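/- arXiv:2312.07918 — 4 statements merged into one kernel-verified Lean document; each statement's English description precedes it below -/
import Mathlib

section
/- Let Ω ⊆ ℝⁿ be a nonempty open connected set, α ∈ (0,1), and let φ: Ω → ℂ^N be a map of class C^{1,α}, not identically zero, satisfying the Dirac equation Dφ(x) = V(φ(x)) for all x ∈ Ω, where V: ℂ^N → ℂ^N satisfies V(0) = 0 and is Lipschitz on some neighborhood of 0 in ℂ^N. Then the nodal set Z(φ) = {x ∈ Ω : φ(x) = 0} has Hausdorff dimension at most n − 2. -/
open MeasureTheory

/-- The Euclidean Dirac operator `Dφ = Σ_j γ_j ∂_j φ` associated to Clifford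
matrices `γ_1, …, γ_n`. -/
noncomputable def dirac {n N : ℕ} (γ : Fin n → Matrix (Fin N) (Fin N) ℂ)
    (φ : EuclideanSpace ℝ (Fin n) → EuclideanSpace ℂ (Fin N))
    (x : EuclideanSpace ℝ (Fin n)) : EuclideanSpace ℂ (Fin N) :=
  (WithLp.equiv 2 (Fin N → ℂ)).symm
    (∑ j, (γ j).mulVec
      (WithLp.equiv 2 (Fin N → ℂ) (fderiv ℝ φ x (EuclideanSpace.single j 1))))

/-- `φ` is of class `C^{1,α}` on `s`: continuously differentiable with `α`-Hölder
continuous derivative. -/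
def IsC1Holder {n N : ℕ} (α : ℝ)
    (φ : EuclideanSpace ℝ (Fin n) → EuclideanSpace ℂ (Fin N))
    (s : Set (EuclideanSpace ℝ (Fin n))) : Prop :=
  ContDiffOn ℝ 1 φ s ∧ ∃ C : NNReal, HolderOnWith C α.toNNReal (fun x => fderiv ℝ φ x) s

section Clifford

open Set Filter Topology Metric
open scoped RealInnerProductSpace

variable {n : ℕ} {F : Type*} [NormedAddCommGroup F] [InnerProductSpace ℝ F]

/-- A skew-adjoint Clifford multiplication of `ℝⁿ` on a real inner product space. -/
structure IsCliffordMul (c : EuclideanSpace ℝ (Fin n) →L[ℝ] F →L[ℝ] F) : Prop where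
  sq : ∀ v a, c v (c v a) = -(‖v‖ ^ 2 • a)
  skew : ∀ v a b, ⟪c v a, b⟫ = -⟪a, c v b⟫

/-- The Dirac operator of a Clifford multiplication. -/
noncomputable def diracOp (c : EuclideanSpace ℝ (Fin n) →L[ℝ] F →L[ℝ] F)
    (u : EuclideanSpace ℝ (Fin n) → F) (x : EuclideanSpace ℝ (Fin n)) : F :=
  ∑ j, c (EuclideanSpace.single j 1) (fderiv ℝ u x (EuclideanSpace.single j 1))

variable {c : EuclideanSpace ℝ (Fin n) →L[ℝ] F →L[ℝ] F}

theorem IsCliffordMul.anticomm (hc : IsCliffordMul c) (v w : EuclideanSpace ℝ (Fin n)) (a : F) :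
    c v (c w a) + c w (c v a) = -((2 * ⟪v, w⟫) • a) := by
  have h := hc.sq (v + w) a
  have e : ‖v + w‖ ^ 2 = ‖v‖ ^ 2 + 2 * ⟪v, w⟫ + ‖w‖ ^ 2 := norm_add_sq_real v w
  rw [e] at h
  simp only [map_add, _root_.add_apply, add_smul, hc.sq v, hc.sq w] at h
  rw [← sub_eq_zero] at h ⊢
  rw [← h]
  abel

theorem IsCliffordMul.norm_apply (hc : IsCliffordMul c) (v : EuclideanSpace ℝ (Fin n)) (a : F) :
    ‖c v a‖ = ‖v‖ * ‖a‖ := by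
  have h : ‖c v a‖ ^ 2 = (‖v‖ * ‖a‖) ^ 2 := by
    rw [← real_inner_self_eq_norm_sq, hc.skew, hc.sq, inner_neg_right, inner_smul_right,
      real_inner_self_eq_norm_sq]
    ring
  exact (pow_left_inj₀ (norm_nonneg _) (by positivity) two_ne_zero).1 h

theorem sum_coord_smul_single (x : EuclideanSpace ℝ (Fin n)) :
    ∑ j, x j • EuclideanSpace.single j (1 : ℝ) = x := by
  have := (EuclideanSpace.basisFun (Fin n) ℝ).sum_repr x
  simpa using this

theorem diracOp_smul {f : EuclideanSpace ℝ (Fin n) → ℝ} {u : EuclideanSpace ℝ (Fin n) → F}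
    {x : EuclideanSpace ℝ (Fin n)} (hf : DifferentiableAt ℝ f x) (hu : DifferentiableAt ℝ u x) :
    diracOp c (fun y => f y • u y) x = f x • diracOp c u x + c (gradient f x) (u x) := by
  have e : gradient f x = ∑ j, fderiv ℝ f x (EuclideanSpace.single j 1) •
      EuclideanSpace.single j (1 : ℝ) := by
    rw [← sum_coord_smul_single (gradient f x)]
    refine Finset.sum_congr rfl fun j _ => ?_
    congr 1
    have : ⟪gradient f x, EuclideanSpace.single j (1 : ℝ)⟫
        = fderiv ℝ f x (EuclideanSpace.single j 1) := by
      rw [gradient, InnerProductSpace.toDual_symm_apply]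
    rw [← this, EuclideanSpace.inner_single_right]
    simp
  rw [e]
  simp only [diracOp, fderiv_fun_smul hf hu, Finset.smul_sum, map_sum, ← Finset.sum_add_distrib,
    _root_.add_apply, _root_.smul_apply, map_add, map_smul,
    ContinuousLinearMap.smulRight_apply, _root_.sum_apply]

theorem norm_gradient (f : EuclideanSpace ℝ (Fin n) → ℝ) (x : EuclideanSpace ℝ (Fin n)) :
    ‖gradient f x‖ = ‖fderiv ℝ f x‖ := by
  rw [gradient, LinearIsometryEquiv.norm_map]

theorem continuous_diracOp {u : EuclideanSpace ℝ (Fin n) → F} (hu : ContDiff ℝ 1 u) :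
    Continuous (diracOp c u) := by
  have := hu.continuous_fderiv one_ne_zero
  unfold diracOp
  fun_prop

end Clifford

section Integration

open Set Filter Topology Metric
open scoped RealInnerProductSpace

variable {n : ℕ} {F : Type*} [NormedAddCommGroup F] [NormedSpace ℝ F]

theorem integral_fderiv_apply_eq_zero {f : EuclideanSpace ℝ (Fin n) → F} (hf : ContDiff ℝ 1 f)
    (hs : HasCompactSupport f) (v : EuclideanSpace ℝ (Fin n)) :
    ∫ x, fderiv ℝ f x v = 0 := by
  have hd : Continuous fun x => fderiv ℝ f x v :=
    (hf.continuous_fderiv one_ne_zero).clm_apply continuous_const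
  have hds : HasCompactSupport fun x => fderiv ℝ f x v := hs.fderiv_apply ℝ v
  have := integral_smul_fderiv_eq_neg_fderiv_smul_of_integrable (𝕜 := ℝ) (μ := volume)
    (f := fun _ : EuclideanSpace ℝ (Fin n) => (1 : ℝ)) (g := f) (v := v) (by simp)
    (by simpa using hd.integrable_of_hasCompactSupport hds)
    (by simpa using hf.continuous.integrable_of_hasCompactSupport hs)
    (by fun_prop) (fun x _ => hf.differentiable one_ne_zero x)
  simpa using this

end Integration

section Punctured

open Set Filter Topology Metric
open scoped RealInnerProductSpace

variable {n : ℕ} {F : Type*} [NormedAddCommGroup F] [InnerProductSpace ℝ F]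

/-- `C¹` maps with compact support in the punctured space. -/
structure IsC1Punctured {F : Type*} [NormedAddCommGroup F] [NormedSpace ℝ F]
    (w : EuclideanSpace ℝ (Fin n) → F) : Prop where
  contDiff : ContDiff ℝ 1 w
  hasCompactSupport : HasCompactSupport w
  zero_notMem : (0 : EuclideanSpace ℝ (Fin n)) ∉ tsupport w

theorem IsC1Punctured.eventually_zero {w : EuclideanSpace ℝ (Fin n) → F}
    (hw : IsC1Punctured w) : w =ᶠ[𝓝 0] 0 :=
  notMem_tsupport_iff_eventuallyEq.1 hw.zero_notMem

theorem IsC1Punctured.fderiv_zero {w : EuclideanSpace ℝ (Fin n) → F}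
    (hw : IsC1Punctured w) : fderiv ℝ w 0 = 0 := by
  rw [hw.eventually_zero.fderiv_eq]; simp

theorem IsC1Punctured.smul {w : EuclideanSpace ℝ (Fin n) → F} (hw : IsC1Punctured w)
    {a : EuclideanSpace ℝ (Fin n) → ℝ} (ha : ∀ x, x ≠ 0 → ContDiffAt ℝ 1 a x) :
    IsC1Punctured fun x => a x • w x where
  contDiff := contDiff_iff_contDiffAt.2 fun x => by
    by_cases hx : x = 0
    · subst hx
      have : (fun x => a x • w x) =ᶠ[𝓝 0] fun _ => 0 := by
        filter_upwards [hw.eventually_zero] with x hx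
        simp [hx]
      exact contDiffAt_const.congr_of_eventuallyEq this
    · exact (ha x hx).smul hw.contDiff.contDiffAt
  hasCompactSupport := hw.hasCompactSupport.smul_left
  zero_notMem h := hw.zero_notMem (tsupport_smul_subset_right a w h)

theorem IsC1Punctured.inner {v w : EuclideanSpace ℝ (Fin n) → F} (hv : IsC1Punctured v)
    (hw : IsC1Punctured w) : IsC1Punctured fun x => ⟪v x, w x⟫ where
  contDiff := hv.contDiff.inner ℝ hw.contDiff
  hasCompactSupport := hw.hasCompactSupport.mono fun x hx h => hx (by simp [h])
  zero_notMem h := hw.zero_notMem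
    (closure_mono (Function.support_subset_iff'.2 fun x hx => by
      simp [Function.notMem_support.1 hx]) h)

theorem integrable_mul_of_zero_notMem_tsupport {a g : EuclideanSpace ℝ (Fin n) → ℝ}
    (ha : ∀ x, x ≠ 0 → ContinuousAt a x) (hg : Continuous g)
    {w : EuclideanSpace ℝ (Fin n) → F} (hw : IsC1Punctured w)
    (hgw : ∀ x ∉ tsupport w, g x = 0) : Integrable fun x => a x * g x := by
  have hs : tsupport g ⊆ tsupport w :=
    closure_minimal (fun x hx => by_contra fun h => hx (hgw x h)) (isClosed_tsupport w)
  refine Continuous.integrable_of_hasCompactSupport (continuous_iff_continuousAt.2 fun x => ?_) ?_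
  · by_cases hx : x = 0
    · subst hx
      have : (fun x => a x * g x) =ᶠ[𝓝 0] fun _ => 0 := by
        filter_upwards [notMem_tsupport_iff_eventuallyEq.1 fun h => hw.zero_notMem (hs h)] with x hx
        simp [hx]
      exact continuousAt_const.congr this.symm
    · exact (ha x hx).mul hg.continuousAt
  · exact (hw.hasCompactSupport.mono' (subset_closure.trans hs)).mul_left

theorem fderiv_eq_zero_of_notMem_tsupport {w : EuclideanSpace ℝ (Fin n) → F}
    {x : EuclideanSpace ℝ (Fin n)} (hx : x ∉ tsupport w) : fderiv ℝ w x = 0 := by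
  rw [(notMem_tsupport_iff_eventuallyEq.1 hx).fderiv_eq]; simp

theorem hasFDerivAt_norm_of_ne_zero {x : EuclideanSpace ℝ (Fin n)} (hx : x ≠ 0) :
    HasFDerivAt (fun y : EuclideanSpace ℝ (Fin n) => ‖y‖) (‖x‖⁻¹ • innerSL ℝ x) x := by
  have h := (hasStrictFDerivAt_norm_sq x).hasFDerivAt.sqrt (by positivity)
  simp only [Real.sqrt_sq (norm_nonneg _)] at h
  refine h.congr_fderiv ?_
  ext v
  simp
  field_simp

/-- The dilation-invariant density `‖x‖⁻ⁿ`. -/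
noncomputable def invDensity (x : EuclideanSpace ℝ (Fin n)) : ℝ := (‖x‖ ^ n)⁻¹

theorem invDensity_nonneg (x : EuclideanSpace ℝ (Fin n)) : 0 ≤ invDensity x := by
  unfold invDensity; positivity

theorem contDiffAt_invDensity {x : EuclideanSpace ℝ (Fin n)} (hx : x ≠ 0) :
    ContDiffAt ℝ 1 (invDensity (n := n)) x :=
  ((contDiffAt_norm ℝ hx).pow n).inv (by positivity)

theorem hasFDerivAt_invDensity {x : EuclideanSpace ℝ (Fin n)} (hx : x ≠ 0) :
    HasFDerivAt (invDensity (n := n)) (-(n * invDensity x / ‖x‖ ^ 2) • innerSL ℝ x) x := by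
  have hx' : ‖x‖ ≠ 0 := norm_ne_zero_iff.2 hx
  have h := (hasDerivAt_inv (pow_ne_zero n hx')).comp_hasFDerivAt x
    ((hasFDerivAt_norm_of_ne_zero hx).pow n)
  refine h.congr_fderiv ?_
  ext v
  simp only [invDensity, _root_.smul_apply, innerSL_apply_apply, smul_eq_mul]
  rcases n with _ | m
  · simp
  · simp only [Nat.add_sub_cancel, nsmul_eq_mul]
    field_simp
    ring

theorem integral_sum_fderiv_eq_zero {X : Fin n → EuclideanSpace ℝ (Fin n) → ℝ}
    (hX : ∀ j, ContDiff ℝ 1 (X j)) (hs : ∀ j, HasCompactSupport (X j)) :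
    ∫ x, ∑ j, fderiv ℝ (X j) x (EuclideanSpace.single j 1) = 0 := by
  rw [integral_finsetSum]
  · exact Finset.sum_eq_zero fun j _ => integral_fderiv_apply_eq_zero (hX j) (hs j) _
  · intro j _
    exact Continuous.integrable_of_hasCompactSupport
      (((hX j).continuous_fderiv one_ne_zero).clm_apply continuous_const)
      ((hs j).fderiv_apply ℝ _)

theorem fderiv_apply_self_eq_sum (f : EuclideanSpace ℝ (Fin n) →L[ℝ] F)
    (x : EuclideanSpace ℝ (Fin n)) :
    f x = ∑ j, x j • f (EuclideanSpace.single j 1) := by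
  conv_lhs => rw [← sum_coord_smul_single x]
  simp

/-- The Euler field is divergence free for `invDensity`. -/
theorem integral_invDensity_mul_fderiv_self {f : EuclideanSpace ℝ (Fin n) → ℝ}
    (hf : IsC1Punctured f) : ∫ x, invDensity x * fderiv ℝ f x x = 0 := by
  have hC (j : Fin n) : IsC1Punctured fun x => (x j * invDensity x) • f x :=
    hf.smul fun x hx => (contDiff_piLp_apply 2).contDiffAt.mul (contDiffAt_invDensity hx)
  rw [← integral_sum_fderiv_eq_zero (fun j => (hC j).contDiff) fun j => (hC j).hasCompactSupport]
  congr 1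
  ext x
  by_cases hx : x = 0
  · subst hx
    simp only [(hC _).fderiv_zero, hf.fderiv_zero]
    simp
  have hcoord (j : Fin n) : HasFDerivAt (fun y : EuclideanSpace ℝ (Fin n) => y j)
      (EuclideanSpace.proj j : _ →L[ℝ] ℝ) x := (EuclideanSpace.proj j : _ →L[ℝ] ℝ).hasFDerivAt
  have hd (j : Fin n) : HasFDerivAt (fun x => (x j * invDensity x) • f x) _ x :=
    ((hcoord j).mul (hasFDerivAt_invDensity hx)).smul
    (hf.contDiff.differentiable one_ne_zero x).hasFDerivAt
  have hcomp (j : Fin n) : fderiv ℝ (fun x => (x j * invDensity x) • f x) x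
      (EuclideanSpace.single j 1) = invDensity x * (x j * fderiv ℝ f x (EuclideanSpace.single j 1))
        + (invDensity x * f x - (n * invDensity x / ‖x‖ ^ 2) * f x * (x j) ^ 2) := by
    rw [(hd j).fderiv]
    simp [EuclideanSpace.inner_single_right]
    ring
  simp only [hcomp]
  rw [Finset.sum_add_distrib, Finset.sum_sub_distrib, ← Finset.mul_sum, ← Finset.mul_sum,
    ← Finset.mul_sum, ← EuclideanSpace.real_norm_sq_eq, fderiv_apply_self_eq_sum (fderiv ℝ f x) x]
  have : ‖x‖ ≠ 0 := norm_ne_zero_iff.2 hx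
  simp
  field_simp
  ring

end Punctured

section Angular

open Set Filter Topology Metric
open scoped RealInnerProductSpace

variable {n : ℕ} {F : Type*} [NormedAddCommGroup F] [InnerProductSpace ℝ F]
  {c : EuclideanSpace ℝ (Fin n) →L[ℝ] F →L[ℝ] F}

/-- The angular part of the Dirac operator. -/
noncomputable def angularOp (c : EuclideanSpace ℝ (Fin n) →L[ℝ] F →L[ℝ] F)
    (w : EuclideanSpace ℝ (Fin n) → F) (x : EuclideanSpace ℝ (Fin n)) : F :=
  c x (diracOp c w x) + fderiv ℝ w x x

theorem continuous_angularOp {w : EuclideanSpace ℝ (Fin n) → F} (hw : ContDiff ℝ 1 w) :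
    Continuous (angularOp c w) := by
  have := hw.continuous_fderiv one_ne_zero
  have := continuous_diracOp (c := c) hw
  unfold angularOp
  fun_prop

theorem angularOp_eq_zero {w : EuclideanSpace ℝ (Fin n) → F} {x : EuclideanSpace ℝ (Fin n)}
    (h : fderiv ℝ w x = 0) : angularOp c w x = 0 := by
  simp [angularOp, diracOp, h]

theorem sum_clifford_swap (hc : IsCliffordMul c) {w : EuclideanSpace ℝ (Fin n) → F}
    (x : EuclideanSpace ℝ (Fin n)) :
    ∑ j, c (EuclideanSpace.single j 1) (c x (fderiv ℝ w x (EuclideanSpace.single j 1))) =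
      -c x (diracOp c w x) - (2 : ℝ) • fderiv ℝ w x x := by
  rw [diracOp, map_sum, fderiv_apply_self_eq_sum (fderiv ℝ w x) x, Finset.smul_sum,
    ← Finset.sum_neg_distrib, ← Finset.sum_sub_distrib]
  refine Finset.sum_congr rfl fun j _ => ?_
  have h := hc.anticomm (EuclideanSpace.single j 1) x (fderiv ℝ w x (EuclideanSpace.single j 1))
  rw [EuclideanSpace.inner_single_left] at h
  simp only [map_one, one_mul] at h
  rw [eq_sub_iff_add_eq, eq_neg_iff_add_eq_zero, add_right_comm, h, smul_smul]
  simp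

theorem sum_clifford_sq (hc : IsCliffordMul c) (a : F) :
    ∑ j : Fin n, c (EuclideanSpace.single j 1) (c (EuclideanSpace.single j 1) a) =
      -((n : ℝ) • a) := by
  simp [hc.sq, ← Nat.cast_smul_eq_nsmul ℝ]

theorem sum_inner_clifford (hc : IsCliffordMul c) {v : EuclideanSpace ℝ (Fin n) → F}
    (x : EuclideanSpace ℝ (Fin n)) (b : F) :
    ∑ j, ⟪fderiv ℝ v x (EuclideanSpace.single j 1), c (EuclideanSpace.single j 1) (c x b)⟫ =
      ⟪c x (diracOp c v x), b⟫ := by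
  rw [hc.skew, diracOp, sum_inner, ← Finset.sum_neg_distrib]
  refine Finset.sum_congr rfl fun j _ => ?_
  rw [hc.skew, neg_neg]

theorem integral_angularOp_comm (hc : IsCliffordMul c) {v w : EuclideanSpace ℝ (Fin n) → F}
    (hv : IsC1Punctured v) (hw : IsC1Punctured w) :
    ∫ x, invDensity x * ⟪angularOp c v x, w x⟫ = ∫ x, invDensity x * ⟪v x, angularOp c w x⟫ := by
  have hW (j : Fin n) : IsC1Punctured fun x =>
      invDensity x • ⟪v x, c (EuclideanSpace.single j 1) (c x (w x))⟫ := by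
    refine IsC1Punctured.smul (hv.inner ⟨?_, ?_, ?_⟩) fun x hx => contDiffAt_invDensity hx
    · exact (c _).contDiff.comp (c.contDiff.clm_apply hw.contDiff)
    · exact hw.hasCompactSupport.mono fun x hx h => hx (by simp [h])
    · exact fun h => hw.zero_notMem (closure_mono (Function.support_subset_iff'.2 fun x hx => by
        simp [Function.notMem_support.1 hx]) h)
  have h1 := integral_sum_fderiv_eq_zero (fun j => (hW j).contDiff) fun j =>
    (hW j).hasCompactSupport
  have h2 := integral_invDensity_mul_fderiv_self (hv.inner hw)
  have hdv (x) := (hv.contDiff.differentiable one_ne_zero x).hasFDerivAt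
  have hdw (x) := (hw.contDiff.differentiable one_ne_zero x).hasFDerivAt
  have e1 (x : EuclideanSpace ℝ (Fin n)) :
      ∑ j, fderiv ℝ (fun x => invDensity x • ⟪v x, c (EuclideanSpace.single j 1) (c x (w x))⟫) x
        (EuclideanSpace.single j 1) = invDensity x * (⟪c x (diracOp c v x), w x⟫ +
          ⟪v x, -c x (diracOp c w x) - (2 : ℝ) • fderiv ℝ w x x⟫) := by
    by_cases hx : x = 0
    · subst hx
      simp only [(hW _).fderiv_zero]
      simp [diracOp, hv.fderiv_zero, hw.fderiv_zero]
    have key (j : Fin n) : fderiv ℝ (fun x => invDensity x •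
        ⟪v x, c (EuclideanSpace.single j 1) (c x (w x))⟫) x (EuclideanSpace.single j 1) =
        invDensity x * (⟪fderiv ℝ v x (EuclideanSpace.single j 1),
            c (EuclideanSpace.single j 1) (c x (w x))⟫ +
          ⟪v x, c (EuclideanSpace.single j 1)
            (c x (fderiv ℝ w x (EuclideanSpace.single j 1)))⟫) +
        (invDensity x * ⟪v x, c (EuclideanSpace.single j 1)
            (c (EuclideanSpace.single j 1) (w x))⟫ -
        (n * invDensity x / ‖x‖ ^ 2) *
          ⟪v x, c (x j • EuclideanSpace.single j 1) (c x (w x))⟫) := by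
      have hcw : HasFDerivAt (fun x => c (EuclideanSpace.single j 1) (c x (w x))) _ x :=
        (c (EuclideanSpace.single j 1)).hasFDerivAt.comp x (c.hasFDerivAt.clm_apply (hdw x))
      have : HasFDerivAt (fun x => invDensity x •
        ⟪v x, c (EuclideanSpace.single j 1) (c x (w x))⟫) _ x :=
        (hasFDerivAt_invDensity hx).smul ((hdv x).inner ℝ hcw)
      rw [this.fderiv]
      simp [EuclideanSpace.inner_single_right, inner_add_right, real_inner_smul_right]
      ring
    simp only [key]
    rw [Finset.sum_add_distrib, Finset.sum_sub_distrib, ← Finset.mul_sum, ← Finset.mul_sum,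
      ← Finset.mul_sum, Finset.sum_add_distrib, sum_inner_clifford hc, ← inner_sum,
      ← inner_sum, ← inner_sum, sum_clifford_swap hc, sum_clifford_sq hc,
      ← _root_.sum_apply, ← map_sum, sum_coord_smul_single, hc.sq]
    have : ‖x‖ ≠ 0 := norm_ne_zero_iff.2 hx
    simp only [inner_neg_right, real_inner_smul_right]
    field_simp
    ring
  have e2 (x : EuclideanSpace ℝ (Fin n)) : fderiv ℝ (fun x => ⟪v x, w x⟫) x x =
      ⟪v x, fderiv ℝ w x x⟫ + ⟪fderiv ℝ v x x, w x⟫ := by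
    rw [((hdv x).inner ℝ (hdw x)).fderiv]
    simp
  simp only [e1] at h1
  simp only [e2] at h2
  have hvc := hv.contDiff.continuous
  have hwc := hw.contDiff.continuous
  have hvc' := hv.contDiff.continuous_fderiv one_ne_zero
  have hwc' := hw.contDiff.continuous_fderiv one_ne_zero
  have hvD := continuous_diracOp (c := c) hv.contDiff
  have hwD := continuous_diracOp (c := c) hw.contDiff
  have hρ (x : EuclideanSpace ℝ (Fin n)) (hx : x ≠ 0) : ContinuousAt (invDensity (n := n)) x :=
    (contDiffAt_invDensity hx).continuousAt
  have hΓv := continuous_angularOp (c := c) hv.contDiff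
  have hΓw := continuous_angularOp (c := c) hw.contDiff
  have z {x} (hx : x ∉ tsupport w) : w x = 0 ∧ fderiv ℝ w x = 0 :=
    ⟨image_eq_zero_of_notMem_tsupport hx, fderiv_eq_zero_of_notMem_tsupport hx⟩
  rw [← sub_eq_zero, ← integral_sub
    (integrable_mul_of_zero_notMem_tsupport hρ (by fun_prop) hw fun x hx => by simp [z hx])
    (integrable_mul_of_zero_notMem_tsupport hρ (by fun_prop) hw fun x hx => by
      simp [angularOp_eq_zero (z hx).2])]
  have h := congrArg₂ (· + ·) h1 h2
  beta_reduce at h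
  rw [← integral_add
    (integrable_mul_of_zero_notMem_tsupport hρ (by fun_prop) hw fun x hx => by
      simp [z hx, diracOp])
    (integrable_mul_of_zero_notMem_tsupport hρ (by fun_prop) hw fun x hx => by simp [z hx]),
    add_zero] at h
  rw [← h]
  congr 1
  ext x
  simp only [angularOp, inner_add_left, inner_add_right, inner_sub_right, inner_neg_right,
    real_inner_smul_right]
  ring

end Angular

section Carleman

open Set Filter Topology Metric
open scoped RealInnerProductSpace

variable {n : ℕ} {F : Type*} [NormedAddCommGroup F] [InnerProductSpace ℝ F]
  {c : EuclideanSpace ℝ (Fin n) →L[ℝ] F →L[ℝ] F}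

theorem IsC1Punctured.comp_dilation {w : EuclideanSpace ℝ (Fin n) → F} (hw : IsC1Punctured w)
    {s : ℝ} (hs : s ≠ 0) : IsC1Punctured fun x => w (s • x) where
  contDiff := hw.contDiff.comp (contDiff_const_smul s)
  hasCompactSupport := hw.hasCompactSupport.comp_smul hs
  zero_notMem := by
    rw [notMem_tsupport_iff_eventuallyEq]
    have : Tendsto (fun x : EuclideanSpace ℝ (Fin n) => s • x) (𝓝 0) (𝓝 0) := by
      simpa using (continuous_const_smul s).tendsto (0 : EuclideanSpace ℝ (Fin n))
    exact this.eventually hw.eventually_zero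

theorem fderiv_dilation {w : EuclideanSpace ℝ (Fin n) → F} (hw : ContDiff ℝ 1 w) (s : ℝ)
    (x : EuclideanSpace ℝ (Fin n)) :
    fderiv ℝ (fun x => w (s • x)) x = s • fderiv ℝ w (s • x) := by
  have := ((hw.differentiable one_ne_zero (s • x)).hasFDerivAt).comp x
    ((hasFDerivAt_id x).const_smul s)
  refine (this.fderiv).trans ?_
  ext v
  simp

theorem angularOp_dilation {w : EuclideanSpace ℝ (Fin n) → F} (hw : ContDiff ℝ 1 w) (s : ℝ)
    (x : EuclideanSpace ℝ (Fin n)) :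
    angularOp c (fun x => w (s • x)) x = angularOp c w (s • x) := by
  simp [angularOp, diracOp, fderiv_dilation hw]

theorem integral_inner_dilation (hc : IsCliffordMul c) {w : EuclideanSpace ℝ (Fin n) → F}
    (hw : IsC1Punctured w) {s : ℝ} (hs : 0 < s) :
    ∫ x, invDensity x * ⟪w (s • x), angularOp c w x⟫ =
      ∫ x, invDensity x * ⟪w (s⁻¹ • x), angularOp c w x⟫ := by
  rw [← integral_angularOp_comm hc (hw.comp_dilation hs.ne') hw]
  have h := Measure.integral_comp_smul_of_nonneg (μ := volume)
    (fun x => invDensity x * ⟪w (s⁻¹ • x), angularOp c w x⟫) s (hR := hs.le)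
  have h' : ∫ x, invDensity x * ⟪w (s⁻¹ • x), angularOp c w x⟫ =
      s ^ n * ∫ x, invDensity (s • x) * ⟪w (s⁻¹ • s • x), angularOp c w (s • x)⟫ := by
    rw [h]
    simp
    field_simp
  rw [h', ← integral_const_mul]
  congr 1
  ext x
  rw [angularOp_dilation hw.contDiff, smul_smul, inv_mul_cancel₀ hs.ne', one_smul, invDensity,
    invDensity, norm_smul, Real.norm_of_nonneg hs.le, real_inner_comm, mul_pow, mul_inv]
  field_simp

theorem integral_inner_fderiv_angularOp (hc : IsCliffordMul c) {w : EuclideanSpace ℝ (Fin n) → F}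
    (hw : IsC1Punctured w) : ∫ x, invDensity x * ⟪fderiv ℝ w x x, angularOp c w x⟫ = 0 := by
  have hρ (x : EuclideanSpace ℝ (Fin n)) (hx : x ≠ 0) : ContinuousAt (invDensity (n := n)) x :=
    (contDiffAt_invDensity hx).continuousAt
  have hwc := hw.contDiff.continuous
  have hwc' := hw.contDiff.continuous_fderiv one_ne_zero
  have hΓw := continuous_angularOp (c := c) hw.contDiff
  have z {x} (hx : x ∉ tsupport w) : angularOp c w x = 0 :=
    angularOp_eq_zero (fderiv_eq_zero_of_notMem_tsupport hx)
  obtain ⟨C, hC⟩ := (hw.hasCompactSupport.fderiv ℝ).exists_bound_of_continuous hwc'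
  have hder := (hasDerivAt_integral_of_dominated_loc_of_deriv_le (μ := volume) (x₀ := (1 : ℝ))
    (F := fun s x => invDensity x * ⟪w (s • x), angularOp c w x⟫)
    (F' := fun s x => invDensity x * ⟪fderiv ℝ w (s • x) x, angularOp c w x⟫)
    (bound := fun x => invDensity x * (C * ‖x‖ * ‖angularOp c w x‖)) univ_mem
    (Eventually.of_forall fun s => (integrable_mul_of_zero_notMem_tsupport hρ (by fun_prop) hw
      fun x hx => by simp [z hx]).aestronglyMeasurable)
    (integrable_mul_of_zero_notMem_tsupport hρ (by fun_prop) hw fun x hx => by simp [z hx])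
    (integrable_mul_of_zero_notMem_tsupport hρ (by fun_prop) hw
      fun x hx => by simp [z hx]).aestronglyMeasurable
    (Eventually.of_forall fun x s _ => by
      rw [norm_mul, Real.norm_of_nonneg (invDensity_nonneg x)]
      refine mul_le_mul_of_nonneg_left ?_ (invDensity_nonneg x)
      refine (norm_inner_le_norm _ _).trans (mul_le_mul_of_nonneg_right ?_ (norm_nonneg _))
      exact (ContinuousLinearMap.le_opNorm _ _).trans
        (mul_le_mul_of_nonneg_right (hC _) (norm_nonneg _)))
    (integrable_mul_of_zero_notMem_tsupport hρ (by fun_prop) hw fun x hx => by simp [z hx])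
    (Eventually.of_forall fun x s _ => by
      have h1 : HasDerivAt (fun s : ℝ => w (s • x)) (fderiv ℝ w (s • x) x) s := by
        have := ((hw.contDiff.differentiable one_ne_zero (s • x)).hasFDerivAt).comp_hasDerivAt s
          ((hasDerivAt_id s).smul_const x)
        simpa [Function.comp_def] using this
      have h2 := (h1.inner ℝ (hasDerivAt_const s (angularOp c w x))).const_mul (invDensity x)
      simpa using h2)).2
  simp only [one_smul] at hder
  set B := fun s : ℝ => ∫ x, invDensity x * ⟪w (s • x), angularOp c w x⟫ with hB
  have h1 : HasDerivAt (fun s => B s⁻¹) (-∫ x, invDensity x * ⟪fderiv ℝ w x x, angularOp c w x⟫)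
      1 := by
    have hi : HasDerivAt (fun s : ℝ => s⁻¹) (-1) 1 := by
      simpa using hasDerivAt_inv (one_ne_zero : (1 : ℝ) ≠ 0)
    have := HasDerivAt.comp (h₂ := B) (1 : ℝ) (by simpa using hder) hi
    simpa [Function.comp_def] using this
  have h2 : B =ᶠ[𝓝 1] fun s => B s⁻¹ := by
    filter_upwards [lt_mem_nhds one_pos] with s hs
    exact integral_inner_dilation hc hw hs
  have := (h1.congr_of_eventuallyEq h2).unique hder
  linarith

/-- The Carleman weight `‖x‖^{-τ} e^{τ a ‖x‖²}`. -/
noncomputable def carlemanWeight (a τ : ℝ) (x : EuclideanSpace ℝ (Fin n)) : ℝ :=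
  Real.exp (τ * (a * ‖x‖ ^ 2 - Real.log ‖x‖))

theorem hasFDerivAt_carlemanWeight (a τ : ℝ) {x : EuclideanSpace ℝ (Fin n)} (hx : x ≠ 0) :
    HasFDerivAt (carlemanWeight a τ)
      ((carlemanWeight a τ x * (τ * (2 * a - (‖x‖ ^ 2)⁻¹))) • innerSL ℝ x) x := by
  have hx' : ‖x‖ ≠ 0 := norm_ne_zero_iff.2 hx
  have h := ((((hasStrictFDerivAt_norm_sq x).hasFDerivAt.const_mul a).sub
    ((hasFDerivAt_norm_of_ne_zero hx).log hx')).const_mul τ).exp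
  refine h.congr_fderiv ?_
  ext v
  simp [carlemanWeight]
  field_simp

theorem contDiffAt_carlemanWeight (a τ : ℝ) {x : EuclideanSpace ℝ (Fin n)} (hx : x ≠ 0) :
    ContDiffAt ℝ 1 (carlemanWeight a τ) x :=
  (contDiffAt_const.mul ((contDiffAt_const.mul (contDiff_norm_sq ℝ).contDiffAt).sub
    ((contDiffAt_norm ℝ hx).log (norm_ne_zero_iff.2 hx)))).exp

theorem carleman_estimate (hc : IsCliffordMul c) {u : EuclideanSpace ℝ (Fin n) → F}
    (hu : IsC1Punctured u) (a : ℝ) (τ : ℝ) :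
    4 * a * τ * ∫ x, (invDensity x * (‖x‖ ^ 2 * carlemanWeight a τ x ^ 2)) * ‖u x‖ ^ 2 ≤
      ∫ x, (invDensity x * (‖x‖ ^ 2 * carlemanWeight a τ x ^ 2)) * ‖diracOp c u x‖ ^ 2 := by
  set W := carlemanWeight (n := n) a τ with hW
  obtain ⟨w, hwdef⟩ : ∃ w, w = fun x => W x • u x := ⟨_, rfl⟩
  have hw : IsC1Punctured w :=
    hwdef ▸ hu.smul fun x hx => contDiffAt_carlemanWeight a τ hx
  set p : EuclideanSpace ℝ (Fin n) → ℝ := fun x => 2 * a * ‖x‖ ^ 2 - 1 with hp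
  have hpd : ContDiff ℝ 1 p := (contDiff_const.mul (contDiff_norm_sq ℝ)).sub contDiff_const
  have hpc := hpd.continuous
  have hρ (x : EuclideanSpace ℝ (Fin n)) (hx : x ≠ 0) : ContinuousAt (invDensity (n := n)) x :=
    (contDiffAt_invDensity hx).continuousAt
  have hρW (x : EuclideanSpace ℝ (Fin n)) (hx : x ≠ 0) :
      ContinuousAt (fun x => invDensity x * (‖x‖ ^ 2 * W x ^ 2)) x :=
    (hρ x hx).mul ((continuous_norm.pow 2).continuousAt.mul
      ((contDiffAt_carlemanWeight a τ hx).continuousAt.pow 2))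
  have huc := hu.contDiff.continuous
  have hud := continuous_diracOp (c := c) hu.contDiff
  have hwc := hw.contDiff.continuous
  have hwc' := hw.contDiff.continuous_fderiv one_ne_zero
  have hΓw := continuous_angularOp (c := c) hw.contDiff
  have zu {x} (hx : x ∉ tsupport u) : u x = 0 ∧ diracOp c u x = 0 :=
    ⟨image_eq_zero_of_notMem_tsupport hx, by
      simp [diracOp, fderiv_eq_zero_of_notMem_tsupport hx]⟩
  have z {x} (hx : x ∉ tsupport w) : w x = 0 ∧ fderiv ℝ w x = 0 :=
    ⟨image_eq_zero_of_notMem_tsupport hx, fderiv_eq_zero_of_notMem_tsupport hx⟩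
  have i1 := integral_inner_fderiv_angularOp hc hw
  have i2 := integral_invDensity_mul_fderiv_self
    ((hw.inner hw).smul fun x _ => hpd.contDiffAt (x := x))
  have hpw (x : EuclideanSpace ℝ (Fin n)) : fderiv ℝ (fun x => p x • ⟪w x, w x⟫) x x =
      4 * a * ‖x‖ ^ 2 * ‖w x‖ ^ 2 + 2 * (p x * ⟪fderiv ℝ w x x, w x⟫) := by
    have hdw := (hw.contDiff.differentiable one_ne_zero x).hasFDerivAt
    have hdp : HasFDerivAt p (a • 2 • 2 • innerSL ℝ x) x := by
      have := (((hasStrictFDerivAt_norm_sq x).hasFDerivAt.const_mul (2 * a)).sub_const 1)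
      refine this.congr_fderiv ?_
      ext v
      simp
      ring
    have : HasFDerivAt (fun x => p x • ⟪w x, w x⟫) _ x := hdp.smul (hdw.inner ℝ hdw)
    rw [this.fderiv]
    simp [real_inner_comm]
    ring
  simp only [hpw] at i2
  have key (x : EuclideanSpace ℝ (Fin n)) :
      τ * (invDensity x * (4 * a * ‖x‖ ^ 2 * ‖w x‖ ^ 2)) -
        τ * (invDensity x * (4 * a * ‖x‖ ^ 2 * ‖w x‖ ^ 2 + 2 * (p x * ⟪fderiv ℝ w x x, w x⟫))) -
        2 * (invDensity x * ⟪fderiv ℝ w x x, angularOp c w x⟫) ≤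
      (invDensity x * (‖x‖ ^ 2 * W x ^ 2)) * ‖diracOp c u x‖ ^ 2 := by
    by_cases hx : x = 0
    · subst hx
      simp [hw.fderiv_zero, hw.eventually_zero.eq_of_nhds]
    have hx' : ‖x‖ ≠ 0 := norm_ne_zero_iff.2 hx
    have e : W x • c x (diracOp c u x) =
        -fderiv ℝ w x x + ((τ * p x) • w x + angularOp c w x) := by
      have hdW : HasFDerivAt W _ x := hasFDerivAt_carlemanWeight a τ hx
      rw [← hW] at hdW
      have hDw : diracOp c w x = W x • diracOp c u x + c (gradient W x) (u x) := by
        rw [hwdef]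
        exact diracOp_smul hdW.differentiableAt (hu.contDiff.differentiable one_ne_zero x)
      have hg : gradient W x = (W x * (τ * (2 * a - (‖x‖ ^ 2)⁻¹))) • x := by
        rw [gradient, hdW.fderiv]
        apply (InnerProductSpace.toDual ℝ _).injective
        ext v
        simp
      rw [angularOp, hDw, hg]
      simp only [map_add, map_smul, _root_.smul_apply, hc.sq, hwdef, hp]
      simp only [← sub_eq_zero (b := _ + _), smul_neg, smul_smul]
      have : W x * (τ * (2 * a - (‖x‖ ^ 2)⁻¹)) * ‖x‖ ^ 2 = τ * (2 * a * ‖x‖ ^ 2 - 1) * W x := by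
        field_simp
      rw [this]
      abel
    have e2 : ‖x‖ ^ 2 * W x ^ 2 * ‖diracOp c u x‖ ^ 2 =
        ‖-fderiv ℝ w x x + ((τ * p x) • w x + angularOp c w x)‖ ^ 2 := by
      rw [← e, norm_smul, hc.norm_apply, mul_pow, mul_pow, Real.norm_eq_abs, sq_abs]
      ring
    rw [mul_assoc (invDensity x) (‖x‖ ^ 2 * W x ^ 2), e2, norm_add_sq_real, inner_neg_left,
      inner_add_right, real_inner_smul_right]
    have h0 := invDensity_nonneg x
    have h3 : 0 ≤ invDensity x * (‖-fderiv ℝ w x x‖ ^ 2 +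
        ‖(τ * p x) • w x + angularOp c w x‖ ^ 2) := by positivity
    linarith
  have I1 : Integrable fun x => invDensity x * (4 * a * ‖x‖ ^ 2 * ‖w x‖ ^ 2) :=
    integrable_mul_of_zero_notMem_tsupport hρ (by fun_prop) hw fun x hx => by simp [z hx]
  have I2 : Integrable fun x => invDensity x *
      (4 * a * ‖x‖ ^ 2 * ‖w x‖ ^ 2 + 2 * (p x * ⟪fderiv ℝ w x x, w x⟫)) :=
    integrable_mul_of_zero_notMem_tsupport hρ (by fun_prop) hw fun x hx => by simp [z hx]
  have I3 : Integrable fun x => invDensity x * ⟪fderiv ℝ w x x, angularOp c w x⟫ :=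
    integrable_mul_of_zero_notMem_tsupport hρ (by fun_prop) hw fun x hx => by simp [z hx]
  have h := integral_mono (((I1.const_mul τ).sub (I2.const_mul τ)).sub (I3.const_mul 2))
    (integrable_mul_of_zero_notMem_tsupport hρW (by fun_prop) hu fun x hx => by simp [zu hx]) key
  rw [integral_sub' ((I1.const_mul τ).sub (I2.const_mul τ)) (I3.const_mul 2),
    integral_sub' (I1.const_mul τ) (I2.const_mul τ)] at h
  simp only [integral_const_mul, i1, i2, mul_zero, sub_zero] at h
  refine le_trans (le_of_eq ?_) h
  rw [← integral_const_mul, ← integral_const_mul]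
  congr 1
  ext x
  rw [hwdef, norm_smul, Real.norm_eq_abs, mul_pow, sq_abs]
  ring

end Carleman

section StrongUniqueContinuation

open Set Filter Topology Metric
open scoped RealInnerProductSpace

variable {n : ℕ} {F : Type*} [NormedAddCommGroup F] [InnerProductSpace ℝ F]
  {c : EuclideanSpace ℝ (Fin n) →L[ℝ] F →L[ℝ] F}

theorem carlemanWeight_le {R τ : ℝ} (hτ : 0 ≤ τ) {x y : EuclideanSpace ℝ (Fin n)} (hy : 0 < ‖y‖)
    (hyx : ‖y‖ ≤ ‖x‖) (hx : ‖x‖ ≤ R) :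
    carlemanWeight (1 / (4 * R ^ 2)) τ x ≤ carlemanWeight (1 / (4 * R ^ 2)) τ y := by
  have hx0 : 0 < ‖x‖ := hy.trans_le hyx
  have hR : 0 < R := hx0.trans_le hx
  refine Real.exp_le_exp.2 (mul_le_mul_of_nonneg_left ?_ hτ)
  have h1 := Real.log_le_sub_one_of_pos (div_pos hy hx0)
  rw [Real.log_div hy.ne' hx0.ne'] at h1
  have h2 : 1 / (4 * R ^ 2) * ‖x‖ ^ 2 - 1 / (4 * R ^ 2) * ‖y‖ ^ 2 ≤ 1 - ‖y‖ / ‖x‖ := by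
    rw [← sub_nonneg]
    have : 1 - ‖y‖ / ‖x‖ - (1 / (4 * R ^ 2) * ‖x‖ ^ 2 - 1 / (4 * R ^ 2) * ‖y‖ ^ 2) =
        (‖x‖ - ‖y‖) * (4 * R ^ 2 - ‖x‖ * (‖x‖ + ‖y‖)) / (4 * R ^ 2 * ‖x‖) := by
      field_simp
      ring
    rw [this]
    refine div_nonneg (mul_nonneg (sub_nonneg.2 hyx) ?_) (by positivity)
    nlinarith
  linarith

theorem carlemanWeight_natCast (a : ℝ) (τ : ℕ) {x : EuclideanSpace ℝ (Fin n)} (hx : x ≠ 0) :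
    carlemanWeight a τ x = Real.exp (τ * (a * ‖x‖ ^ 2)) * (‖x‖ ^ τ)⁻¹ := by
  rw [carlemanWeight, mul_sub, Real.exp_sub, Real.exp_nat_mul (Real.log ‖x‖),
    Real.exp_log (norm_pos_iff.2 hx), div_eq_mul_inv]

/-- Carleman's inequality after absorbing the zeroth order term. -/
theorem carleman_absorbed (hc : IsCliffordMul c) {u : EuclideanSpace ℝ (Fin n) → F}
    (hu : ContDiff ℝ 1 u) {χ : EuclideanSpace ℝ (Fin n) → ℝ} (hχ : IsC1Punctured χ) {K : ℝ}
    (hD : ∀ x, χ x ≠ 0 → ‖diracOp c u x‖ ≤ K * ‖u x‖) {a τ : ℝ} (hτ : K ^ 2 ≤ a * τ) :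
    Integrable (fun x => (invDensity x * (‖x‖ ^ 2 * carlemanWeight a τ x ^ 2)) *
      ‖χ x • u x‖ ^ 2) ∧
    Integrable (fun x => (invDensity x * (‖x‖ ^ 2 * carlemanWeight a τ x ^ 2)) *
      (‖fderiv ℝ χ x‖ ^ 2 * ‖u x‖ ^ 2)) ∧
    a * τ * ∫ x, (invDensity x * (‖x‖ ^ 2 * carlemanWeight a τ x ^ 2)) * ‖χ x • u x‖ ^ 2 ≤
      ∫ x, (invDensity x * (‖x‖ ^ 2 * carlemanWeight a τ x ^ 2)) *
        (‖fderiv ℝ χ x‖ ^ 2 * ‖u x‖ ^ 2) := by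
  have hω (x : EuclideanSpace ℝ (Fin n)) (hx : x ≠ 0) : ContinuousAt
      (fun x => invDensity x * (‖x‖ ^ 2 * carlemanWeight a τ x ^ 2)) x :=
    (contDiffAt_invDensity hx).continuousAt.mul
      ((by fun_prop : ContinuousAt (fun x => ‖x‖ ^ 2) x).mul
      ((contDiffAt_carlemanWeight a τ hx).continuousAt.pow 2))
  have hv : IsC1Punctured fun x => χ x • u x :=
    ⟨hχ.contDiff.smul hu, hχ.hasCompactSupport.smul_right,
      fun h => hχ.zero_notMem (closure_mono (Function.support_smul_subset_left _ _) h)⟩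
  have hu' := hu.continuous
  have hχ' := hχ.contDiff.continuous
  have hχ'' := hχ.contDiff.continuous_fderiv one_ne_zero
  have i1 := integrable_mul_of_zero_notMem_tsupport hω
    (g := fun x => ‖χ x • u x‖ ^ 2) (by fun_prop) hχ
    fun x hx => by simp [image_eq_zero_of_notMem_tsupport hx]
  have i2 := integrable_mul_of_zero_notMem_tsupport hω
    (g := fun x => ‖fderiv ℝ χ x‖ ^ 2 * ‖u x‖ ^ 2) (by fun_prop) hχ
    fun x hx => by simp [fderiv_eq_zero_of_notMem_tsupport hx]
  have i3 := integrable_mul_of_zero_notMem_tsupport hω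
    (g := fun x => ‖diracOp c (fun x => χ x • u x) x‖ ^ 2)
    ((continuous_diracOp hv.contDiff).norm.pow 2) hv
    fun x hx => by simp [diracOp, fderiv_eq_zero_of_notMem_tsupport hx]
  refine ⟨i1, i2, ?_⟩
  have h := carleman_estimate hc hv a τ
  have h2 := integral_mono i3 ((i1.const_mul (2 * K ^ 2)).add (i2.const_mul 2)) fun x => ?_
  · simp only [Pi.add_apply] at h2
    rw [integral_add (i1.const_mul (2 * K ^ 2)) (i2.const_mul 2), integral_const_mul,
      integral_const_mul] at h2
    have h3 : 0 ≤ ∫ x, (invDensity x * (‖x‖ ^ 2 * carlemanWeight a τ x ^ 2)) *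
        ‖χ x • u x‖ ^ 2 :=
      integral_nonneg fun x => mul_nonneg (mul_nonneg (invDensity_nonneg x) (by positivity))
        (by positivity)
    nlinarith
  · have hω0 : 0 ≤ invDensity x * (‖x‖ ^ 2 * carlemanWeight a τ x ^ 2) :=
      mul_nonneg (invDensity_nonneg x) (by positivity)
    have hb : ‖diracOp c (fun x => χ x • u x) x‖ ≤
        K * ‖χ x • u x‖ + ‖fderiv ℝ χ x‖ * ‖u x‖ := by
      rw [diracOp_smul (hχ.contDiff.differentiable one_ne_zero x)
        (hu.differentiable one_ne_zero x)]
      refine (norm_add_le _ _).trans (add_le_add ?_ ?_)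
      · by_cases hx : χ x = 0
        · simp [hx]
        · rw [norm_smul, norm_smul]
          nlinarith [hD x hx, norm_nonneg (χ x)]
      · rw [hc.norm_apply, norm_gradient]
    have : ‖diracOp c (fun x => χ x • u x) x‖ ^ 2 ≤
        2 * K ^ 2 * ‖χ x • u x‖ ^ 2 + 2 * (‖fderiv ℝ χ x‖ ^ 2 * ‖u x‖ ^ 2) := by
      have := pow_le_pow_left₀ (norm_nonneg _) hb 2
      nlinarith [sq_nonneg (K * ‖χ x • u x‖ - ‖fderiv ℝ χ x‖ * ‖u x‖)]
    have := mul_le_mul_of_nonneg_left this hω0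
    simp only [Pi.add_apply]
    linarith

end StrongUniqueContinuation

section Cutoff

open Set Filter Topology Metric
open scoped RealInnerProductSpace

variable {n : ℕ}

theorem exists_annular_cutoff {R : ℝ} (hR : 0 < R) :
    ∃ M : ℝ, 0 ≤ M ∧ ∀ δ : ℝ, 0 < δ → 4 * δ < R → ∃ χ : EuclideanSpace ℝ (Fin n) → ℝ,
      IsC1Punctured χ ∧ (∀ x, 2 * δ ≤ ‖x‖ → ‖x‖ ≤ R / 2 → χ x = 1) ∧
      (∀ x, R ≤ ‖x‖ → χ x = 0) ∧ ∀ x, fderiv ℝ χ x ≠ 0 →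
        (δ ≤ ‖x‖ ∧ ‖x‖ ≤ 2 * δ ∧ ‖fderiv ℝ χ x‖ ≤ M / δ) ∨
        (R / 2 ≤ ‖x‖ ∧ ‖x‖ ≤ R ∧ ‖fderiv ℝ χ x‖ ≤ M) := by
  let b : ContDiffBump (0 : EuclideanSpace ℝ (Fin n)) := ⟨1, 2, by norm_num, by norm_num⟩
  let η : ContDiffBump (0 : EuclideanSpace ℝ (Fin n)) :=
    ⟨R / 2, 3 * R / 4, by positivity, by linarith⟩
  have hb : ContDiff ℝ 1 b := b.contDiff
  have hη : ContDiff ℝ 1 η := η.contDiff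
  obtain ⟨Mb, hMb⟩ := (b.hasCompactSupport.fderiv ℝ).exists_bound_of_continuous
    (hb.continuous_fderiv one_ne_zero)
  obtain ⟨Mη, hMη⟩ := (η.hasCompactSupport.fderiv ℝ).exists_bound_of_continuous
    (hη.continuous_fderiv one_ne_zero)
  have hMb0 := (norm_nonneg _).trans (hMb 0)
  have hMη0 := (norm_nonneg _).trans (hMη 0)
  refine ⟨Mb + Mη, by positivity, fun δ hδ hδR =>
    ⟨fun x => η x * (1 - b (δ⁻¹ • x)), ⟨?_, ?_, ?_⟩, ?_, ?_, ?_⟩⟩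
  · exact hη.mul (contDiff_const.sub (hb.comp (contDiff_const_smul _)))
  · exact η.hasCompactSupport.mul_right
  · rw [notMem_tsupport_iff_eventuallyEq]
    filter_upwards [ball_mem_nhds 0 hδ] with x hx
    have : b (δ⁻¹ • x) = 1 := b.one_of_mem_closedBall <| by
      rw [mem_closedBall_zero_iff, norm_smul, norm_inv, Real.norm_of_nonneg hδ.le,
        inv_mul_le_iff₀ hδ]
      simpa [b] using (mem_ball_zero_iff.1 hx).le
    simp [this]
  · intro x h1 h2
    have e1 : η x = 1 := η.one_of_mem_closedBall (by simpa [η] using h2)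
    have e2 : b (δ⁻¹ • x) = 0 := b.zero_of_le_dist <| by
      rw [dist_zero_right, norm_smul, norm_inv, Real.norm_of_nonneg hδ.le, le_inv_mul_iff₀ hδ]
      simpa [b, mul_comm] using h1
    simp [e1, e2]
  · intro x h
    have : η x = 0 := η.zero_of_le_dist <| by
      rw [dist_zero_right]; exact le_trans (by simp only [η]; linarith) h
    simp [this]
  · intro x hx
    rcases lt_or_ge ‖x‖ (R / 2) with h | h
    · left
      have e : (fun x => η x * (1 - b (δ⁻¹ • x))) =ᶠ[𝓝 x] fun x => 1 - b (δ⁻¹ • x) := by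
        have := η.eventuallyEq_one_of_mem_ball (x := x) (by simpa [η] using h)
        filter_upwards [this] with y hy
        simp [hy]
      have hd : HasFDerivAt (fun x => 1 - b (δ⁻¹ • x))
          (-((fderiv ℝ b (δ⁻¹ • x)).comp (δ⁻¹ • ContinuousLinearMap.id ℝ _))) x := by
        have := ((hb.differentiable one_ne_zero (δ⁻¹ • x)).hasFDerivAt).comp x
          ((hasFDerivAt_id x).const_smul δ⁻¹)
        simpa [Function.comp_def] using this.const_sub 1
      have hfd : fderiv ℝ (fun x => η x * (1 - b (δ⁻¹ • x))) x =
          -(δ⁻¹ • fderiv ℝ b (δ⁻¹ • x)) := by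
        rw [e.fderiv_eq, hd.fderiv]
        ext v
        simp
      have hne : fderiv ℝ b (δ⁻¹ • x) ≠ 0 := by
        rintro h0
        exact hx (by rw [hfd, h0]; simp)
      rw [hfd, norm_neg, norm_smul, norm_inv, Real.norm_of_nonneg hδ.le]
      refine ⟨?_, ?_, ?_⟩
      · by_contra! hlt
        refine hne ?_
        rw [(b.eventuallyEq_one_of_mem_ball (x := δ⁻¹ • x) ?_).fderiv_eq]
        · simp
        · rw [mem_ball_zero_iff, norm_smul, norm_inv, Real.norm_of_nonneg hδ.le,
            inv_mul_lt_iff₀ hδ]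
          simpa [b] using hlt
      · have := tsupport_fderiv_subset ℝ (subset_tsupport (fderiv ℝ b) hne)
        rw [b.tsupport_eq, mem_closedBall_zero_iff, norm_smul, norm_inv,
          Real.norm_of_nonneg hδ.le, inv_mul_le_iff₀ hδ] at this
        simpa [b, mul_comm] using this
      · rw [div_eq_inv_mul]
        exact mul_le_mul_of_nonneg_left ((hMb _).trans (by linarith)) (by positivity)
    · right
      have e : (fun x => η x * (1 - b (δ⁻¹ • x))) =ᶠ[𝓝 x] η := by
        have : ∀ᶠ y in 𝓝 x, 2 * δ < ‖y‖ :=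
          continuous_norm.continuousAt.eventually (lt_mem_nhds (by linarith))
        filter_upwards [this] with y hy
        have e2 : b (δ⁻¹ • y) = 0 := b.zero_of_le_dist <| by
          rw [dist_zero_right, norm_smul, norm_inv, Real.norm_of_nonneg hδ.le, le_inv_mul_iff₀ hδ]
          simpa [b, mul_comm] using hy.le
        simp [e2]
      rw [e.fderiv_eq] at hx ⊢
      refine ⟨h, ?_, (hMη _).trans (by linarith)⟩
      have := tsupport_fderiv_subset ℝ (subset_tsupport (fderiv ℝ η) hx)
      rw [η.tsupport_eq, mem_closedBall_zero_iff] at this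
      exact this.trans (by simp only [η]; linarith)

end Cutoff

section StrongUniqueContinuation

open Set Filter Topology Metric
open scoped RealInnerProductSpace

variable {n : ℕ} {F : Type*} [NormedAddCommGroup F] [InnerProductSpace ℝ F]
  {c : EuclideanSpace ℝ (Fin n) →L[ℝ] F →L[ℝ] F}

/-- The error of the cutoff near the origin is `O(δ)`. -/
theorem weight_mul_inner_error_le {R δ M C s : ℝ} {τ : ℕ} {x : EuclideanSpace ℝ (Fin n)}
    (hR : 0 < R) (hδ : 0 < δ) (hs : 0 ≤ s)
    (h1 : δ ≤ ‖x‖) (h2 : ‖x‖ ≤ 2 * δ) (hxR : ‖x‖ ≤ R) {d : ℝ} (hd0 : 0 ≤ d) (hd : d ≤ M / δ)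
    (hsC : s ≤ C * ‖x‖ ^ (n + τ + 1)) :
    (invDensity x * (‖x‖ ^ 2 * carlemanWeight (1 / (4 * R ^ 2)) τ x ^ 2)) * (d ^ 2 * s ^ 2) ≤
      8 * (Real.exp τ ^ 2 * M ^ 2 * C ^ 2 * R ^ (n + 1)) * δ := by
  have hx : 0 < ‖x‖ := hδ.trans_le h1
  rw [carlemanWeight_natCast _ _ (norm_pos_iff.1 hx), invDensity]
  set r := ‖x‖
  have e1 : Real.exp (τ * (1 / (4 * R ^ 2) * r ^ 2)) ≤ Real.exp τ := by
    refine Real.exp_le_exp.2 (mul_le_of_le_one_right (Nat.cast_nonneg _) ?_)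
    rw [one_div, inv_mul_le_iff₀ (by positivity)]
    nlinarith
  have hd2 : d ^ 2 ≤ (M / δ) ^ 2 := pow_le_pow_left₀ hd0 hd 2
  have hs2 : s ^ 2 ≤ (C * r ^ (n + τ + 1)) ^ 2 := pow_le_pow_left₀ hs hsC 2
  have he2 := pow_le_pow_left₀ (Real.exp_nonneg _) e1 2
  calc (r ^ n)⁻¹ * (r ^ 2 * (Real.exp (τ * (1 / (4 * R ^ 2) * r ^ 2)) * (r ^ τ)⁻¹) ^ 2) *
        (d ^ 2 * s ^ 2)
      ≤ (r ^ n)⁻¹ * (r ^ 2 * (Real.exp τ * (r ^ τ)⁻¹) ^ 2) *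
        ((M / δ) ^ 2 * (C * r ^ (n + τ + 1)) ^ 2) := by gcongr
    _ = Real.exp τ ^ 2 * M ^ 2 * C ^ 2 * (r ^ (n + 1) * r ^ 3) / δ ^ 2 := by
        field_simp
        ring
    _ ≤ Real.exp τ ^ 2 * M ^ 2 * C ^ 2 * (R ^ (n + 1) * (2 * δ) ^ 3) / δ ^ 2 := by gcongr
    _ = _ := by field_simp; ring

/-- Strong unique continuation for the Dirac differential inequality. -/
theorem eqOn_zero_of_infinite_order (hc : IsCliffordMul c) {u : EuclideanSpace ℝ (Fin n) → F}
    (hu : ContDiff ℝ 1 u) {K R : ℝ} (hR : 0 < R)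
    (hD : ∀ x, ‖x‖ < R → ‖diracOp c u x‖ ≤ K * ‖u x‖)
    (h0 : ∀ m : ℕ, u =O[𝓝 0] fun x => ‖x‖ ^ m) {x₀ : EuclideanSpace ℝ (Fin n)}
    (hx₀ : ‖x₀‖ < R / 2) : u x₀ = 0 := by
  by_cases hx0 : x₀ = 0
  · subst hx0
    have h1 : u =O[𝓝 0] fun x => ‖x - 0‖ ^ 1 := by simpa using h0 1
    exact h1.eq_zero_of_norm_pow one_ne_zero
  by_contra hne
  have hx0' : 0 < ‖x₀‖ := norm_pos_iff.2 hx0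
  have huc := hu.continuous
  obtain ⟨M, hM, hcut⟩ := exists_annular_cutoff (n := n) hR
  obtain ⟨δ₀, hδ₀, hδx, hδR⟩ : ∃ δ₀ : ℝ, 0 < δ₀ ∧ 4 * δ₀ ≤ ‖x₀‖ ∧ ‖x₀‖ + δ₀ ≤ R / 2 :=
    ⟨min (‖x₀‖ / 4) (R / 2 - ‖x₀‖), by simp [hx0', hx₀],
      by linarith [min_le_left (‖x₀‖ / 4) (R / 2 - ‖x₀‖)],
      by linarith [min_le_right (‖x₀‖ / 4) (R / 2 - ‖x₀‖)]⟩
  let θ : ContDiffBump x₀ := ⟨δ₀ / 2, δ₀, by positivity, by linarith⟩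
  have hθ {x} (hx : θ x ≠ 0) : 2 * δ₀ ≤ ‖x‖ ∧ ‖x‖ ≤ R / 2 := by
    have h : ‖x - x₀‖ < δ₀ := by
      by_contra! h
      exact hx (θ.zero_of_le_dist (by rw [dist_eq_norm]; exact h))
    have h1 := norm_sub_norm_le x₀ x
    have h2 := norm_sub_norm_le x x₀
    rw [norm_sub_rev] at h1
    constructor <;> linarith
  have hθ0 : ∀ᶠ x in 𝓝 0, θ x = 0 := by
    filter_upwards [ball_mem_nhds 0 hδ₀] with x hx
    by_contra h
    linarith [(hθ h).1, mem_ball_zero_iff.1 hx]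
  -- the mass that Carleman's inequality shows to be zero
  set g : EuclideanSpace ℝ (Fin n) → ℝ := fun x => (invDensity x * ‖x‖ ^ 2) * (θ x * ‖u x‖ ^ 2)
    with hg
  have hgc : Continuous g := continuous_iff_continuousAt.2 fun x => by
    by_cases hx : x = 0
    · subst hx
      have : g =ᶠ[𝓝 0] fun _ => 0 := by
        filter_upwards [hθ0] with y hy
        simp [hg, hy]
      exact continuousAt_const.congr this.symm
    · exact ((contDiffAt_invDensity hx).continuousAt.mul (by fun_prop)).mul
        (θ.continuous.continuousAt.mul (by fun_prop))
  have hgs : HasCompactSupport g := (θ.hasCompactSupport.mul_right).mul_left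
  have hg0 (x) : 0 ≤ g x :=
    mul_nonneg (mul_nonneg (invDensity_nonneg x) (by positivity))
      (mul_nonneg θ.nonneg (by positivity))
  have hI : 0 < ∫ x, g x := by
    refine hgc.integral_pos_of_hasCompactSupport_nonneg_nonzero (x := x₀) hgs hg0 ?_
    have : θ x₀ = 1 := θ.one_of_mem_closedBall (mem_closedBall_self (by positivity))
    simp only [hg, this, invDensity]
    have : u x₀ ≠ 0 := hne
    positivity
  obtain ⟨Mu, hMu⟩ := (isCompact_closedBall (0 : EuclideanSpace ℝ (Fin n)) R).exists_bound_of_continuousOn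
    huc.continuousOn
  set a : ℝ := 1 / (4 * R ^ 2) with ha
  have ha0 : 0 < a := by positivity
  set B : ℝ := ((R / 2) ^ n)⁻¹ * R ^ 2 * (M ^ 2 * Mu ^ 2)
  set vol : ℝ := volume.real (closedBall (0 : EuclideanSpace ℝ (Fin n)) R)
  have hvol : volume (closedBall (0 : EuclideanSpace ℝ (Fin n)) R) ≠ ⊤ :=
    (isCompact_closedBall _ _).measure_lt_top.ne
  suffices H : ∀ᶠ τ : ℕ in atTop, a * τ * ∫ x, g x ≤ B * vol by
    have : Tendsto (fun τ : ℕ => a * τ * ∫ x, g x) atTop atTop :=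
      (tendsto_natCast_atTop_atTop.const_mul_atTop ha0).atTop_mul_const hI
    obtain ⟨τ, h1, h2⟩ := (H.and (this.eventually_gt_atTop (B * vol))).exists
    linarith
  have hlarge : ∀ᶠ τ : ℕ in atTop, K ^ 2 ≤ a * τ :=
    (tendsto_natCast_atTop_atTop.const_mul_atTop ha0).eventually_ge_atTop _
  filter_upwards [hlarge] with τ hτ
  obtain ⟨C, hC⟩ := (h0 (n + τ + 1)).bound
  obtain ⟨ε, hε, hCε⟩ := Metric.eventually_nhds_iff_ball.1 hC
  -- the value of the squared weight on the sphere of radius `R / 2`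
  set E : ℝ := Real.exp (τ * (a * (R / 2) ^ 2 - Real.log (R / 2))) ^ 2 with hE
  have hE0 : 0 < E := by positivity
  set C₁ : ℝ := 8 * (Real.exp τ ^ 2 * M ^ 2 * C ^ 2 * R ^ (n + 1))
  have hC₁ : 0 ≤ C₁ := by positivity
  have hB : 0 ≤ B := by positivity
  have main : ∀ δ : ℝ, 0 < δ → δ < δ₀ → 2 * δ < ε →
      a * τ * (E * ∫ x, g x) ≤ (E * B + C₁ * δ) * vol := by
    intro δ hδ hδδ hδε
    obtain ⟨χ, hχ, hχ1, hχ0, hχd⟩ := hcut δ hδ (by linarith)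
    obtain ⟨i1, i2, h⟩ := carleman_absorbed (K := K) hc hu hχ
      (fun x hx => hD x (by by_contra! h; exact hx (hχ0 x h))) hτ
    refine le_trans (mul_le_mul_of_nonneg_left ?_ (by positivity)) (h.trans ?_)
    · rw [← integral_const_mul]
      refine integral_mono ((hgc.integrable_of_hasCompactSupport hgs).const_mul E) i1 fun x => ?_
      have hω : 0 ≤ invDensity x * (‖x‖ ^ 2 * carlemanWeight a τ x ^ 2) :=
        mul_nonneg (invDensity_nonneg x) (by positivity)
      by_cases hx : θ x = 0
      · simp only [hg, hx]
        simpa using mul_nonneg hω (sq_nonneg _)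
      · obtain ⟨h1, h2⟩ := hθ hx
        have hW : E ≤ carlemanWeight a τ x ^ 2 := by
          have hx1 : 0 < ‖x‖ := by linarith
          have := carlemanWeight_le (n := n) (R := R) (τ := τ) (Nat.cast_nonneg _)
            (y := x) (x := ((R / 2) / ‖x‖) • x) hx1
          rw [norm_smul, norm_div, norm_norm, div_mul_cancel₀ _ hx1.ne',
            Real.norm_of_nonneg (by positivity)] at this
          have := this h2 (by linarith)
          rw [carlemanWeight, norm_smul, norm_div, norm_norm, div_mul_cancel₀ _ hx1.ne',
            Real.norm_of_nonneg (by positivity)] at this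
          exact pow_le_pow_left₀ (Real.exp_nonneg _) this 2
        simp only [hg, hχ1 x (by linarith) h2, one_smul]
        have := invDensity_nonneg x
        have hθx : 0 ≤ θ x := θ.nonneg
        calc E * (invDensity x * ‖x‖ ^ 2 * (θ x * ‖u x‖ ^ 2))
            ≤ carlemanWeight a τ x ^ 2 * (invDensity x * ‖x‖ ^ 2 * (1 * ‖u x‖ ^ 2)) := by
              gcongr
              exact θ.le_one
          _ = _ := by ring
    · have hc2 : Integrable ((closedBall (0 : EuclideanSpace ℝ (Fin n)) R).indicator
          fun _ => E * B + C₁ * δ) :=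
        (integrable_indicator_iff measurableSet_closedBall).2 (integrableOn_const hvol)
      refine (integral_mono i2 hc2 fun x => ?_).trans_eq ?_
      · by_cases hx : fderiv ℝ χ x = 0
        · simp only [hx]
          simpa using indicator_nonneg (fun _ _ => by positivity) _
        rcases hχd x hx with ⟨h1, h2, h3⟩ | ⟨h1, h2, h3⟩
        · have hxR : ‖x‖ ≤ R := by linarith
          rw [indicator_of_mem (mem_closedBall_zero_iff.2 hxR)]
          have h4 := hCε x (mem_ball_zero_iff.2 (by linarith))
          rw [norm_pow, norm_norm] at h4
          have := weight_mul_inner_error_le hR hδ (norm_nonneg _) h1 h2 hxR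
            (norm_nonneg _) h3 h4
          have h5 : 0 ≤ E * B := by positivity
          exact this.trans (by linarith)
        · rw [indicator_of_mem (mem_closedBall_zero_iff.2 h2)]
          have hx1 : 0 < ‖x‖ := by linarith
          have hW : carlemanWeight a τ x ^ 2 ≤ E := by
            have := carlemanWeight_le (n := n) (R := R) (τ := τ) (Nat.cast_nonneg _)
              (x := x) (y := ((R / 2) / ‖x‖) • x)
            rw [norm_smul, norm_div, norm_norm, div_mul_cancel₀ _ hx1.ne',
              Real.norm_of_nonneg (by positivity)] at this
            have := this (by positivity) h1 h2
            rw [carlemanWeight, carlemanWeight, norm_smul, norm_div, norm_norm,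
              div_mul_cancel₀ _ hx1.ne', Real.norm_of_nonneg (by positivity)] at this
            exact pow_le_pow_left₀ (Real.exp_nonneg _) this 2
          have h4 := hMu x (mem_closedBall_zero_iff.2 h2)
          have h6 : invDensity x ≤ ((R / 2) ^ n)⁻¹ := by
            unfold invDensity
            gcongr
          have h7 := invDensity_nonneg x
          have h8 : 0 ≤ C₁ * δ := by positivity
          calc invDensity x * (‖x‖ ^ 2 * carlemanWeight a τ x ^ 2) *
                (‖fderiv ℝ χ x‖ ^ 2 * ‖u x‖ ^ 2)
              ≤ ((R / 2) ^ n)⁻¹ * (R ^ 2 * E) * (M ^ 2 * Mu ^ 2) := by gcongr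
            _ = E * B := by ring
            _ ≤ _ := by linarith
      · rw [integral_indicator measurableSet_closedBall, setIntegral_const, smul_eq_mul, mul_comm]
  have lim : Tendsto (fun δ : ℝ => (E * B + C₁ * δ) * vol) (𝓝[>] 0) (𝓝 ((E * B + C₁ * 0) * vol)) :=
    (Continuous.tendsto (by fun_prop) 0).mono_left nhdsWithin_le_nhds
  have := ge_of_tendsto lim (b := a * τ * (E * ∫ x, g x)) <| by
    filter_upwards [Ioo_mem_nhdsGT (show (0 : ℝ) < min δ₀ (ε / 2) by positivity)] with δ hδ
    exact main δ hδ.1 (hδ.2.trans_le (min_le_left _ _))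
      (by linarith [hδ.2.trans_le (min_le_right δ₀ (ε / 2))])
  refine le_of_mul_le_mul_left ?_ hE0
  linarith

end StrongUniqueContinuation

section Connectedness

open Set Filter Topology Metric
open scoped RealInnerProductSpace

variable {n : ℕ} {F : Type*} [NormedAddCommGroup F] [InnerProductSpace ℝ F]
  {c : EuclideanSpace ℝ (Fin n) →L[ℝ] F →L[ℝ] F}

theorem exists_localization {φ : EuclideanSpace ℝ (Fin n) → F} {x : EuclideanSpace ℝ (Fin n)}
    {r : ℝ} (hr : 0 < r) (hφ : ContDiffOn ℝ 1 φ (ball x (2 * r))) :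
    ∃ u : EuclideanSpace ℝ (Fin n) → F, ContDiff ℝ 1 u ∧ HasCompactSupport u ∧
      (∀ h, ‖h‖ < r → u h = φ (x + h)) ∧
      ∀ h, ‖h‖ < r → diracOp c u h = diracOp c φ (x + h) := by
  let χ : ContDiffBump (0 : EuclideanSpace ℝ (Fin n)) := ⟨r, 3 * r / 2, hr, by linarith⟩
  have hu (h) (hh : ‖h‖ < r) : χ h • φ (x + h) = φ (x + h) := by
    rw [χ.one_of_mem_closedBall (mem_closedBall_zero_iff.2 hh.le), one_smul]
  refine ⟨fun h => χ h • φ (x + h), contDiff_iff_contDiffAt.2 fun h => ?_,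
    χ.hasCompactSupport.smul_right, hu, fun h hh => ?_⟩
  · by_cases hh : ‖h‖ < 2 * r
    · have h1 : ContDiffAt ℝ 1 φ (x + h) :=
        hφ.contDiffAt (isOpen_ball.mem_nhds (by simpa using hh))
      exact χ.contDiff.contDiffAt.smul (h1.comp h (contDiffAt_const.add contDiffAt_id))
    · have h1 : h ∉ tsupport χ := by
        rw [χ.tsupport_eq, mem_closedBall_zero_iff]
        simp only [χ]
        linarith
      have h2 := notMem_tsupport_iff_eventuallyEq.1 h1
      refine ContDiffAt.congr_of_eventuallyEq (f := fun _ => 0) contDiffAt_const ?_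
      filter_upwards [h2] with y hy
      simp [hy]
  · have h1 : (fun h => χ h • φ (x + h)) =ᶠ[𝓝 h] fun h => φ (x + h) := by
      filter_upwards [isOpen_ball.mem_nhds (mem_ball_zero_iff.2 hh)] with y hy
      exact hu y (mem_ball_zero_iff.1 hy)
    simp only [diracOp]
    rw [h1.fderiv_eq, fderiv_comp_add_left]

theorem eqOn_ball_zero_of_infinite_order (hc : IsCliffordMul c)
    {φ : EuclideanSpace ℝ (Fin n) → F} {x : EuclideanSpace ℝ (Fin n)} {r K : ℝ} (hr : 0 < r)
    (hφ : ContDiffOn ℝ 1 φ (ball x (2 * r)))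
    (hD : ∀ y ∈ ball x r, ‖diracOp c φ y‖ ≤ K * ‖φ y‖)
    (h0 : ∀ m : ℕ, (fun h => φ (x + h)) =O[𝓝 0] fun h => ‖h‖ ^ m) :
    ∀ y ∈ ball x (r / 2), φ y = 0 := by
  obtain ⟨u, hu, -, hu1, hu2⟩ := exists_localization (c := c) hr hφ
  intro y hy
  have hy' : ‖y - x‖ < r / 2 := by simpa [dist_eq_norm] using hy
  have := eqOn_zero_of_infinite_order hc hu (K := K) hr (fun h hh => ?_) (fun m => ?_) hy'
  · simpa [hu1 (y - x) (by linarith)] using this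
  · rw [hu1 h hh, hu2 h hh]
    exact hD _ (by simpa using hh)
  · refine (h0 m).congr' ?_ EventuallyEq.rfl
    filter_upwards [ball_mem_nhds 0 hr] with h hh
    exact (hu1 h (mem_ball_zero_iff.1 hh)).symm

theorem eqOn_zero_of_exists_infinite_order (hc : IsCliffordMul c)
    {Ω : Set (EuclideanSpace ℝ (Fin n))} (hΩ : IsOpen Ω) (hΩc : IsPreconnected Ω)
    {φ : EuclideanSpace ℝ (Fin n) → F} (hφ : ContDiffOn ℝ 1 φ Ω)
    (hD : ∀ x ∈ Ω, ∃ K : ℝ, ∀ᶠ y in 𝓝 x, ‖diracOp c φ y‖ ≤ K * ‖φ y‖)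
    {x : EuclideanSpace ℝ (Fin n)} (hx : x ∈ Ω)
    (h0 : ∀ m : ℕ, (fun h => φ (x + h)) =O[𝓝 0] fun h => ‖h‖ ^ m) :
    ∀ y ∈ Ω, φ y = 0 := by
  have hball (x) (hx : x ∈ Ω) : ∃ ρ > 0, ∃ K : ℝ, ball x ρ ⊆ Ω ∧
      ∀ y ∈ ball x ρ, ‖diracOp c φ y‖ ≤ K * ‖φ y‖ := by
    obtain ⟨K, hK⟩ := hD x hx
    obtain ⟨ρ, hρ, h⟩ := Metric.mem_nhds_iff.1 (Filter.inter_mem (hΩ.mem_nhds hx) hK)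
    exact ⟨ρ, hρ, K, fun y hy => (h hy).1, fun y hy => (h hy).2⟩
  have hsub : Ω ⊆ interior (φ ⁻¹' {0}) := by
    refine hΩc.subset_of_closure_inter_subset isOpen_interior ⟨x, hx, ?_⟩ ?_
    · obtain ⟨ρ, hρ, K, h1, h2⟩ := hball x hx
      have := eqOn_ball_zero_of_infinite_order hc (half_pos hρ)
        (hφ.mono ((ball_subset_ball (by linarith)).trans h1))
        (fun y hy => h2 y (ball_subset_ball (by linarith) hy)) h0
      exact mem_interior_iff_mem_nhds.2 (mem_of_superset (ball_mem_nhds x (by positivity)) this)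
    · rintro z ⟨hz, hzΩ⟩
      obtain ⟨ρ, hρ, K, h1, h2⟩ := hball z hzΩ
      obtain ⟨y, hy, hzy⟩ := Metric.mem_closure_iff.1 hz (ρ / 8) (by positivity)
      have hsub (s : ℝ) (hs : s ≤ ρ / 2) : ball y s ⊆ ball z ρ :=
        ball_subset_ball' (by rw [dist_comm]; linarith)
      have := eqOn_ball_zero_of_infinite_order (x := y) (r := ρ / 4) hc (by positivity)
        (hφ.mono ((hsub _ (by linarith)).trans h1))
        (fun w hw => h2 w (hsub _ (by linarith) hw)) fun m => ?_
      · refine mem_interior_iff_mem_nhds.2 (mem_of_superset (isOpen_ball.mem_nhds ?_) this)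
        rw [mem_ball]; linarith
      · refine Asymptotics.IsBigO.of_bound 0 ?_
        have ht : Tendsto (fun h => y + h) (𝓝 0) (𝓝 y) := by
          simpa using (continuous_const_add y).tendsto 0
        filter_upwards [ht.eventually (mem_interior_iff_mem_nhds.1 hy)] with h hh
        have : φ (y + h) = 0 := hh
        simp [this]
  intro y hy
  have : y ∈ φ ⁻¹' {0} := interior_subset (hsub hy)
  exact this

end Connectedness

section CauchyPompeiu

open Set Filter Topology Metric
open scoped RealInnerProductSpace

variable {n : ℕ} {F : Type*} [NormedAddCommGroup F] [InnerProductSpace ℝ F]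
  {c : EuclideanSpace ℝ (Fin n) →L[ℝ] F →L[ℝ] F}

theorem integrableOn_sqrt_norm_div_norm_pow (hn : 1 ≤ n) (r : ℝ) :
    IntegrableOn (fun x : EuclideanSpace ℝ (Fin n) => √‖x‖ / ‖x‖ ^ n) (ball 0 r) := by
  have : Nonempty (Fin n) := ⟨⟨0, hn⟩⟩
  have : Nontrivial (EuclideanSpace ℝ (Fin n)) := inferInstance
  rw [integrableOn_fun_norm_addHaar volume (f := fun t => √t / t ^ n)]
  rcases le_or_gt r 0 with hr | hr
  · simp [hr]
  have h : IntegrableOn (fun t : ℝ => t ^ (-(1 / 2) : ℝ)) (Ioo 0 r) := by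
    rw [intervalIntegral.integrableOn_Ioo_rpow_iff hr]; norm_num
  refine h.congr_fun (fun t ht => ?_) measurableSet_Ioo
  have ht0 : 0 < t := ht.1
  obtain ⟨m, rfl⟩ : ∃ m, n = m + 1 := ⟨n - 1, by omega⟩
  have : √t ≠ 0 := (Real.sqrt_pos.2 ht0).ne'
  simp only [Real.rpow_neg ht0.le, ← Real.sqrt_eq_rpow, finrank_euclideanSpace, Fintype.card_fin,
    Nat.add_sub_cancel, smul_eq_mul]
  field_simp
  rw [pow_succ', Real.sq_sqrt ht0.le]

/-- The fundamental solution of the Dirac operator, up to a constant. -/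
noncomputable def diracKernel (c : EuclideanSpace ℝ (Fin n) →L[ℝ] F →L[ℝ] F)
    (z : EuclideanSpace ℝ (Fin n)) : F →L[ℝ] F :=
  invDensity z • c z

theorem norm_diracKernel_apply (hc : IsCliffordMul c) (z : EuclideanSpace ℝ (Fin n)) (a : F) :
    ‖diracKernel c z a‖ = ‖z‖ / ‖z‖ ^ n * ‖a‖ := by
  rw [diracKernel, _root_.smul_apply, norm_smul, hc.norm_apply,
    Real.norm_of_nonneg (invDensity_nonneg z), invDensity]
  ring

theorem integral_rpow_smul_clifford_diracOp (hc : IsCliffordMul c)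
    {u : EuclideanSpace ℝ (Fin n) → F} (hu : ContDiff ℝ 1 u) (hs : HasCompactSupport u)
    {ε : ℝ} (hε : 0 < ε) :
    ∫ z, ((‖z‖ ^ 2 + ε ^ 2) ^ (-(n : ℝ) / 2)) • c z (diracOp c u z) =
      ∫ z, (n * (ε ^ 2 * (‖z‖ ^ 2 + ε ^ 2) ^ (-(n + 2 : ℝ) / 2))) • u z := by
  have hq (z : EuclideanSpace ℝ (Fin n)) : 0 < ‖z‖ ^ 2 + ε ^ 2 := by positivity
  set ρ : EuclideanSpace ℝ (Fin n) → ℝ := fun z => (‖z‖ ^ 2 + ε ^ 2) ^ (-(n : ℝ) / 2) with hρ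
  have hρd (z) : HasFDerivAt ρ
      ((-(n : ℝ) * (‖z‖ ^ 2 + ε ^ 2) ^ (-(n + 2 : ℝ) / 2)) • innerSL ℝ z) z := by
    have := (((hasStrictFDerivAt_norm_sq z).hasFDerivAt.add_const (ε ^ 2)).rpow_const
      (p := -(n : ℝ) / 2) (Or.inl (hq z).ne'))
    refine this.congr_fderiv ?_
    ext v
    simp only [_root_.smul_apply, innerSL_apply_apply, smul_eq_mul]
    rw [show -(n : ℝ) / 2 - 1 = -(n + 2 : ℝ) / 2 by ring]
    simp
    ring
  have hρc : ContDiff ℝ 1 ρ :=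
    ((contDiff_norm_sq ℝ).add contDiff_const).rpow_const_of_ne fun z => (hq z).ne'
  have hqc (p : ℝ) : Continuous fun z : EuclideanSpace ℝ (Fin n) => (‖z‖ ^ 2 + ε ^ 2) ^ p :=
    (by fun_prop : Continuous fun z : EuclideanSpace ℝ (Fin n) => ‖z‖ ^ 2 + ε ^ 2).rpow_const
      fun z => Or.inl (hq z).ne'
  have hDc := continuous_diracOp (c := c) hu
  have hDs : HasCompactSupport (diracOp c u) := by
    refine (hs.fderiv ℝ).mono fun x hx h => hx ?_
    simp [diracOp, h]
  set X : Fin n → EuclideanSpace ℝ (Fin n) → F := fun j z =>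
    ρ z • c z (c (EuclideanSpace.single j 1) (u z)) with hX
  have hXc (j) : ContDiff ℝ 1 (X j) :=
    hρc.smul (c.contDiff.clm_apply ((c _).contDiff.comp hu))
  have hXs (j) : HasCompactSupport (X j) :=
    hs.mono fun x hx h => hx (by simp [hX, h])
  have hXd (j z) : fderiv ℝ (X j) z (EuclideanSpace.single j 1) =
      ρ z • (c z (c (EuclideanSpace.single j 1) (fderiv ℝ u z (EuclideanSpace.single j 1))) +
        c (EuclideanSpace.single j 1) (c (EuclideanSpace.single j 1) (u z))) +
      (-(n : ℝ) * (‖z‖ ^ 2 + ε ^ 2) ^ (-(n + 2 : ℝ) / 2)) •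
        c z (c (z j • EuclideanSpace.single j 1) (u z)) := by
    have h : HasFDerivAt (X j) _ z := (hρd z).smul (c.hasFDerivAt.clm_apply
      ((c (EuclideanSpace.single j 1)).hasFDerivAt.comp z
        (hu.differentiable one_ne_zero z).hasFDerivAt))
    rw [h.fderiv]
    simp [EuclideanSpace.inner_single_right, smul_smul]
  have hdiv (z) : ∑ j, fderiv ℝ (X j) z (EuclideanSpace.single j 1) =
      ρ z • c z (diracOp c u z) -
        (n * (ε ^ 2 * (‖z‖ ^ 2 + ε ^ 2) ^ (-(n + 2 : ℝ) / 2))) • u z := by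
    simp only [hXd]
    rw [Finset.sum_add_distrib, ← Finset.smul_sum, ← Finset.smul_sum, Finset.sum_add_distrib,
      sum_clifford_sq hc, ← map_sum, ← map_sum, ← diracOp]
    have e : ∑ j, c (z j • EuclideanSpace.single j 1) (u z) = c z (u z) := by
      rw [← _root_.sum_apply, ← map_sum, sum_coord_smul_single]
    rw [e, hc.sq]
    have e2 : ρ z = (‖z‖ ^ 2 + ε ^ 2) * (‖z‖ ^ 2 + ε ^ 2) ^ (-(n + 2 : ℝ) / 2) := by
      have := Real.rpow_add (hq z) 1 (-(n + 2 : ℝ) / 2)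
      rw [Real.rpow_one] at this
      rw [← this]
      simp only [hρ]
      congr 1
      ring
    rw [smul_add, e2]
    module
  have h_int : ∫ z, ∑ j, fderiv ℝ (X j) z (EuclideanSpace.single j 1) = 0 := by
    rw [integral_finsetSum]
    · exact Finset.sum_eq_zero fun j _ => integral_fderiv_apply_eq_zero (hXc j) (hXs j) _
    · intro j _
      exact Continuous.integrable_of_hasCompactSupport
        (((hXc j).continuous_fderiv one_ne_zero).clm_apply continuous_const)
        ((hXs j).fderiv_apply ℝ _)
  simp only [hdiv] at h_int
  rw [integral_sub] at h_int
  · exact sub_eq_zero.1 h_int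
  · refine Continuous.integrable_of_hasCompactSupport ?_ ?_
    · exact (hρc.continuous).smul (c.continuous.clm_apply hDc)
    · exact hDs.mono fun x hx h => hx (by simp [h])
  · refine Continuous.integrable_of_hasCompactSupport ?_ hs.smul_left
    exact (continuous_const.mul (continuous_const.mul (hqc _))).smul hu.continuous

end CauchyPompeiu

section CauchyPompeiu

open Set Filter Topology Metric
open scoped RealInnerProductSpace

variable {n : ℕ} {F : Type*} [NormedAddCommGroup F] [InnerProductSpace ℝ F]
  {c : EuclideanSpace ℝ (Fin n) →L[ℝ] F →L[ℝ] F}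

theorem measurable_invDensity : Measurable (invDensity (n := n)) := by
  unfold invDensity
  fun_prop

theorem integrable_diracKernel_apply (hn : 1 ≤ n) (hc : IsCliffordMul c)
    {g : EuclideanSpace ℝ (Fin n) → F} (hg : Continuous g) (hs : HasCompactSupport g) :
    Integrable fun z => diracKernel c z (g z) := by
  obtain ⟨M, hM⟩ := hs.exists_bound_of_continuous hg
  obtain ⟨r, hr0, hr⟩ := hs.isCompact.isBounded.subset_ball_lt 0 0
  have hW := (integrable_indicator_iff measurableSet_ball).2
    (integrableOn_sqrt_norm_div_norm_pow hn r)
  refine (hW.const_mul (√r * M)).mono' ?_ (Eventually.of_forall fun z => ?_)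
  · exact measurable_invDensity.aestronglyMeasurable.smul
      (c.continuous.clm_apply hg).aestronglyMeasurable
  · have hM0 := (norm_nonneg _).trans (hM z)
    by_cases hz : z ∈ ball 0 r
    · rw [norm_diracKernel_apply hc, indicator_of_mem hz]
      have h1 : √‖z‖ ≤ √r := Real.sqrt_le_sqrt (mem_ball_zero_iff.1 hz).le
      have h2 : ‖z‖ / ‖z‖ ^ n = √‖z‖ * (√‖z‖ / ‖z‖ ^ n) := by
        rw [mul_div_assoc', Real.mul_self_sqrt (norm_nonneg _)]
      rw [h2]
      have := hM z
      calc √‖z‖ * (√‖z‖ / ‖z‖ ^ n) * ‖g z‖ ≤ √r * (√‖z‖ / ‖z‖ ^ n) * M := by gcongr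
        _ = _ := by ring
    · have : g z = 0 := image_eq_zero_of_notMem_tsupport fun h => hz (hr h)
      rw [this, indicator_of_notMem hz]
      simp

theorem integral_rpow_smul_eq_integral_dilation (u : EuclideanSpace ℝ (Fin n) → F) {ε : ℝ}
    (hε : 0 < ε) :
    ∫ z, (n * (ε ^ 2 * (‖z‖ ^ 2 + ε ^ 2) ^ (-(n + 2 : ℝ) / 2))) • u z =
      ∫ w, (n * ((1 : ℝ) + ‖w‖ ^ 2) ^ (-(n + 2 : ℝ) / 2)) • u (ε • w) := by
  have h := Measure.integral_comp_smul_of_nonneg (μ := volume)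
    (fun z : EuclideanSpace ℝ (Fin n) =>
      (n * (ε ^ 2 * (‖z‖ ^ 2 + ε ^ 2) ^ (-(n + 2 : ℝ) / 2))) • u z) ε (hR := hε.le)
  rw [finrank_euclideanSpace, Fintype.card_fin, eq_inv_smul_iff₀ (by positivity),
    ← integral_smul] at h
  rw [← h]
  refine integral_congr_ae (Eventually.of_forall fun w => ?_)
  simp only [smul_smul]
  congr 1
  have e : ‖ε • w‖ ^ 2 + ε ^ 2 = ε ^ 2 * (1 + ‖w‖ ^ 2) := by
    rw [norm_smul, Real.norm_of_nonneg hε.le]; ring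
  rw [e, Real.mul_rpow (by positivity) (by positivity), ← Real.rpow_natCast ε 2,
    ← Real.rpow_mul hε.le]
  have e2 : ε ^ n * (ε ^ ((2 : ℕ) : ℝ) * ε ^ (((2 : ℕ) : ℝ) * (-(n + 2 : ℝ) / 2))) = 1 := by
    rw [← Real.rpow_natCast ε n, ← Real.rpow_add hε, ← Real.rpow_add hε]
    convert Real.rpow_zero ε using 2
    push_cast
    ring
  linear_combination (n * ((1 : ℝ) + ‖w‖ ^ 2) ^ (-(n + 2 : ℝ) / 2)) * e2

variable (n) in
/-- The constant in the Cauchy–Pompeiu formula. -/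
noncomputable def pompeiuConst : ℝ :=
  ∫ w : EuclideanSpace ℝ (Fin n), n * ((1 : ℝ) + ‖w‖ ^ 2) ^ (-(n + 2 : ℝ) / 2)

variable (n) in
theorem integrable_pompeiu : Integrable fun w : EuclideanSpace ℝ (Fin n) =>
    n * ((1 : ℝ) + ‖w‖ ^ 2) ^ (-(n + 2 : ℝ) / 2) :=
  (integrable_rpow_neg_one_add_norm_sq (μ := volume) (r := n + 2) (by simp)).const_mul _

theorem pompeiuConst_pos (hn : 1 ≤ n) : 0 < pompeiuConst n := by
  have hn' : (0 : ℝ) < n := by exact_mod_cast hn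
  refine (integral_pos_iff_support_of_nonneg (fun w => by positivity)
    (integrable_pompeiu n)).2 ?_
  rw [show Function.support _ = univ from eq_univ_of_forall fun w => ?_]
  · exact Measure.measure_univ_pos.2 (NeZero.ne _)
  · rw [Function.mem_support]; positivity

theorem pompeiuConst_smul_apply_zero [CompleteSpace F] (hn : 1 ≤ n) (hc : IsCliffordMul c)
    {u : EuclideanSpace ℝ (Fin n) → F} (hu : ContDiff ℝ 1 u) (hs : HasCompactSupport u) :
    pompeiuConst n • u 0 = ∫ z, diracKernel c z (diracOp c u z) := by
  have hDc := continuous_diracOp (c := c) hu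
  have hDs : HasCompactSupport (diracOp c u) := by
    refine (hs.fderiv ℝ).mono fun x hx h => hx ?_
    simp [diracOp, h]
  obtain ⟨M, hM⟩ := hs.exists_bound_of_continuous hu.continuous
  have hq (z : EuclideanSpace ℝ (Fin n)) {ε : ℝ} (hε : 0 < ε) : 0 < ‖z‖ ^ 2 + ε ^ 2 := by
    positivity
  have hne : ∀ᵐ z : EuclideanSpace ℝ (Fin n), z ≠ 0 := by
    have : Nonempty (Fin n) := ⟨⟨0, hn⟩⟩
    exact compl_mem_ae_iff.2 (measure_singleton 0)
  have e0 {z : EuclideanSpace ℝ (Fin n)} (hz : z ≠ 0) :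
      (‖z‖ ^ 2) ^ (-(n : ℝ) / 2) = invDensity z := by
    rw [← Real.rpow_natCast ‖z‖ 2, ← Real.rpow_mul (norm_nonneg z), invDensity,
      ← Real.rpow_natCast ‖z‖ n, ← Real.rpow_neg (norm_nonneg z)]
    congr 1
    push_cast
    ring
  have lim1 : Tendsto (fun ε : ℝ => ∫ z, ((‖z‖ ^ 2 + ε ^ 2) ^ (-(n : ℝ) / 2)) •
      c z (diracOp c u z)) (𝓝[>] 0) (𝓝 (∫ z, diracKernel c z (diracOp c u z))) := by
    refine tendsto_integral_filter_of_dominated_convergence _ ?_ ?_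
      (integrable_diracKernel_apply hn hc hDc hDs).norm ?_
    · filter_upwards [self_mem_nhdsWithin] with ε hε
      refine Continuous.aestronglyMeasurable (Continuous.smul ?_ (c.continuous.clm_apply hDc))
      exact Continuous.rpow_const (by fun_prop) fun z => Or.inl (hq z hε).ne'
    · filter_upwards [self_mem_nhdsWithin] with ε hε
      filter_upwards [hne] with z hz
      rw [diracKernel, _root_.smul_apply, norm_smul, norm_smul]
      gcongr
      have hz' := norm_pos_iff.2 hz
      rw [Real.norm_of_nonneg (Real.rpow_nonneg (hq z hε).le _),
        Real.norm_of_nonneg (invDensity_nonneg z), ← e0 hz]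
      refine Real.rpow_le_rpow_of_nonpos (by positivity) (by nlinarith) ?_
      have : (0 : ℝ) ≤ n := n.cast_nonneg
      linarith
    · filter_upwards [hne] with z hz
      have hz' := norm_pos_iff.2 hz
      have h1 : ContinuousAt (fun ε : ℝ => (‖z‖ ^ 2 + ε ^ 2) ^ (-(n : ℝ) / 2)) 0 :=
        ContinuousAt.rpow_const (by fun_prop) (Or.inl (by positivity))
      have h2 := (h1.tendsto.smul_const (c z (diracOp c u z))).mono_left
        (nhdsWithin_le_nhds (s := Ioi 0))
      simpa [diracKernel, e0 hz] using h2
  have lim2 : Tendsto (fun ε : ℝ => ∫ z, ((‖z‖ ^ 2 + ε ^ 2) ^ (-(n : ℝ) / 2)) •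
      c z (diracOp c u z)) (𝓝[>] 0) (𝓝 (pompeiuConst n • u 0)) := by
    rw [pompeiuConst, ← integral_smul_const]
    refine Tendsto.congr' (f₁ := fun ε : ℝ => ∫ w, (n * ((1 : ℝ) + ‖w‖ ^ 2) ^
      (-(n + 2 : ℝ) / 2)) • u (ε • w)) ?_ ?_
    · filter_upwards [self_mem_nhdsWithin] with ε hε
      rw [integral_rpow_smul_clifford_diracOp hc hu hs hε,
        integral_rpow_smul_eq_integral_dilation u hε]
    have hc1 : Continuous fun w : EuclideanSpace ℝ (Fin n) =>
        n * ((1 : ℝ) + ‖w‖ ^ 2) ^ (-(n + 2 : ℝ) / 2) :=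
      continuous_const.mul (Continuous.rpow_const (by fun_prop)
        fun w => Or.inl (by positivity))
    refine tendsto_integral_filter_of_dominated_convergence _ (Eventually.of_forall fun ε => ?_)
      (Eventually.of_forall fun ε => Eventually.of_forall fun w => ?_)
      ((integrable_pompeiu n).mul_const M) (Eventually.of_forall fun w => ?_)
    · have := hu.continuous
      exact (hc1.smul (by fun_prop)).aestronglyMeasurable
    · rw [norm_smul, Real.norm_of_nonneg (by positivity)]
      exact mul_le_mul_of_nonneg_left (hM _) (by positivity)
    · have h1 : ContinuousAt (fun ε : ℝ => u (ε • w)) 0 := by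
        have := hu.continuous
        fun_prop
      have := (h1.tendsto.const_smul (n * ((1 : ℝ) + ‖w‖ ^ 2) ^ (-(n + 2 : ℝ) / 2))).mono_left
        (nhdsWithin_le_nhds (s := Ioi 0))
      simpa using this
  exact tendsto_nhds_unique lim2 lim1

/-- The Cauchy–Pompeiu representation formula. -/
theorem pompeiuConst_smul_apply [CompleteSpace F] (hn : 1 ≤ n) (hc : IsCliffordMul c)
    {u : EuclideanSpace ℝ (Fin n) → F} (hu : ContDiff ℝ 1 u) (hs : HasCompactSupport u)
    (x : EuclideanSpace ℝ (Fin n)) :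
    pompeiuConst n • u x = ∫ y, diracKernel c (y - x) (diracOp c u y) := by
  have h := pompeiuConst_smul_apply_zero hn hc
    (u := fun z => u (x + z)) (hu.comp (contDiff_const.add contDiff_id))
    (hs.comp_homeomorph (Homeomorph.addLeft x))
  simp only [add_zero] at h
  rw [h, ← integral_add_left_eq_self (fun y => diracKernel c (y - x) (diracOp c u y)) x]
  refine integral_congr_ae (Eventually.of_forall fun z => ?_)
  simp [diracOp, fderiv_comp_add_left]

end CauchyPompeiu

section KernelTaylor

open Set Filter Topology Metric
open scoped RealInnerProductSpace

variable {n : ℕ} {F : Type*} [NormedAddCommGroup F] [InnerProductSpace ℝ F]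
  {c : EuclideanSpace ℝ (Fin n) →L[ℝ] F →L[ℝ] F}

theorem contDiffAt_diracKernel {m : WithTop ℕ∞} {z : EuclideanSpace ℝ (Fin n)} (hz : z ≠ 0) :
    ContDiffAt ℝ m (diracKernel c) z :=
  (((contDiffAt_norm ℝ hz).pow n).inv (by simpa using fun h => absurd h hz)).smul
    c.contDiff.contDiffAt

theorem diracKernel_smul {t : ℝ} (ht : 0 ≤ t) (z : EuclideanSpace ℝ (Fin n)) :
    diracKernel c (t • z) = (t * (t ^ n)⁻¹) • diracKernel c z := by
  simp only [diracKernel, invDensity, norm_smul, Real.norm_of_nonneg ht, mul_pow, mul_inv, map_smul,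
    smul_smul]
  congr 1
  ring

theorem iteratedFDeriv_comp_smul_apply {E G : Type*} [NormedAddCommGroup E] [NormedSpace ℝ E]
    [NormedAddCommGroup G] [NormedSpace ℝ G] (f : E → G) {r : ℝ} (hr : r ≠ 0) (j : ℕ) (w : E)
    (v : Fin j → E) :
    iteratedFDeriv ℝ j (fun y => f (r • y)) w v =
      iteratedFDeriv ℝ j f (r • w) (fun i => r • v i) := by
  have h1 := (ContinuousLinearEquiv.smulLeft (R₁ := ℝ) (M₁ := E)
    (Units.mk0 r hr)).iteratedFDerivWithin_comp_right f (s := univ) uniqueDiffOn_univ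
    (x := w) (mem_univ _) j
  simp only [preimage_univ, iteratedFDerivWithin_univ] at h1
  exact congrArg (fun A => A v) h1

theorem exists_norm_iteratedFDeriv_diracKernel_le (hn : 1 ≤ n)
    (c : EuclideanSpace ℝ (Fin n) →L[ℝ] F →L[ℝ] F) (j : ℕ) :
    ∃ C, 0 ≤ C ∧ ∀ z : EuclideanSpace ℝ (Fin n), z ≠ 0 →
      ‖iteratedFDeriv ℝ j (diracKernel c) z‖ ≤ C * (‖z‖ ^ (n - 1 + j))⁻¹ := by
  obtain ⟨C, hC⟩ := (isCompact_sphere (0 : EuclideanSpace ℝ (Fin n)) 1).exists_bound_of_continuousOn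
    (f := iteratedFDeriv ℝ j (diracKernel c)) fun w hw =>
      ((contDiffAt_diracKernel (c := c) (m := j)
        (ne_zero_of_mem_unit_sphere ⟨w, hw⟩)).continuousAt_iteratedFDeriv le_rfl).continuousWithinAt
  refine ⟨max C 0, le_max_right _ _, fun z hz => ?_⟩
  have hr : 0 < ‖z‖ := norm_pos_iff.2 hz
  set r := ‖z‖ with hrdef
  obtain ⟨w, hw⟩ : ∃ w, w = r⁻¹ • z := ⟨_, rfl⟩
  have hrw : r • w = z := by rw [hw, smul_inv_smul₀ hr.ne']
  have hw1 : ‖w‖ = 1 := by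
    rw [hw, norm_smul, norm_inv, Real.norm_of_nonneg hr.le, ← hrdef, inv_mul_cancel₀ hr.ne']
  have hw0 : w ≠ 0 := by rw [← norm_ne_zero_iff, hw1]; exact one_ne_zero
  set s := r * (r ^ n)⁻¹
  have hs : 0 ≤ s := by positivity
  have h2 : (fun v => diracKernel c (r • v)) = s • diracKernel c := by
    ext1 v
    exact diracKernel_smul hr.le v
  refine ContinuousMultilinearMap.opNorm_le_bound (by positivity) fun v => ?_
  have h3 : iteratedFDeriv ℝ j (diracKernel c) z v =
      s • iteratedFDeriv ℝ j (diracKernel c) w (fun i => r⁻¹ • v i) := by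
    have h1 := iteratedFDeriv_comp_smul_apply (diracKernel c) hr.ne' j w fun i => r⁻¹ • v i
    rw [h2, iteratedFDeriv_const_smul_apply (contDiffAt_diracKernel hw0), hrw] at h1
    simp only [smul_inv_smul₀ hr.ne'] at h1
    exact h1.symm
  have h4 : ‖iteratedFDeriv ℝ j (diracKernel c) w (fun i => r⁻¹ • v i)‖ ≤
      max C 0 * ∏ i, ‖r⁻¹ • v i‖ :=
    (ContinuousMultilinearMap.le_opNorm _ _).trans (mul_le_mul_of_nonneg_right
      ((hC w (mem_sphere_zero_iff_norm.2 hw1)).trans (le_max_left _ _))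
      (Finset.prod_nonneg fun _ _ => norm_nonneg _))
  rw [h3, norm_smul, Real.norm_of_nonneg hs]
  refine (mul_le_mul_of_nonneg_left h4 hs).trans_eq ?_
  simp only [norm_smul, norm_inv, Real.norm_of_nonneg hr.le, Finset.prod_mul_distrib,
    Finset.prod_const, Finset.card_univ, Fintype.card_fin]
  obtain ⟨d, rfl⟩ : ∃ d, n = d + 1 := ⟨n - 1, by omega⟩
  simp only [s, Nat.add_sub_cancel, pow_add, pow_one, inv_pow]
  field_simp

theorem exists_norm_diracKernel_sub_taylor_le [CompleteSpace F] (hn : 1 ≤ n)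
    (c : EuclideanSpace ℝ (Fin n) →L[ℝ] F →L[ℝ] F) (k : ℕ) :
    ∃ C, 0 ≤ C ∧ ∀ x y : EuclideanSpace ℝ (Fin n), y ≠ 0 → 2 * ‖x‖ ≤ ‖y‖ →
      ‖diracKernel c (y - x) - ∑ j ∈ Finset.range (k + 1),
        (j.factorial : ℝ)⁻¹ • iteratedFDeriv ℝ j (diracKernel c) y (fun _ => -x)‖ ≤
        C * (‖x‖ ^ (k + 1) * (‖y‖ ^ (n + k))⁻¹) := by
  obtain ⟨C, hC0, hC⟩ := exists_norm_iteratedFDeriv_diracKernel_le hn c (k + 1)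
  refine ⟨(k.factorial : ℝ)⁻¹ * (C * 2 ^ (n + k)), by positivity, fun x y hy hxy => ?_⟩
  have hy' : 0 < ‖y‖ := norm_pos_iff.2 hy
  have hge (t : ℝ) (ht : t ∈ Icc (0 : ℝ) 1) : ‖y‖ / 2 ≤ ‖y + t • -x‖ := by
    have h1 : ‖t • -x‖ ≤ ‖y‖ / 2 := by
      rw [norm_smul, Real.norm_of_nonneg ht.1, norm_neg]
      nlinarith [norm_nonneg x, ht.2]
    have := norm_sub_le (y + t • -x) (t • -x)
    rw [add_sub_cancel_right] at this
    linarith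
  have hne (t : ℝ) (ht : t ∈ Icc (0 : ℝ) 1) : y + t • -x ≠ 0 := by
    rw [← norm_pos_iff]
    exact (half_pos hy').trans_le (hge t ht)
  have hT := map_add_eq_sum_add_integral_iteratedFDeriv (f := diracKernel c) (x := y) (y := -x)
    (n := k) fun t ht => contDiffAt_diracKernel (hne t ht)
  rw [sub_eq_add_neg y x, hT, add_sub_cancel_left, norm_smul, norm_inv,
    Real.norm_of_nonneg (Nat.cast_nonneg _), mul_assoc]
  gcongr
  have := intervalIntegral.norm_integral_le_of_norm_le_const (a := 0) (b := 1)
    (f := fun t : ℝ => (1 - t) ^ k •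
      iteratedFDeriv ℝ (k + 1) (diracKernel c) (y + t • -x) fun _ => -x)
    (C := C * 2 ^ (n + k) * (‖x‖ ^ (k + 1) * (‖y‖ ^ (n + k))⁻¹)) fun t ht => ?_
  · simpa using this
  · rw [uIoc_of_le zero_le_one] at ht
    have ht' : t ∈ Icc (0 : ℝ) 1 := ⟨ht.1.le, ht.2⟩
    rw [norm_smul, norm_pow, Real.norm_of_nonneg (by linarith [ht.2])]
    have h1 : (1 - t) ^ k ≤ 1 := pow_le_one₀ (by linarith [ht.2]) (by linarith [ht.1])
    have h2 := ContinuousMultilinearMap.le_opNorm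
      (iteratedFDeriv ℝ (k + 1) (diracKernel c) (y + t • -x)) fun _ => -x
    have h3 := hC _ (hne t ht')
    have h4 : (‖y + t • -x‖ ^ (n - 1 + (k + 1)))⁻¹ ≤ 2 ^ (n + k) * (‖y‖ ^ (n + k))⁻¹ := by
      rw [show n - 1 + (k + 1) = n + k by omega]
      have : (‖y + t • -x‖ ^ (n + k))⁻¹ ≤ ((‖y‖ / 2) ^ (n + k))⁻¹ := by
        gcongr
        exact hge t ht'
      refine this.trans_eq ?_
      rw [div_pow, inv_div, div_eq_mul_inv]
    simp only [norm_neg, Finset.prod_const, Finset.card_univ, Fintype.card_fin] at h2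
    refine (mul_le_of_le_one_left (norm_nonneg _) h1).trans (h2.trans ?_)
    calc _ ≤ C * (2 ^ (n + k) * (‖y‖ ^ (n + k))⁻¹) * ‖x‖ ^ (k + 1) := by
          gcongr
          exact h3.trans (by gcongr)
      _ = _ := by ring

end KernelTaylor

section KernelExpansion

open Set Filter Topology Metric
open scoped RealInnerProductSpace

variable {n : ℕ} {F : Type*} [NormedAddCommGroup F] [InnerProductSpace ℝ F]
  {c : EuclideanSpace ℝ (Fin n) →L[ℝ] F →L[ℝ] F}

/-- The iterated derivative of the kernel at `y`, applied to the vector `a`. -/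
noncomputable def kernelJet (c : EuclideanSpace ℝ (Fin n) →L[ℝ] F →L[ℝ] F) (j : ℕ)
    (y : EuclideanSpace ℝ (Fin n)) (a : F) :
    ContinuousMultilinearMap ℝ (fun _ : Fin j => EuclideanSpace ℝ (Fin n)) F :=
  (ContinuousLinearMap.apply ℝ F a).compContinuousMultilinearMap
    (iteratedFDeriv ℝ j (diracKernel c) y)

theorem kernelJet_apply (j : ℕ) (y : EuclideanSpace ℝ (Fin n)) (a : F)
    (v : Fin j → EuclideanSpace ℝ (Fin n)) :
    kernelJet c j y a v = iteratedFDeriv ℝ j (diracKernel c) y v a := rfl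

theorem norm_kernelJet_le (j : ℕ) (y : EuclideanSpace ℝ (Fin n)) (a : F) :
    ‖kernelJet c j y a‖ ≤ ‖iteratedFDeriv ℝ j (diracKernel c) y‖ * ‖a‖ := by
  refine ContinuousMultilinearMap.opNorm_le_bound (by positivity) fun v => ?_
  rw [kernelJet_apply, mul_right_comm]
  exact (ContinuousLinearMap.le_opNorm _ _).trans
    (mul_le_mul_of_nonneg_right (ContinuousMultilinearMap.le_opNorm _ _) (norm_nonneg _))

theorem inv_pow_mul_sqrt_pow (hn : 1 ≤ n) {j p : ℕ} (hj : 2 * j ≤ p) {y : ℝ} (hy : 0 < y) :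
    (y ^ (n - 1 + j))⁻¹ * √y ^ p = √y / y ^ n * √y ^ (p + 1 - 2 * j) := by
  obtain ⟨d, rfl⟩ : ∃ d, n = d + 1 := ⟨n - 1, by omega⟩
  obtain ⟨q, rfl⟩ : ∃ q, p = 2 * j + q := ⟨p - 2 * j, by omega⟩
  have hs : 0 < √y := Real.sqrt_pos.2 hy
  rw [show 2 * j + q + 1 - 2 * j = q + 1 by omega]
  have e : y = √y ^ 2 := (Real.sq_sqrt hy.le).symm
  set s := √y
  rw [e, Nat.add_sub_cancel, pow_add s, pow_mul s]
  field_simp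
  ring

theorem aestronglyMeasurable_kernelJet (hn : 1 ≤ n) {g : EuclideanSpace ℝ (Fin n) → F}
    (hg : Continuous g) (j : ℕ) :
    AEStronglyMeasurable (fun y => kernelJet c j y (g y)) := by
  have : Nonempty (Fin n) := ⟨⟨0, hn⟩⟩
  have h : ContinuousOn (fun y => kernelJet c j y (g y)) {0}ᶜ := by
    have h1 : ContinuousOn (iteratedFDeriv ℝ j (diracKernel c)) {0}ᶜ := fun y hy =>
      ((contDiffAt_diracKernel (c := c) (m := j) hy).continuousAt_iteratedFDeriv
        le_rfl).continuousWithinAt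
    have h2 : Continuous fun y => ContinuousLinearMap.apply ℝ F (g y) :=
      (ContinuousLinearMap.apply ℝ F).continuous.comp hg
    exact ((ContinuousLinearMap.compContinuousMultilinearMapL ℝ
      (fun _ : Fin j => EuclideanSpace ℝ (Fin n)) (F →L[ℝ] F) F).continuous.comp
        h2).continuousOn.clm_apply h1
  have h3 := h.aestronglyMeasurable (μ := volume) (measurableSet_singleton 0).compl
  rwa [Measure.restrict_eq_self_of_ae_mem] at h3
  exact compl_mem_ae_iff.2 (measure_singleton 0)

theorem integrable_kernelJet (hn : 1 ≤ n) {g : EuclideanSpace ℝ (Fin n) → F}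
    (hg : Continuous g) (hs : HasCompactSupport g) {A : ℝ} {p : ℕ}
    (hA : ∀ y, ‖g y‖ ≤ A * √‖y‖ ^ p) {j : ℕ} (hj : 2 * j ≤ p) :
    Integrable fun y => kernelJet c j y (g y) := by
  have : Nonempty (Fin n) := ⟨⟨0, hn⟩⟩
  obtain ⟨C, hC0, hC⟩ := exists_norm_iteratedFDeriv_diracKernel_le hn c j
  obtain ⟨r, hr0, hr⟩ := hs.isCompact.isBounded.subset_ball_lt 0 0
  have hW := (integrable_indicator_iff measurableSet_ball).2
    (integrableOn_sqrt_norm_div_norm_pow hn r)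
  have hne : ∀ᵐ z : EuclideanSpace ℝ (Fin n), z ≠ 0 := compl_mem_ae_iff.2 (measure_singleton 0)
  refine (hW.const_mul (C * |A| * √r ^ (p + 1 - 2 * j))).mono'
    (aestronglyMeasurable_kernelJet hn hg j) ?_
  filter_upwards [hne] with y hy
  have hy' := norm_pos_iff.2 hy
  have h0 := norm_kernelJet_le (c := c) j y (g y)
  by_cases hyr : y ∈ ball 0 r
  · rw [indicator_of_mem hyr]
    have h1 : √‖y‖ ≤ √r := Real.sqrt_le_sqrt (mem_ball_zero_iff.1 hyr).le
    have h2 : ‖g y‖ ≤ |A| * √‖y‖ ^ p := (hA y).trans (by gcongr; exact le_abs_self A)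
    refine h0.trans ((mul_le_mul (hC y hy) h2 (norm_nonneg _) (by positivity)).trans ?_)
    calc C * (‖y‖ ^ (n - 1 + j))⁻¹ * (|A| * √‖y‖ ^ p)
        = C * |A| * ((‖y‖ ^ (n - 1 + j))⁻¹ * √‖y‖ ^ p) := by ring
      _ = C * |A| * (√‖y‖ / ‖y‖ ^ n * √‖y‖ ^ (p + 1 - 2 * j)) := by
          rw [inv_pow_mul_sqrt_pow hn hj hy']
      _ ≤ C * |A| * (√‖y‖ / ‖y‖ ^ n * √r ^ (p + 1 - 2 * j)) := by gcongr
      _ = _ := by ring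
  · have : g y = 0 := image_eq_zero_of_notMem_tsupport fun h => hyr (hr h)
    rw [indicator_of_notMem hyr, mul_zero]
    simpa [this] using h0

theorem exists_norm_kernel_remainder_le [CompleteSpace F] (hn : 1 ≤ n) (hc : IsCliffordMul c)
    {p k : ℕ} (hk : 2 * k ≤ p) (hp : p ≤ 2 * k + 1) :
    ∃ C, 0 ≤ C ∧ ∀ (x y : EuclideanSpace ℝ (Fin n)) (a : F) (A : ℝ), y ≠ 0 →
      ‖a‖ ≤ A * √‖y‖ ^ p →
      ‖diracKernel c (y - x) a - ∑ j ∈ Finset.range (k + 1),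
        (j.factorial : ℝ)⁻¹ • kernelJet c j y a (fun _ => -x)‖ ≤
        C * A * √‖x‖ ^ (p + 1) * (√‖y‖ / ‖y‖ ^ n + √‖y - x‖ / ‖y - x‖ ^ n) := by
  obtain ⟨C₁, hC₁0, hC₁⟩ := exists_norm_diracKernel_sub_taylor_le hn c k
  choose C₂ hC₂0 hC₂ using exists_norm_iteratedFDeriv_diracKernel_le hn c
  set S := ∑ j ∈ Finset.range (k + 1), C₂ j with hS
  have hS0 : 0 ≤ S := Finset.sum_nonneg fun j _ => hC₂0 j
  refine ⟨C₁ + 2 ^ (p + 1) * (1 + S), by positivity, fun x y a A hy ha => ?_⟩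
  have hy' := norm_pos_iff.2 hy
  have hA : 0 ≤ A := by
    have := (norm_nonneg a).trans ha
    have h2 : 0 < √‖y‖ ^ p := pow_pos (Real.sqrt_pos.2 hy') p
    exact nonneg_of_mul_nonneg_left this h2
  have hW : 0 ≤ √‖y‖ / ‖y‖ ^ n := by positivity
  have hW' : 0 ≤ √‖y - x‖ / ‖y - x‖ ^ n := by positivity
  rcases le_or_gt (2 * ‖x‖) ‖y‖ with hxy | hxy
  · have h1 := hC₁ x y hy hxy
    have h2 : diracKernel c (y - x) a - ∑ j ∈ Finset.range (k + 1),
        (j.factorial : ℝ)⁻¹ • kernelJet c j y a (fun _ => -x) =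
        (diracKernel c (y - x) - ∑ j ∈ Finset.range (k + 1),
        (j.factorial : ℝ)⁻¹ • iteratedFDeriv ℝ j (diracKernel c) y (fun _ => -x)) a := by
      simp [kernelJet_apply, _root_.sum_apply]
    rw [h2]
    have hts : √‖x‖ ≤ √‖y‖ := Real.sqrt_le_sqrt (by linarith [norm_nonneg x])
    have key : ‖x‖ ^ (k + 1) * (‖y‖ ^ (n + k))⁻¹ * √‖y‖ ^ p ≤
        √‖x‖ ^ (p + 1) * (√‖y‖ / ‖y‖ ^ n) := by
      have ex : ‖x‖ = √‖x‖ ^ 2 := (Real.sq_sqrt (norm_nonneg x)).symm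
      have ey : ‖y‖ = √‖y‖ ^ 2 := (Real.sq_sqrt (norm_nonneg y)).symm
      have hs : 0 < √‖y‖ := Real.sqrt_pos.2 hy'
      have ht : 0 ≤ √‖x‖ := Real.sqrt_nonneg _
      set s := √‖y‖
      set t := √‖x‖
      rw [ex, ey]
      have h3 : t ^ (2 * k + 2) * s ^ p ≤ t ^ (p + 1) * (s * s ^ (2 * k)) := by
        obtain rfl | rfl : p = 2 * k ∨ p = 2 * k + 1 := by omega
        · have : t ^ (2 * k + 2) * s ^ (2 * k) = t ^ (2 * k + 1) * (t * s ^ (2 * k)) := by ring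
          rw [this]
          gcongr
        · exact le_of_eq (by ring)
      have e1 : (t ^ 2) ^ (k + 1) * ((s ^ 2) ^ (n + k))⁻¹ * s ^ p =
          (t ^ (2 * k + 2) * s ^ p) * (((s ^ 2) ^ n)⁻¹ * (s ^ (2 * k))⁻¹) := by
        rw [pow_add (s ^ 2), mul_inv, ← pow_mul t, ← pow_mul s 2 k]
        ring
      have e2 : t ^ (p + 1) * (s / (s ^ 2) ^ n) =
          (t ^ (p + 1) * (s * s ^ (2 * k))) * (((s ^ 2) ^ n)⁻¹ * (s ^ (2 * k))⁻¹) := by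
        field_simp
      rw [e1, e2]
      gcongr
    calc _ ≤ C₁ * (‖x‖ ^ (k + 1) * (‖y‖ ^ (n + k))⁻¹) * (A * √‖y‖ ^ p) :=
          (ContinuousLinearMap.le_opNorm _ _).trans
            (mul_le_mul h1 ha (norm_nonneg _) (by positivity))
      _ = C₁ * A * (‖x‖ ^ (k + 1) * (‖y‖ ^ (n + k))⁻¹ * √‖y‖ ^ p) := by ring
      _ ≤ C₁ * A * (√‖x‖ ^ (p + 1) * (√‖y‖ / ‖y‖ ^ n)) := by gcongr
      _ = C₁ * A * √‖x‖ ^ (p + 1) * (√‖y‖ / ‖y‖ ^ n) := by ring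
      _ ≤ _ := by
          gcongr
          · exact le_add_of_nonneg_right (by positivity)
          · exact le_add_of_nonneg_right hW'
  · have hst : √‖y‖ ≤ 2 * √‖x‖ := by
      rw [Real.sqrt_le_left (by positivity), mul_pow, Real.sq_sqrt (norm_nonneg x)]
      linarith [norm_nonneg x]
    have hst' : √‖y - x‖ ≤ 2 * √‖x‖ := by
      rw [Real.sqrt_le_left (by positivity), mul_pow, Real.sq_sqrt (norm_nonneg x)]
      linarith [norm_nonneg x, norm_sub_le y x]
    have hK : ‖diracKernel c (y - x) a‖ ≤
        2 ^ (p + 1) * A * √‖x‖ ^ (p + 1) * (√‖y - x‖ / ‖y - x‖ ^ n) := by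
      rw [norm_diracKernel_apply hc]
      have e : ‖y - x‖ / ‖y - x‖ ^ n = √‖y - x‖ * (√‖y - x‖ / ‖y - x‖ ^ n) := by
        rw [mul_div_assoc', Real.mul_self_sqrt (norm_nonneg _)]
      rw [e]
      calc _ ≤ 2 * √‖x‖ * (√‖y - x‖ / ‖y - x‖ ^ n) * (A * (2 * √‖x‖) ^ p) := by
            gcongr
            exact ha.trans (by gcongr)
        _ = _ := by ring
    have hJ (j : ℕ) (hj : j ∈ Finset.range (k + 1)) :
        ‖(j.factorial : ℝ)⁻¹ • kernelJet c j y a (fun _ => -x)‖ ≤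
        C₂ j * (2 ^ (p + 1) * A * √‖x‖ ^ (p + 1) * (√‖y‖ / ‖y‖ ^ n)) := by
      have hj' : 2 * j ≤ p := by have := Finset.mem_range.1 hj; omega
      have h1 : ‖kernelJet c j y a (fun _ => -x)‖ ≤ ‖kernelJet c j y a‖ * ‖x‖ ^ j := by
        simpa using ContinuousMultilinearMap.le_opNorm (kernelJet c j y a) fun _ => -x
      have hf : (j.factorial : ℝ)⁻¹ ≤ 1 :=
        inv_le_one_of_one_le₀ (by exact_mod_cast j.factorial_pos)
      rw [norm_smul, norm_inv, Real.norm_of_nonneg (Nat.cast_nonneg _)]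
      refine (mul_le_of_le_one_left (norm_nonneg _) hf).trans (h1.trans ?_)
      calc _ ≤ C₂ j * (‖y‖ ^ (n - 1 + j))⁻¹ * (A * √‖y‖ ^ p) * ‖x‖ ^ j := by
            gcongr
            exact (norm_kernelJet_le j y a).trans
              (mul_le_mul (hC₂ j y hy) ha (norm_nonneg _)
                (mul_nonneg (hC₂0 j) (by positivity)))
        _ = C₂ j * A * ((‖y‖ ^ (n - 1 + j))⁻¹ * √‖y‖ ^ p) * ‖x‖ ^ j := by ring
        _ = C₂ j * A * (√‖y‖ / ‖y‖ ^ n * √‖y‖ ^ (p + 1 - 2 * j)) * (√‖x‖ ^ 2) ^ j := by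
            rw [inv_pow_mul_sqrt_pow hn hj' hy', Real.sq_sqrt (norm_nonneg x)]
        _ ≤ C₂ j * A * (√‖y‖ / ‖y‖ ^ n * (2 * √‖x‖) ^ (p + 1 - 2 * j)) *
              (2 ^ (2 * j) * (√‖x‖ ^ 2) ^ j) := by
            have := hC₂0 j
            gcongr
            exact le_mul_of_one_le_left (by positivity) (one_le_pow₀ one_le_two)
        _ = C₂ j * A * (√‖y‖ / ‖y‖ ^ n) * ((2 * √‖x‖) ^ (p + 1 - 2 * j) * (2 * √‖x‖) ^ (2 * j)) := by
            rw [← pow_mul, mul_pow _ _ (2 * j)]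
            ring
        _ = _ := by
            rw [← pow_add, Nat.sub_add_cancel (by omega), mul_pow]
            ring
    refine (norm_sub_le _ _).trans ((add_le_add hK ((norm_sum_le _ _).trans
      (Finset.sum_le_sum hJ))).trans ?_)
    rw [← Finset.sum_mul, ← hS]
    set X := A * √‖x‖ ^ (p + 1) with hX
    have hX0 : 0 ≤ X := by positivity
    have h1 := mul_nonneg (mul_nonneg hC₁0 hX0) (add_nonneg hW hW')
    have h2 := mul_nonneg (mul_nonneg (pow_nonneg zero_le_two (p + 1)) hX0) hW
    have h3 := mul_nonneg (mul_nonneg (mul_nonneg (pow_nonneg zero_le_two (p + 1)) hX0) hW') hS0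
    simp only [hX] at h1 h2 h3
    linarith

end KernelExpansion

section KernelExpansion

open Set Filter Topology Metric
open scoped RealInnerProductSpace

variable {n : ℕ} {F : Type*} [NormedAddCommGroup F] [InnerProductSpace ℝ F]
  {c : EuclideanSpace ℝ (Fin n) →L[ℝ] F →L[ℝ] F}

theorem exists_integral_diracKernel_expansion [CompleteSpace F] (hn : 1 ≤ n)
    (hc : IsCliffordMul c) {g : EuclideanSpace ℝ (Fin n) → F} (hg : Continuous g)
    (hs : HasCompactSupport g) {A : ℝ} {p k : ℕ} (hk : 2 * k ≤ p) (hp : p ≤ 2 * k + 1)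
    (hA : ∀ y, ‖g y‖ ≤ A * √‖y‖ ^ p) :
    ∃ (M : (j : ℕ) → ContinuousMultilinearMap ℝ (fun _ : Fin j => EuclideanSpace ℝ (Fin n)) F)
      (C : ℝ), ∀ x, ‖x‖ ≤ 1 →
        ‖(∫ y, diracKernel c (y - x) (g y)) - ∑ j ∈ Finset.range (k + 1), M j (fun _ => x)‖ ≤
          C * √‖x‖ ^ (p + 1) := by
  have : Nonempty (Fin n) := ⟨⟨0, hn⟩⟩
  have hne : ∀ᵐ z : EuclideanSpace ℝ (Fin n), z ≠ 0 := compl_mem_ae_iff.2 (measure_singleton 0)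
  obtain ⟨C, hC0, hC⟩ := exists_norm_kernel_remainder_le hn hc hk hp
  obtain ⟨r, hr0, hr⟩ := hs.isCompact.isBounded.subset_ball_lt 0 0
  set W : EuclideanSpace ℝ (Fin n) → ℝ :=
    (ball 0 (r + 1)).indicator fun x => √‖x‖ / ‖x‖ ^ n with hWdef
  have hW : Integrable W := (integrable_indicator_iff measurableSet_ball).2
    (integrableOn_sqrt_norm_div_norm_pow hn (r + 1))
  have hW0 (y) : 0 ≤ W y := indicator_nonneg (fun _ _ => by positivity) y
  have hJ (j : ℕ) (hj : j ∈ Finset.range (k + 1)) :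
      Integrable fun y => kernelJet c j y (g y) :=
    integrable_kernelJet hn hg hs hA (by have := Finset.mem_range.1 hj; omega)
  refine ⟨fun j => ((-1) ^ j * (j.factorial : ℝ)⁻¹) • ∫ y, kernelJet c j y (g y),
    C * |A| * (2 * ∫ y, W y), fun x hx => ?_⟩
  have hJx (j : ℕ) (hj : j ∈ Finset.range (k + 1)) :
      Integrable fun y => (j.factorial : ℝ)⁻¹ • kernelJet c j y (g y) (fun _ => -x) :=
    ((ContinuousMultilinearMap.apply ℝ (fun _ : Fin j => EuclideanSpace ℝ (Fin n)) F
      fun _ => -x).integrable_comp (hJ j hj)).smul _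
  have hM : ∑ j ∈ Finset.range (k + 1), (((-1) ^ j * (j.factorial : ℝ)⁻¹) •
      ∫ y, kernelJet c j y (g y)) (fun _ => x) =
      ∫ y, ∑ j ∈ Finset.range (k + 1),
        (j.factorial : ℝ)⁻¹ • kernelJet c j y (g y) (fun _ => -x) := by
    rw [integral_finsetSum _ hJx]
    refine Finset.sum_congr rfl fun j hj => ?_
    rw [integral_smul, ← ContinuousMultilinearMap.integral_apply (hJ j hj),
      _root_.smul_apply]
    have := (∫ y, kernelJet c j y (g y)).map_smul_univ (fun _ => (-1 : ℝ)) fun _ => x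
    simp only [neg_smul, one_smul, Finset.prod_const, Finset.card_univ, Fintype.card_fin] at this
    rw [this, smul_smul, mul_comm]
  have hKi : Integrable fun y => diracKernel c (y - x) (g y) := by
    have h1 := (integrable_diracKernel_apply hn hc (g := fun z => g (z + x)) (by fun_prop)
      (hs.comp_homeomorph (Homeomorph.addRight x))).comp_sub_right x
    simpa using h1
  rw [hM, ← integral_sub hKi (integrable_finsetSum _ hJx)]
  refine (norm_integral_le_of_norm_le (g := fun y => C * |A| * √‖x‖ ^ (p + 1) *
    (W y + W (y - x))) ((hW.add (hW.comp_sub_right x)).const_mul _) ?_).trans_eq ?_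
  · filter_upwards [hne] with y hy
    by_cases hyr : y ∈ ball 0 r
    · have h1 : W y = √‖y‖ / ‖y‖ ^ n :=
        indicator_of_mem (ball_subset_ball (by linarith) hyr) _
      have h2 : W (y - x) = √‖y - x‖ / ‖y - x‖ ^ n := by
        refine indicator_of_mem (mem_ball_zero_iff.2 ?_) _
        have := mem_ball_zero_iff.1 hyr
        linarith [norm_sub_le y x]
      rw [h1, h2]
      refine hC x y (g y) |A| hy ((hA y).trans ?_)
      gcongr
      exact le_abs_self A
    · have : g y = 0 := image_eq_zero_of_notMem_tsupport fun h => hyr (hr h)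
      have h0 : ∀ j, kernelJet c j y (g y) (fun _ => -x) = 0 := fun j => by
        rw [kernelJet_apply, this, map_zero]
      rw [Finset.sum_eq_zero fun j _ => by rw [h0, smul_zero], this, map_zero, sub_zero, norm_zero]
      have := hW0 y
      have := hW0 (y - x)
      positivity
  · rw [integral_const_mul, integral_add hW (hW.comp_sub_right x), integral_sub_right_eq_self]
    ring

end KernelExpansion

section LeadingTerm

open Set Filter Topology Metric
open scoped RealInnerProductSpace

variable {n : ℕ} {F : Type*} [NormedAddCommGroup F] [InnerProductSpace ℝ F]
  {c : EuclideanSpace ℝ (Fin n) →L[ℝ] F →L[ℝ] F}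

theorem eq_zero_of_sum_pow_smul_isBigO {G : Type*} [NormedAddCommGroup G] [NormedSpace ℝ G]
    (m : ℕ) : ∀ (a : ℕ → G) (q : ℕ), 2 * m ≤ q + 1 →
      (fun t : ℝ => ∑ j ∈ Finset.range m, t ^ j • a j) =O[𝓝[>] 0] (fun t => √t ^ q) →
      ∀ j < m, a j = 0 := by
  induction m with
  | zero => intro a q _ _ j hj; omega
  | succ m ih =>
    intro a q hq h
    have h0 : a 0 = 0 := by
      have h1 : Tendsto (fun t : ℝ => √t ^ q) (𝓝[>] 0) (𝓝 0) := by
        have : Continuous fun t : ℝ => √t ^ q := by fun_prop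
        have h2 := (this.tendsto 0).mono_left (nhdsWithin_le_nhds (s := Ioi 0))
        simpa [show q ≠ 0 by omega] using h2
      have h2 := h.trans_tendsto h1
      have h3 : Tendsto (fun t : ℝ => ∑ j ∈ Finset.range (m + 1), t ^ j • a j) (𝓝[>] 0)
          (𝓝 (a 0)) := by
        have : Continuous fun t : ℝ => ∑ j ∈ Finset.range (m + 1), t ^ j • a j := by fun_prop
        have h2 := (this.tendsto 0).mono_left (nhdsWithin_le_nhds (s := Ioi 0))
        simpa [Finset.sum_range_succ'] using h2
      exact tendsto_nhds_unique h3 h2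
    intro j hj
    rcases j with _ | j
    · exact h0
    · refine ih (fun j => a (j + 1)) (q - 2) (by omega) ?_ j (by omega)
      obtain ⟨C, hC⟩ := h.bound
      rcases Nat.lt_or_ge q 2 with hq2 | hq2
      · omega
      refine Asymptotics.IsBigO.of_bound C ?_
      filter_upwards [hC, self_mem_nhdsWithin] with t ht ht0
      have ht0' : (0 : ℝ) < t := ht0
      rw [Finset.sum_range_succ', h0, smul_zero, add_zero] at ht
      simp only [pow_succ', mul_smul, ← Finset.smul_sum] at ht
      rw [norm_smul, Real.norm_of_nonneg ht0'.le] at ht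
      obtain ⟨s, rfl⟩ : ∃ s, q = s + 2 := ⟨q - 2, by omega⟩
      rw [Nat.add_sub_cancel, norm_pow]
      rw [norm_pow, pow_add, Real.norm_of_nonneg (Real.sqrt_nonneg t), Real.sq_sqrt ht0'.le] at ht
      rw [Real.norm_of_nonneg (Real.sqrt_nonneg t)]
      refine le_of_mul_le_mul_left (ht.trans_eq ?_) ht0'
      ring

theorem exists_norm_diracOp_le_sqrt_pow {u : EuclideanSpace ℝ (Fin n) → F}
    (hu : ContDiff ℝ 1 u) (hs : HasCompactSupport u) {K r : ℝ} (hr : 0 < r)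
    (hD : ∀ h, ‖h‖ < r → ‖diracOp c u h‖ ≤ K * ‖u h‖) {p : ℕ}
    (hp : u =O[𝓝 0] fun h => √‖h‖ ^ p) :
    ∃ A, ∀ y, ‖diracOp c u y‖ ≤ A * √‖y‖ ^ p := by
  have hDs : HasCompactSupport (diracOp c u) := by
    refine (hs.fderiv ℝ).mono fun x hx h => hx ?_
    simp [diracOp, h]
  obtain ⟨M, hM⟩ := hDs.exists_bound_of_continuous (continuous_diracOp (c := c) hu)
  obtain ⟨C, hC⟩ := hp.bound
  obtain ⟨δ, hδ, hδC⟩ := Metric.eventually_nhds_iff_ball.1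
    (hC.and (ball_mem_nhds (0 : EuclideanSpace ℝ (Fin n)) hr))
  refine ⟨|K| * |C| + |M| / √δ ^ p, fun y => ?_⟩
  have hsδ := Real.sqrt_pos.2 hδ
  rw [add_mul]
  by_cases hy : y ∈ ball 0 δ
  · obtain ⟨h1, h2⟩ := hδC y hy
    rw [norm_pow, Real.norm_of_nonneg (Real.sqrt_nonneg _)] at h1
    refine le_add_of_le_of_nonneg ?_ (by positivity)
    calc _ ≤ K * ‖u y‖ := hD y (mem_ball_zero_iff.1 h2)
      _ ≤ |K| * (|C| * √‖y‖ ^ p) := by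
          gcongr
          · exact le_abs_self K
          · exact h1.trans (by gcongr; exact le_abs_self C)
      _ = _ := by ring
  · rw [mem_ball_zero_iff, not_lt] at hy
    refine le_add_of_nonneg_of_le (by positivity) ?_
    calc _ ≤ |M| := (hM y).trans (le_abs_self M)
      _ = |M| / √δ ^ p * √δ ^ p := by field_simp
      _ ≤ _ := by gcongr

theorem exists_leading_term [CompleteSpace F] (hn : 1 ≤ n) (hc : IsCliffordMul c)
    {u : EuclideanSpace ℝ (Fin n) → F} (hu : ContDiff ℝ 1 u) (hs : HasCompactSupport u)
    {K r : ℝ} (hr : 0 < r) (hD : ∀ h, ‖h‖ < r → ‖diracOp c u h‖ ≤ K * ‖u h‖) (hu0 : u 0 = 0)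
    (hfin : ¬∀ m : ℕ, u =O[𝓝 0] fun h => ‖h‖ ^ m) :
    ∃ (k : ℕ) (P : ContinuousMultilinearMap ℝ (fun _ : Fin k => EuclideanSpace ℝ (Fin n)) F),
      1 ≤ k ∧ (∃ h, P (fun _ => h) ≠ 0) ∧
      (fun h => u h - P fun _ => h) =O[𝓝 0] fun h => √‖h‖ ^ (2 * k + 1) := by
  have hex : ∃ p : ℕ, ¬u =O[𝓝 0] fun h => √‖h‖ ^ p := by
    by_contra! H
    refine hfin fun m => (H (2 * m)).congr_right fun h => ?_
    rw [pow_mul, Real.sq_sqrt (norm_nonneg h)]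
  obtain ⟨p, hp, hp1⟩ : ∃ p : ℕ, (u =O[𝓝 0] fun h => √‖h‖ ^ p) ∧
      ¬u =O[𝓝 0] fun h => √‖h‖ ^ (p + 1) := by
    classical
    have hpos : Nat.find hex ≠ 0 := by
      intro h
      refine Nat.find_spec hex ?_
      rw [h]
      simpa using hu.continuous.continuousAt.isBigO_one ℝ
    obtain ⟨p, hp⟩ := Nat.exists_eq_succ_of_ne_zero hpos
    have hp' := Nat.find_spec hex
    rw [hp] at hp'
    exact ⟨p, not_not.1 (Nat.find_min hex (by omega)), hp'⟩
  obtain ⟨A, hA⟩ := exists_norm_diracOp_le_sqrt_pow hu hs hr hD hp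
  have hDs : HasCompactSupport (diracOp c u) := by
    refine (hs.fderiv ℝ).mono fun x hx h => hx ?_
    simp [diracOp, h]
  set k := p / 2 with hkdef
  obtain ⟨M, C, hMC⟩ := exists_integral_diracKernel_expansion hn hc (continuous_diracOp (c := c) hu)
    hDs (k := k) (by omega) (by omega) hA
  have hκ := pompeiuConst_pos hn
  set κ := pompeiuConst n
  obtain ⟨N, hO⟩ : ∃ N : (j : ℕ) →
      ContinuousMultilinearMap ℝ (fun _ : Fin j => EuclideanSpace ℝ (Fin n)) F,
      (fun h => u h - ∑ j ∈ Finset.range (k + 1), N j fun _ => h) =O[𝓝 0]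
      fun h => √‖h‖ ^ (p + 1) := by
    refine ⟨fun j => κ⁻¹ • M j, ?_⟩
    refine Asymptotics.IsBigO.of_bound (κ⁻¹ * C) ?_
    filter_upwards [closedBall_mem_nhds (0 : EuclideanSpace ℝ (Fin n)) one_pos] with x hx
    have h1 := hMC x (mem_closedBall_zero_iff.1 hx)
    rw [← pompeiuConst_smul_apply hn hc hu hs] at h1
    have h2 : u x - ∑ j ∈ Finset.range (k + 1), (κ⁻¹ • M j) (fun _ => x) =
        κ⁻¹ • (κ • u x - ∑ j ∈ Finset.range (k + 1), M j fun _ => x) := by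
      simp [smul_sub, Finset.smul_sum, inv_smul_smul₀ hκ.ne']
    rw [h2, norm_smul, norm_pow, Real.norm_of_nonneg (Real.sqrt_nonneg _),
      Real.norm_of_nonneg (inv_nonneg.2 hκ.le), mul_assoc]
    gcongr
  have hle : (fun h : EuclideanSpace ℝ (Fin n) => √‖h‖ ^ (p + 1)) =O[𝓝 0] fun h => √‖h‖ ^ p := by
    refine Asymptotics.IsBigO.of_bound 1 ?_
    filter_upwards [closedBall_mem_nhds (0 : EuclideanSpace ℝ (Fin n)) one_pos] with x hx
    rw [norm_pow, norm_pow, Real.norm_of_nonneg (Real.sqrt_nonneg _), one_mul]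
    exact pow_le_pow_of_le_one (Real.sqrt_nonneg _)
      (Real.sqrt_le_one.2 (mem_closedBall_zero_iff.1 hx)) (Nat.le_succ p)
  have hray (h : EuclideanSpace ℝ (Fin n)) :
      (fun t : ℝ => ∑ j ∈ Finset.range (k + 1), t ^ j • N j fun _ => h) =O[𝓝[>] 0]
        fun t => √t ^ p := by
    have h1 := hp.sub (hO.trans hle)
    simp only [sub_sub_cancel] at h1
    have h2 : Tendsto (fun t : ℝ => t • h) (𝓝[>] 0) (𝓝 0) := by
      have : Continuous fun t : ℝ => t • h := by fun_prop
      simpa using (this.tendsto 0).mono_left (nhdsWithin_le_nhds (s := Ioi 0))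
    have h3 := h1.comp_tendsto h2
    refine (h3.congr_left fun t => ?_).trans (Asymptotics.IsBigO.of_bound (√‖h‖ ^ p) ?_)
    · refine Finset.sum_congr rfl fun j _ => ?_
      have := (N j).map_smul_univ (fun _ => t) fun _ => h
      simpa using this
    · filter_upwards [self_mem_nhdsWithin] with t ht
      have ht' : (0 : ℝ) ≤ t := le_of_lt ht
      rw [Function.comp_apply, norm_smul, Real.norm_of_nonneg ht', Real.sqrt_mul ht', mul_pow,
        norm_mul, mul_comm, Real.norm_of_nonneg (pow_nonneg (Real.sqrt_nonneg ‖h‖) p)]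
  have hodd : p ≠ 2 * k + 1 := by
    intro hpk
    refine hp1 (hO.congr_left fun h => ?_)
    rw [Finset.sum_eq_zero fun j hj => ?_, sub_zero]
    exact eq_zero_of_sum_pow_smul_isBigO (k + 1) (fun j => N j fun _ => h) p (by omega) (hray h) j
      (Finset.mem_range.1 hj)
  have hpk : p = 2 * k := by omega
  have hlow (h : EuclideanSpace ℝ (Fin n)) (j : ℕ) (hj : j < k) : N j (fun _ => h) = 0 := by
    refine eq_zero_of_sum_pow_smul_isBigO k (fun j => N j fun _ => h) p (by omega) ?_ j hj
    have h1 : (fun t : ℝ => t ^ k • N k fun _ => h) =O[𝓝[>] 0] fun t => √t ^ p := by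
      refine Asymptotics.IsBigO.of_bound ‖N k fun _ => h‖ ?_
      filter_upwards [self_mem_nhdsWithin] with t ht
      have ht' : (0 : ℝ) ≤ t := le_of_lt ht
      rw [hpk, pow_mul, Real.sq_sqrt ht', norm_smul, mul_comm]
    refine ((hray h).sub h1).congr_left fun t => ?_
    rw [Finset.sum_range_succ, add_sub_cancel_right]
  have hO' : (fun h => u h - N k fun _ => h) =O[𝓝 0] fun h => √‖h‖ ^ (2 * k + 1) := by
    rw [← hpk]
    refine hO.congr_left fun h => ?_
    rw [Finset.sum_range_succ, Finset.sum_eq_zero fun j hj => hlow h j (Finset.mem_range.1 hj),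
      zero_add]
  have hNk : ∃ h, N k (fun _ => h) ≠ 0 := by
    by_contra! H
    refine hp1 ?_
    rw [hpk]
    simpa [H] using hO'
  refine ⟨k, N k, ?_, hNk, hO'⟩
  by_contra hk
  have hk0 : k = 0 := by omega
  obtain ⟨h, hh⟩ := hNk
  obtain ⟨C', hC'⟩ := hO'.bound
  have h1 := hC'.self_of_nhds
  simp only [hu0, zero_sub, norm_neg, norm_zero, Real.sqrt_zero, zero_pow (Nat.succ_ne_zero _),
    mul_zero] at h1
  apply hh
  have : IsEmpty (Fin k) := by rw [hk0]; infer_instance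
  rw [Subsingleton.elim (fun _ : Fin k => h) fun _ => 0]
  exact norm_le_zero_iff.1 h1

end LeadingTerm

section BlowUp

open Set Filter Topology Metric
open scoped RealInnerProductSpace

variable {n : ℕ} {F : Type*} [NormedAddCommGroup F] [InnerProductSpace ℝ F]
  {c : EuclideanSpace ℝ (Fin n) →L[ℝ] F →L[ℝ] F}

theorem ContinuousMultilinearMap.contDiff_diagonal {k : ℕ} {E G : Type*} [NormedAddCommGroup E]
    [NormedSpace ℝ E] [NormedAddCommGroup G] [NormedSpace ℝ G] {m : WithTop ℕ∞}
    (P : ContinuousMultilinearMap ℝ (fun _ : Fin k => E) G) :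
    ContDiff ℝ m fun h => P fun _ => h :=
  P.contDiff.comp (contDiff_pi.2 fun _ => contDiff_id)

theorem ContinuousMultilinearMap.diagonal_smul {k : ℕ} {E G : Type*} [NormedAddCommGroup E]
    [NormedSpace ℝ E] [NormedAddCommGroup G] [NormedSpace ℝ G]
    (P : ContinuousMultilinearMap ℝ (fun _ : Fin k => E) G) (t : ℝ) (h : E) :
    (P fun _ => t • h) = t ^ k • P fun _ => h := by
  simpa using P.map_smul_univ (fun _ => t) fun _ => h

theorem isBigO_norm_pow_of_leading_term {u : EuclideanSpace ℝ (Fin n) → F} {k : ℕ}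
    {P : ContinuousMultilinearMap ℝ (fun _ : Fin k => EuclideanSpace ℝ (Fin n)) F}
    (hP : (fun h => u h - P fun _ => h) =O[𝓝 0] fun h => √‖h‖ ^ (2 * k + 1)) :
    u =O[𝓝 0] fun h => ‖h‖ ^ k := by
  have h1 : (fun h : EuclideanSpace ℝ (Fin n) => √‖h‖ ^ (2 * k + 1)) =O[𝓝 0] fun h => ‖h‖ ^ k := by
    refine Asymptotics.IsBigO.of_bound 1 ?_
    filter_upwards [closedBall_mem_nhds (0 : EuclideanSpace ℝ (Fin n)) one_pos] with x hx
    rw [norm_pow, norm_pow, Real.norm_of_nonneg (Real.sqrt_nonneg _), one_mul, norm_norm, pow_succ,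
      pow_mul, Real.sq_sqrt (norm_nonneg x)]
    exact mul_le_of_le_one_right (by positivity)
      (Real.sqrt_le_one.2 (mem_closedBall_zero_iff.1 hx))
  have h2 : (fun h => P fun _ => h) =O[𝓝 0] fun h => ‖h‖ ^ k := by
    refine Asymptotics.IsBigO.of_bound ‖P‖ (Eventually.of_forall fun h => ?_)
    simpa using P.le_opNorm fun _ => h
  simpa using (hP.trans h1).add h2

theorem integral_diracOp_eq_zero {v : EuclideanSpace ℝ (Fin n) → F}
    (hv : ContDiff ℝ 1 v) (hs : HasCompactSupport v) : ∫ x, diracOp c v x = 0 := by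
  unfold diracOp
  rw [integral_finsetSum]
  · refine Finset.sum_eq_zero fun j _ => ?_
    have := integral_fderiv_apply_eq_zero ((c (EuclideanSpace.single j 1)).contDiff.comp hv)
      (hs.comp_left (map_zero _)) (EuclideanSpace.single j 1)
    refine (integral_congr_ae (Eventually.of_forall fun x => ?_)).trans this
    have h : HasFDerivAt (c (EuclideanSpace.single j 1) ∘ v) _ x :=
      (c (EuclideanSpace.single j 1)).hasFDerivAt.comp x
        (hv.differentiable one_ne_zero x).hasFDerivAt
    simp [h.fderiv]
  · intro j _
    exact Continuous.integrable_of_hasCompactSupport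
      ((c _).continuous.comp ((hv.continuous_fderiv one_ne_zero).clm_apply continuous_const))
      ((hs.fderiv_apply ℝ _).comp_left (map_zero _))

theorem diracOp_comp_smul (u : EuclideanSpace ℝ (Fin n) → F) (hu : Differentiable ℝ u) (r : ℝ)
    (h : EuclideanSpace ℝ (Fin n)) :
    diracOp c (fun y => u (r • y)) h = r • diracOp c u (r • h) := by
  have h1 : HasFDerivAt (fun y => u (r • y)) _ h :=
    (hu (r • h)).hasFDerivAt.comp h ((hasFDerivAt_id h).const_smul r)
  simp [diracOp, h1.fderiv, Finset.smul_sum]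

theorem diracOp_leading_term_eq_zero [CompleteSpace F] (hc : IsCliffordMul c)
    {u : EuclideanSpace ℝ (Fin n) → F} (hu : ContDiff ℝ 1 u)
    {K r : ℝ} (hr : 0 < r) (hD : ∀ h, ‖h‖ < r → ‖diracOp c u h‖ ≤ K * ‖u h‖) {k : ℕ}
    {P : ContinuousMultilinearMap ℝ (fun _ : Fin k => EuclideanSpace ℝ (Fin n)) F}
    (hP : (fun h => u h - P fun _ => h) =O[𝓝 0] fun h => √‖h‖ ^ (2 * k + 1))
    (x : EuclideanSpace ℝ (Fin n)) : diracOp c (fun h => P fun _ => h) x = 0 := by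
  set p : EuclideanSpace ℝ (Fin n) → F := fun h => P fun _ => h with hp
  have hpd : ContDiff ℝ 1 p := P.contDiff_diagonal
  have hDp := continuous_diracOp (c := c) hpd
  suffices H : ∀ η : EuclideanSpace ℝ (Fin n) → ℝ, ContDiff ℝ 1 η → HasCompactSupport η →
      ∫ y, η y • diracOp c p y = 0 by
    have h1 := ae_eq_zero_of_integral_contDiff_smul_eq_zero (μ := volume)
      hDp.locallyIntegrable fun η hη hs => H η (hη.of_le (by simp)) hs
    have h2 : diracOp c p = fun _ => 0 := (hDp.ae_eq_iff_eq volume continuous_const).1 h1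
    exact congrFun h2 x
  intro η hη hs
  obtain ⟨R, hR0, hR⟩ := hs.isCompact.isBounded.subset_ball_lt 0 0
  obtain ⟨C₁, hC₁0, hC₁⟩ := (isBigO_norm_pow_of_leading_term hP).exists_nonneg
  obtain ⟨C₂, hC₂0, hC₂⟩ := hP.exists_nonneg
  obtain ⟨δ, hδ, hδC⟩ := Metric.eventually_nhds_iff_ball.1
    ((hC₁.bound.and hC₂.bound).and (ball_mem_nhds (0 : EuclideanSpace ℝ (Fin n)) hr))
  have hηf := hη.continuous_fderiv one_ne_zero
  have hηi : Integrable fun h => |η h| + ‖fderiv ℝ η h‖ :=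
    (hη.continuous.integrable_of_hasCompactSupport hs).abs.add
      (hηf.integrable_of_hasCompactSupport (hs.fderiv ℝ)).norm
  have hηz {h} (hh : h ∉ ball (0 : EuclideanSpace ℝ (Fin n)) R) : η h = 0 ∧ fderiv ℝ η h = 0 := by
    have : h ∉ tsupport η := fun h' => hh (hR h')
    exact ⟨image_eq_zero_of_notMem_tsupport this, fderiv_eq_zero_of_notMem_tsupport this⟩
  set B := (|K| * C₁ * R ^ k + C₂ * R ^ k * √R) * ∫ h, (|η h| + ‖fderiv ℝ η h‖)
  have key : ∀ᶠ s : ℝ in 𝓝[>] 0, ‖∫ y, η y • diracOp c p y‖ ≤ √s * B := by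
    filter_upwards [Ioo_mem_nhdsGT (lt_min one_pos (div_pos hδ hR0))] with s hs'
    have hs0 : 0 < s := hs'.1
    have hs1 : s ≤ 1 := (hs'.2.trans_le (min_le_left _ _)).le
    have hsR : s * R < δ := (lt_div_iff₀ hR0).1 (hs'.2.trans_le (min_le_right _ _))
    have hss : s ≤ √s := by
      rw [Real.le_sqrt' hs0]
      nlinarith
    set w : EuclideanSpace ℝ (Fin n) → F := fun h => u (s • h) - s ^ k • p h with hw
    have hus : ContDiff ℝ 1 fun h => u (s • h) := hu.comp (contDiff_const_smul s)
    have hwd : ContDiff ℝ 1 w := hus.sub (contDiff_const.smul hpd)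
    have hDw (h) : diracOp c w h = s • diracOp c u (s • h) - s ^ k • diracOp c p h := by
      rw [← diracOp_comp_smul u (hu.differentiable one_ne_zero)]
      have h1 : HasFDerivAt w _ h := (hus.differentiable one_ne_zero h).hasFDerivAt.sub
        ((hpd.differentiable one_ne_zero h).hasFDerivAt.const_smul (s ^ k))
      simp [diracOp, h1.fderiv, Finset.smul_sum]
    have h_int := integral_diracOp_eq_zero (c := c) (hη.smul hwd) hs.smul_right
    have hD1 (h) : diracOp c (fun y => η y • w y) h =
        (η h • s • diracOp c u (s • h) + c (gradient η h) (w h)) - s ^ k • η h • diracOp c p h := by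
      rw [diracOp_smul (hη.differentiable one_ne_zero h) (hwd.differentiable one_ne_zero h), hDw,
        smul_sub, smul_comm (η h) (s ^ k)]
      abel
    have hi2 : Integrable fun h => s ^ k • η h • diracOp c p h :=
      ((hη.continuous.smul hDp).integrable_of_hasCompactSupport hs.smul_right).smul _
    have hi1 : Integrable fun h => diracOp c (fun y => η y • w y) h := by
      refine (continuous_diracOp (hη.smul hwd)).integrable_of_hasCompactSupport ?_
      refine (HasCompactSupport.fderiv ℝ (hs.smul_right (f' := w))).mono fun x hx h => hx ?_
      simp [diracOp, h]
    have hi3 : Integrable fun h => η h • s • diracOp c u (s • h) + c (gradient η h) (w h) := by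
      refine (hi1.add hi2).congr (Eventually.of_forall fun h => ?_)
      simp only [Pi.add_apply, hD1]
      abel
    have h_int' : ∫ h, diracOp c (fun y => η y • w y) h = 0 := h_int
    simp only [hD1] at h_int'
    rw [integral_sub hi3 hi2, sub_eq_zero, integral_smul] at h_int'
    have hb : ‖∫ h, (η h • s • diracOp c u (s • h) + c (gradient η h) (w h))‖ ≤
        ∫ h, s ^ k * √s * (|K| * C₁ * R ^ k + C₂ * R ^ k * √R) * (|η h| + ‖fderiv ℝ η h‖) := by
      refine norm_integral_le_of_norm_le (hηi.const_mul _) (Eventually.of_forall fun h => ?_)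
      by_cases hh : h ∈ ball (0 : EuclideanSpace ℝ (Fin n)) R
      · have hhR := (mem_ball_zero_iff.1 hh).le
        have hsh : ‖s • h‖ ≤ s * R := by
          rw [norm_smul, Real.norm_of_nonneg hs0.le]
          gcongr
        obtain ⟨⟨h1, h2⟩, h3⟩ := hδC (s • h) (mem_ball_zero_iff.2 (hsh.trans_lt hsR))
        have h4 : ‖s • diracOp c u (s • h)‖ ≤ √s * (|K| * (C₁ * (s * R) ^ k)) := by
          rw [norm_smul, Real.norm_of_nonneg hs0.le]
          gcongr
          refine (hD _ (mem_ball_zero_iff.1 h3)).trans ?_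
          gcongr
          · exact le_abs_self K
          · refine h1.trans ?_
            rw [norm_pow, norm_norm]
            gcongr
        have h5 : ‖w h‖ ≤ C₂ * ((s * R) ^ k * (√s * √R)) := by
          rw [hw, ← Real.sqrt_mul hs0.le]
          simp only [hp, ← ContinuousMultilinearMap.diagonal_smul]
          refine h2.trans ?_
          rw [norm_pow, Real.norm_of_nonneg (Real.sqrt_nonneg _), pow_succ, pow_mul,
            Real.sq_sqrt (norm_nonneg _)]
          gcongr
        calc _ ≤ |η h| * ‖s • diracOp c u (s • h)‖ + ‖fderiv ℝ η h‖ * ‖w h‖ := by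
              refine (norm_add_le _ _).trans (add_le_add (norm_smul _ _).le ?_)
              rw [hc.norm_apply, norm_gradient]
          _ ≤ |η h| * (√s * (|K| * (C₁ * (s * R) ^ k))) +
              ‖fderiv ℝ η h‖ * (C₂ * ((s * R) ^ k * (√s * √R))) := by gcongr
          _ = s ^ k * √s * (|K| * C₁ * R ^ k) * |η h| +
              s ^ k * √s * (C₂ * R ^ k * √R) * ‖fderiv ℝ η h‖ := by ring
          _ ≤ s ^ k * √s * (|K| * C₁ * R ^ k + C₂ * R ^ k * √R) * |η h| +
              s ^ k * √s * (|K| * C₁ * R ^ k + C₂ * R ^ k * √R) * ‖fderiv ℝ η h‖ := by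
              gcongr
              · exact le_add_of_nonneg_right (by positivity)
              · exact le_add_of_nonneg_left (by positivity)
          _ = _ := by ring
      · obtain ⟨h1, h2⟩ := hηz hh
        have h3 : gradient η h = 0 := by simp [gradient, h2]
        simp [h1, h2, h3]
    rw [h_int', integral_const_mul, norm_smul, Real.norm_of_nonneg (by positivity), mul_assoc,
      mul_assoc] at hb
    exact le_of_mul_le_mul_left hb (pow_pos hs0 k)
  have hlim : Tendsto (fun s : ℝ => √s * B) (𝓝[>] 0) (𝓝 0) := by
    have : Continuous fun s : ℝ => √s * B := by fun_prop
    simpa using (this.tendsto 0).mono_left (nhdsWithin_le_nhds (s := Ioi 0))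
  exact norm_le_zero_iff.1 (ge_of_tendsto hlim key)

theorem fderiv_eq_zero_of_finrank_ge (hc : IsCliffordMul c) {p : EuclideanSpace ℝ (Fin n) → F}
    {x : EuclideanSpace ℝ (Fin n)} (hp : diracOp c p x = 0)
    {L : Submodule ℝ (EuclideanSpace ℝ (Fin n))} (hL : n ≤ Module.finrank ℝ L + 1)
    (hLp : ∀ v ∈ L, fderiv ℝ p x v = 0) : fderiv ℝ p x = 0 := by
  set T := fderiv ℝ p x
  have hfr : Module.finrank ℝ Lᗮ ≤ 1 := by
    have := L.finrank_add_finrank_orthogonal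
    rw [finrank_euclideanSpace, Fintype.card_fin] at this
    omega
  obtain ⟨e, he⟩ := finrank_le_one_iff.1 hfr
  have hdec (w : EuclideanSpace ℝ (Fin n)) :
      ∃ a : ℝ, T w = a • T e ∧ ⟪(e : EuclideanSpace ℝ (Fin n)), w⟫ = a * ‖e‖ ^ 2 := by
    obtain ⟨l, hl, m, hm, rfl⟩ := L.exists_add_mem_mem_orthogonal w
    obtain ⟨a, ha⟩ := he ⟨m, hm⟩
    have ha' : m = a • (e : EuclideanSpace ℝ (Fin n)) := (congrArg Subtype.val ha).symm
    refine ⟨a, ?_, ?_⟩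
    · rw [map_add, hLp l hl, zero_add, ha', map_smul]
    · rw [inner_add_right, real_inner_comm, e.2 l hl, ha', real_inner_smul_right,
        real_inner_self_eq_norm_sq]
      simp
  have hTe : T e = 0 := by
    have h1 : c e (T e) = ‖e‖ ^ 2 • diracOp c p x := by
      have h2 : c e = ∑ j, c ((e : EuclideanSpace ℝ (Fin n)) j • EuclideanSpace.single j 1) := by
        rw [← map_sum, sum_coord_smul_single]
      rw [h2, _root_.sum_apply, diracOp, Finset.smul_sum]
      refine Finset.sum_congr rfl fun j _ => ?_
      obtain ⟨a, ha, ha'⟩ := hdec (EuclideanSpace.single j 1)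
      rw [EuclideanSpace.inner_single_right] at ha'
      simp only [one_mul, conj_trivial] at ha'
      have ha : fderiv ℝ p x (EuclideanSpace.single j 1) = a • T e := ha
      rw [ha, ha', map_smul, _root_.smul_apply, map_smul, smul_smul, mul_comm]
    rw [hp, smul_zero, ← norm_eq_zero, hc.norm_apply, mul_eq_zero, norm_eq_zero, norm_eq_zero] at h1
    rcases h1 with h1 | h1
    · rw [h1, map_zero]
    · exact h1
  ext1 w
  obtain ⟨a, ha, -⟩ := hdec w
  rw [ha, hTe, smul_zero, _root_.zero_apply]

end BlowUp

section Translation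

open Set Filter Topology Metric
open scoped RealInnerProductSpace

variable {E G : Type*} [NormedAddCommGroup E] [NormedSpace ℝ E] [NormedAddCommGroup G]
  [NormedSpace ℝ G] {k : ℕ} (P : ContinuousMultilinearMap ℝ (fun _ : Fin k => E) G)

theorem ContinuousMultilinearMap.exists_expansion_diagonal (v h : E) :
    ∃ B : ℕ → G, B k = (P fun _ => h) ∧
      ∀ t : ℝ, (P fun _ => v + t • h) = ∑ j ∈ Finset.range (k + 1), t ^ j • B j := by
  refine ⟨fun j => ∑ s : Finset (Fin k) with s.card = j, P (s.piecewise (fun _ => h) fun _ => v),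
    ?_, fun t => ?_⟩
  · have : Finset.univ.filter (fun s : Finset (Fin k) => s.card = k) = {Finset.univ} := by
      ext s
      have := Finset.card_eq_iff_eq_univ s
      rw [Fintype.card_fin] at this
      simpa using this
    simp [this]
  · have h1 : (P fun _ => v + t • h) =
        P ((fun _ => t • h) + fun _ => v) := by
      congr 1
      ext i
      simp [add_comm]
    rw [h1, P.map_add_univ,
      ← Finset.sum_fiberwise_of_maps_to (s := Finset.univ) (t := Finset.range (k + 1))
        (g := Finset.card) fun s _ => Finset.mem_range.2 (by
          have := s.card_le_univ
          rw [Fintype.card_fin] at this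
          omega)]
    refine Finset.sum_congr rfl fun j _ => ?_
    rw [Finset.smul_sum]
    refine Finset.sum_congr rfl fun s hs => ?_
    rw [← (Finset.mem_filter.1 hs).2]
    have := P.toMultilinearMap.map_piecewise_smul (fun _ => t)
      (s.piecewise (fun _ => h) fun _ => v) s
    simp only [Finset.prod_const, ContinuousMultilinearMap.coe_coe] at this
    rw [← this]
    congr 1
    ext i
    by_cases hi : i ∈ s <;> simp [hi]

theorem ContinuousMultilinearMap.diagonal_add_eq_of_norm_le {v : E} {m : ℝ}
    (hv : ∀ h, ‖P fun _ => v + h‖ ≤ m * ‖h‖ ^ k) {t : ℝ} (h : E) :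
    (P fun _ => v + t • h) = t ^ k • P fun _ => h := by
  obtain ⟨B, hBk, hB⟩ := P.exists_expansion_diagonal v h
  have h0 : ∀ j < k, B j = 0 := by
    refine eq_zero_of_sum_pow_smul_isBigO k B (2 * k) (by omega) ?_
    refine Asymptotics.IsBigO.of_bound (m * ‖h‖ ^ k + ‖B k‖) ?_
    filter_upwards [self_mem_nhdsWithin] with t ht
    have ht' : (0 : ℝ) ≤ t := le_of_lt ht
    have h1 : ∑ j ∈ Finset.range k, t ^ j • B j = (P fun _ => v + t • h) - t ^ k • B k := by
      rw [hB t, Finset.sum_range_succ, add_sub_cancel_right]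
    rw [h1, pow_mul, Real.sq_sqrt ht', Real.norm_of_nonneg (pow_nonneg ht' k), add_mul]
    refine (norm_sub_le _ _).trans (add_le_add ((hv _).trans_eq ?_) ?_)
    · rw [norm_smul, Real.norm_of_nonneg ht']
      ring
    · rw [norm_smul, Real.norm_of_nonneg (pow_nonneg ht' k), mul_comm]
  rw [hB, Finset.sum_range_succ, Finset.sum_eq_zero fun j hj => by
    rw [h0 j (Finset.mem_range.1 hj), smul_zero], zero_add, hBk]

theorem ContinuousMultilinearMap.fderiv_diagonal_eq_zero_of_norm_le {v : E} {m : ℝ}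
    (hv : ∀ h, ‖P fun _ => v + h‖ ≤ m * ‖h‖ ^ k) (h : E) :
    fderiv ℝ (fun h => P fun _ => h) h v = 0 := by
  have hs (s : ℝ) (hs : 0 < s) : (P fun _ => h + s • v) = P fun _ => h := by
    have h1 := P.diagonal_add_eq_of_norm_le hv (t := s⁻¹) h
    have h2 := P.diagonal_smul s (v + s⁻¹ • h)
    rw [smul_add, smul_inv_smul₀ hs.ne', h1, smul_smul, ← mul_pow, mul_inv_cancel₀ hs.ne', one_pow,
      one_smul, add_comm] at h2
    exact h2
  have hl : HasDerivAt (fun s : ℝ => h + s • v) v 0 := by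
    simpa using ((hasDerivAt_id (0 : ℝ)).smul_const v).const_add h
  have hd : HasFDerivAt (fun h => P fun _ => h) (fderiv ℝ (fun h => P fun _ => h) h)
      (h + (0 : ℝ) • v) := by
    simpa using ((P.contDiff_diagonal (m := 1)).differentiable one_ne_zero h).hasFDerivAt
  have h1 : HasDerivAt (fun s : ℝ => P fun _ => h + s • v)
      (fderiv ℝ (fun h => P fun _ => h) h v) 0 :=
    HasFDerivAt.comp_hasDerivAt (l := fun h => P fun _ => h) (f := fun s : ℝ => h + s • v)
      (0 : ℝ) hd hl
  have h2 : HasDerivWithinAt (fun s : ℝ => P fun _ => h + s • v) 0 (Ioi 0) 0 :=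
    (hasDerivWithinAt_const (0 : ℝ) (Ioi 0) (P fun _ => h)).congr (fun s h' => hs s h') (by simp)
  have h3 := (uniqueDiffWithinAt_Ioi (0 : ℝ)).eq_deriv _ h1.hasDerivWithinAt h2
  exact h3

end Translation

section TangentDimension

open Set Filter Topology Metric
open scoped RealInnerProductSpace

variable {E : Type*} [NormedAddCommGroup E] [InnerProductSpace ℝ E] [FiniteDimensional ℝ E]

open Module

theorem exists_continuousLinearMap_injOn {d : ℕ} (L : Submodule ℝ E) (hL : finrank ℝ L ≤ d) :
    ∃ A : E →L[ℝ] EuclideanSpace ℝ (Fin d), ∀ v ∈ L, A v = 0 → v = 0 := by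
  obtain ⟨f, hf⟩ : ∃ f : L →ₗ[ℝ] EuclideanSpace ℝ (Fin d), Function.Injective f := by
    rw [← finrank_le_iff_exists_linearMap]
    simpa using hL
  refine ⟨(LinearMap.toContinuousLinearMap f).comp L.orthogonalProjectionOnto, fun v hv h => ?_⟩
  have h1 : f ⟨v, hv⟩ = 0 := by
    simpa [L.orthogonalProjectionOnto_mem_subspace_eq_self ⟨v, hv⟩] using h
  exact congrArg Subtype.val (hf (h1.trans (map_zero f).symm))

theorem exists_norm_le_of_tangent {Z : Set E} {x : E} {L : Submodule ℝ E} {d : ℕ}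
    (hL : ∀ (y : ℕ → E) v, (∀ i, y i ∈ Z ∧ y i ≠ x) → Tendsto y atTop (𝓝 x) →
      Tendsto (fun i => ‖y i - x‖⁻¹ • (y i - x)) atTop (𝓝 v) → v ∈ L)
    {A : E →L[ℝ] EuclideanSpace ℝ (Fin d)} (hA : ∀ v ∈ L, A v = 0 → v = 0) :
    ∃ j : ℕ, ∀ y ∈ Z, ‖y - x‖ < 1 / (j + 1) → ‖y - x‖ ≤ (j + 1) * ‖A (y - x)‖ := by
  by_contra! H
  choose y hyZ hyx hy using H
  have hne (i) : y i ≠ x := fun h => by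
    have := hy i
    simp [h] at this
  have hpos (i) : 0 < ‖y i - x‖ := norm_pos_iff.2 (sub_ne_zero.2 (hne i))
  have hlim : Tendsto y atTop (𝓝 x) := by
    rw [tendsto_iff_norm_sub_tendsto_zero]
    exact squeeze_zero (fun _ => norm_nonneg _) (fun i => (hyx i).le)
      tendsto_one_div_add_atTop_nhds_zero_nat
  have hs (i) : ‖y i - x‖⁻¹ • (y i - x) ∈ sphere (0 : E) 1 := by
    rw [mem_sphere_zero_iff_norm, norm_smul, norm_inv, norm_norm, inv_mul_cancel₀ (hpos i).ne']
  obtain ⟨v, hv, ψ, hψ, hlimψ⟩ := (isCompact_sphere (0 : E) 1).tendsto_subseq hs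
  have hvL : v ∈ L := hL (y ∘ ψ) v (fun i => ⟨hyZ _, hne _⟩) (hlim.comp hψ.tendsto_atTop) hlimψ
  have hAv : A v = 0 := by
    have h1 : Tendsto (fun i => ‖A (‖y (ψ i) - x‖⁻¹ • (y (ψ i) - x))‖) atTop (𝓝 ‖A v‖) :=
      ((A.continuous.tendsto v).comp hlimψ).norm
    have h2 : Tendsto (fun i => ‖A (‖y (ψ i) - x‖⁻¹ • (y (ψ i) - x))‖) atTop (𝓝 0) := by
      refine squeeze_zero (fun _ => norm_nonneg _) (fun i => ?_)
        ((tendsto_one_div_add_atTop_nhds_zero_nat (𝕜 := ℝ)).comp hψ.tendsto_atTop)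
      rw [map_smul, norm_smul, norm_inv, norm_norm, inv_mul_le_iff₀ (hpos _), Function.comp_apply,
        mul_one_div, le_div_iff₀ (by positivity), mul_comm]
      exact (hy _).le
    exact norm_eq_zero.1 (tendsto_nhds_unique h1 h2)
  rw [hA v hvL hAv] at hv
  simp at hv

omit [FiniteDimensional ℝ E] in
theorem dimH_le_of_norm_le {T : Set E} {d : ℕ} {C : ℝ} (A : E →L[ℝ] EuclideanSpace ℝ (Fin d))
    (hT : ∀ x ∈ T, ∀ y ∈ T, ‖y - x‖ ≤ C * ‖A (y - x)‖) : dimH T ≤ d := by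
  have h1 : AntilipschitzWith C.toNNReal (fun x : T => A x) := by
    refine AntilipschitzWith.of_le_mul_dist fun x y => ?_
    rw [Subtype.dist_eq, dist_eq_norm, dist_eq_norm, ← map_sub]
    exact (hT y y.2 x x.2).trans
      (mul_le_mul_of_nonneg_right (Real.le_coe_toNNReal C) (norm_nonneg _))
  calc dimH T = dimH (univ : Set T) := by
        have h2 : Isometry (Subtype.val : T → E) := fun _ _ => rfl
        rw [← h2.dimH_image, image_univ, Subtype.range_coe]
    _ ≤ dimH ((fun x : T => A x) '' univ) := h1.le_dimH_image univ
    _ ≤ dimH (univ : Set (EuclideanSpace ℝ (Fin d))) := dimH_mono (subset_univ _)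
    _ = d := by rw [Real.dimH_univ_eq_finrank, finrank_euclideanSpace_fin]

/-- A set whose tangent directions at each point lie in a subspace of dimension at most `d` has
Hausdorff dimension at most `d`. -/
theorem dimH_le_of_tangent {Z : Set E} {d : ℕ}
    (H : ∀ x ∈ Z, ∃ L : Submodule ℝ E, finrank ℝ L ≤ d ∧
      ∀ (y : ℕ → E) v, (∀ i, y i ∈ Z ∧ y i ≠ x) → Tendsto y atTop (𝓝 x) →
        Tendsto (fun i => ‖y i - x‖⁻¹ • (y i - x)) atTop (𝓝 v) → v ∈ L) : dimH Z ≤ d := by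
  let D : ℕ → E →L[ℝ] EuclideanSpace ℝ (Fin d) :=
    TopologicalSpace.denseSeq (E →L[ℝ] EuclideanSpace ℝ (Fin d))
  let p : ℕ → E := TopologicalSpace.denseSeq E
  let S (i j l : ℕ) : Set E :=
    {x | x ∈ Z ∧ (∀ y ∈ Z, ‖y - x‖ < 1 / (j + 1) → ‖y - x‖ ≤ (j + 1) * ‖D i (y - x)‖) ∧
      dist x (p l) < 1 / (j + 1) / 2}
  have hsub : Z ⊆ ⋃ (i : ℕ) (j : ℕ) (l : ℕ), S i j l := by
    intro x hx
    obtain ⟨L, hLd, hL⟩ := H x hx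
    obtain ⟨A, hA⟩ := exists_continuousLinearMap_injOn L hLd
    obtain ⟨j, hj⟩ := exists_norm_le_of_tangent hL hA
    have hj1 : (0 : ℝ) < 1 / (2 * (j + 1)) := by positivity
    obtain ⟨i, hi⟩ := (TopologicalSpace.denseRange_denseSeq
      (E →L[ℝ] EuclideanSpace ℝ (Fin d))).exists_dist_lt A hj1
    have hj2 : (0 : ℝ) < 1 / ((2 * j + 1 : ℕ) + 1) / 2 := by positivity
    obtain ⟨l, hl⟩ := (TopologicalSpace.denseRange_denseSeq E).exists_dist_lt x hj2
    refine mem_iUnion.2 ⟨i, mem_iUnion.2 ⟨2 * j + 1, mem_iUnion.2 ⟨l, hx, fun y hy hyx => ?_, hl⟩⟩⟩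
    have h1 : ‖y - x‖ < 1 / (j + 1) := hyx.trans_le (by
      apply one_div_le_one_div_of_le (by positivity)
      push_cast
      linarith [(Nat.cast_nonneg j : (0 : ℝ) ≤ j)])
    have h2 := hj y hy h1
    have h3 : ‖A (y - x)‖ ≤ ‖D i (y - x)‖ + 1 / (2 * (j + 1)) * ‖y - x‖ := by
      calc ‖A (y - x)‖ = ‖D i (y - x) + (A - D i) (y - x)‖ := by simp
        _ ≤ ‖D i (y - x)‖ + ‖A - D i‖ * ‖y - x‖ :=
          (norm_add_le _ _).trans (add_le_add le_rfl ((A - D i).le_opNorm _))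
        _ ≤ _ := by
          rw [dist_eq_norm] at hi
          gcongr
    have h4 : ((j : ℝ) + 1) * (1 / (2 * (j + 1)) * ‖y - x‖) = ‖y - x‖ / 2 := by
      field_simp
    have h5 := h2.trans (mul_le_mul_of_nonneg_left h3 (by positivity))
    rw [mul_add, h4] at h5
    push_cast
    linarith
  refine (dimH_mono hsub).trans ?_
  simp only [dimH_iUnion, iSup_le_iff]
  intro i j l
  refine dimH_le_of_norm_le (C := j + 1) (D i) fun x hx y hy => ?_
  refine hx.2.1 y hy.1 ?_
  rw [← dist_eq_norm]
  linarith [dist_triangle_right y x (p l), hx.2.2, hy.2.2]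

end TangentDimension

section NodalSet

open Set Filter Topology Metric
open scoped RealInnerProductSpace

variable {n : ℕ} {F : Type*} [NormedAddCommGroup F] [InnerProductSpace ℝ F]
  {c : EuclideanSpace ℝ (Fin n) →L[ℝ] F →L[ℝ] F}

/-- Near `x`, the map `φ` agrees to leading order with a nonzero homogeneous polynomial of degree
`k` in the kernel of the Dirac operator, with a quantitative bound governed by `m`. -/
def HasLeadingTerm (c : EuclideanSpace ℝ (Fin n) →L[ℝ] F →L[ℝ] F)
    (φ : EuclideanSpace ℝ (Fin n) → F) (k m : ℕ) (x : EuclideanSpace ℝ (Fin n)) : Prop :=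
  ∃ P : ContinuousMultilinearMap ℝ (fun _ : Fin k => EuclideanSpace ℝ (Fin n)) F,
    (∃ h, P (fun _ => h) ≠ 0) ∧ (∀ y, diracOp c (fun h => P fun _ => h) y = 0) ∧
    (fun h => φ (x + h) - P fun _ => h) =O[𝓝 0] (fun h => √‖h‖ ^ (2 * k + 1)) ∧
    ∀ h, ‖h‖ < 1 / (m + 1) → ‖φ (x + h)‖ ≤ (m + 1) * ‖h‖ ^ k

theorem exists_hasLeadingTerm [CompleteSpace F] (hn : 1 ≤ n) (hc : IsCliffordMul c)
    {Ω : Set (EuclideanSpace ℝ (Fin n))} (hΩ : IsOpen Ω) (hΩc : IsPreconnected Ω)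
    {φ : EuclideanSpace ℝ (Fin n) → F} (hφ : ContDiffOn ℝ 1 φ Ω)
    (hD : ∀ x ∈ Ω, ∃ K : ℝ, ∀ᶠ y in 𝓝 x, ‖diracOp c φ y‖ ≤ K * ‖φ y‖)
    (hne : ∃ x ∈ Ω, φ x ≠ 0) {x : EuclideanSpace ℝ (Fin n)} (hx : x ∈ Ω) (h0 : φ x = 0) :
    ∃ k m, 1 ≤ k ∧ HasLeadingTerm c φ k m x := by
  obtain ⟨ρ, hρ, hρΩ⟩ := Metric.isOpen_iff.1 hΩ x hx
  obtain ⟨K, hK⟩ := hD x hx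
  obtain ⟨ρ', hρ', hK⟩ := Metric.eventually_nhds_iff_ball.1 hK
  have hr : 0 < min (ρ / 2) ρ' := lt_min (by linarith) hρ'
  set r := min (ρ / 2) ρ'
  obtain ⟨u, hu, hs, huφ, hDu⟩ := exists_localization (c := c) hr (hφ.mono
    ((ball_subset_ball (by linarith [min_le_left (ρ / 2) ρ'])).trans hρΩ))
  have hev : ∀ᶠ h in 𝓝 (0 : EuclideanSpace ℝ (Fin n)), u h = φ (x + h) := by
    filter_upwards [ball_mem_nhds 0 hr] with h hh using huφ h (mem_ball_zero_iff.1 hh)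
  have hDr (h) (hh : ‖h‖ < r) : ‖diracOp c u h‖ ≤ K * ‖u h‖ := by
    rw [huφ h hh, hDu h hh]
    refine hK _ ?_
    rw [mem_ball, dist_eq_norm, add_sub_cancel_left]
    exact hh.trans_le (min_le_right _ _)
  have hu0 : u 0 = 0 := by rw [huφ 0 (by simpa using hr), add_zero, h0]
  have hfin : ¬∀ m : ℕ, u =O[𝓝 0] fun h => ‖h‖ ^ m := by
    intro H
    obtain ⟨y, hy, hy0⟩ := hne
    exact hy0 (eqOn_zero_of_exists_infinite_order hc hΩ hΩc hφ hD hx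
      (fun m => (H m).congr' hev EventuallyEq.rfl) y hy)
  obtain ⟨k, P, hk, hPne, hP⟩ := exists_leading_term hn hc hu hs hr hDr hu0 hfin
  obtain ⟨C, hC⟩ := (isBigO_norm_pow_of_leading_term hP).bound
  obtain ⟨δ, hδ, hC⟩ := Metric.eventually_nhds_iff_ball.1 (hC.and hev)
  obtain ⟨m₁, hm₁⟩ := exists_nat_one_div_lt hδ
  obtain ⟨m₂, hm₂⟩ := exists_nat_ge C
  refine ⟨k, max m₁ m₂, hk, P, hPne, diracOp_leading_term_eq_zero hc hu hr hDr hP,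
    hP.congr' (by filter_upwards [hev] with h hh using by rw [hh]) EventuallyEq.rfl,
    fun h hh => ?_⟩
  have h1 : ‖h‖ < δ := by
    refine (hh.trans_le ?_).trans hm₁
    gcongr
    exact le_max_left _ _
  obtain ⟨h2, h3⟩ := hC h (mem_ball_zero_iff.2 h1)
  rw [← h3]
  refine h2.trans ?_
  rw [Real.norm_of_nonneg (by positivity)]
  gcongr
  have : (m₂ : ℝ) ≤ (max m₁ m₂ : ℕ) := by exact_mod_cast le_max_right _ _
  linarith

theorem norm_leading_term_le_of_tendsto {φ : EuclideanSpace ℝ (Fin n) → F} {k m : ℕ}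
    {x v : EuclideanSpace ℝ (Fin n)}
    {P : ContinuousMultilinearMap ℝ (fun _ : Fin k => EuclideanSpace ℝ (Fin n)) F}
    (hP : (fun h => φ (x + h) - P fun _ => h) =O[𝓝 0] fun h => √‖h‖ ^ (2 * k + 1))
    {y : ℕ → EuclideanSpace ℝ (Fin n)}
    (hy : ∀ i h, ‖h‖ < 1 / ((m : ℝ) + 1) → ‖φ (y i + h)‖ ≤ (m + 1) * ‖h‖ ^ k)
    (hyx : ∀ i, y i ≠ x) (hlim : Tendsto y atTop (𝓝 x))
    (hv : Tendsto (fun i => ‖y i - x‖⁻¹ • (y i - x)) atTop (𝓝 v))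
    (h : EuclideanSpace ℝ (Fin n)) : ‖P fun _ => v + h‖ ≤ (m + 1) * ‖h‖ ^ k := by
  obtain ⟨C, hC⟩ := hP.bound
  set t : ℕ → ℝ := fun i => ‖y i - x‖
  set θ : ℕ → EuclideanSpace ℝ (Fin n) := fun i => ‖y i - x‖⁻¹ • (y i - x)
  have htpos (i) : 0 < t i := norm_pos_iff.2 (sub_ne_zero.2 (hyx i))
  have ht : Tendsto t atTop (𝓝 0) := tendsto_iff_norm_sub_tendsto_zero.1 hlim
  have hθ : Tendsto (fun i => θ i + h) atTop (𝓝 (v + h)) := hv.add_const h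
  have hw : Tendsto (fun i => t i • (θ i + h)) atTop (𝓝 0) := by
    simpa using ht.smul hθ
  have hth : Tendsto (fun i => ‖t i • h‖) atTop (𝓝 0) := by
    simpa using (ht.smul_const h).norm
  have hyi (i) : x + t i • (θ i + h) = y i + t i • h := by
    rw [smul_add, smul_inv_smul₀ (htpos i).ne', ← add_assoc, add_sub_cancel]
  have hbound : ∀ᶠ i in atTop, ‖P fun _ => θ i + h‖ ≤
      (m + 1) * ‖h‖ ^ k + C * (‖θ i + h‖ ^ k * √‖t i • (θ i + h)‖) := by
    filter_upwards [hw.eventually hC,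
      hth.eventually_lt_const (show (0 : ℝ) < 1 / ((m : ℝ) + 1) by positivity)] with i h1 h2
    have h3 := hy i _ h2
    rw [hyi, P.diagonal_smul, Real.norm_of_nonneg (by positivity), pow_succ, pow_mul,
      Real.sq_sqrt (norm_nonneg _)] at h1
    have h4 : ‖t i ^ k • P fun _ => θ i + h‖ ≤
        ‖φ (y i + t i • h)‖ + ‖φ (y i + t i • h) - t i ^ k • P fun _ => θ i + h‖ := by
      have := norm_sub_le (φ (y i + t i • h)) (φ (y i + t i • h) - t i ^ k • P fun _ => θ i + h)
      rwa [sub_sub_cancel] at this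
    have htk : 0 < t i ^ k := pow_pos (htpos i) k
    refine le_of_mul_le_mul_left ?_ htk
    calc t i ^ k * ‖P fun _ => θ i + h‖ = ‖t i ^ k • P fun _ => θ i + h‖ := by
          rw [norm_smul, Real.norm_of_nonneg htk.le]
      _ ≤ (m + 1) * ‖t i • h‖ ^ k + C * (‖t i • (θ i + h)‖ ^ k * √‖t i • (θ i + h)‖) :=
          h4.trans (add_le_add h3 h1)
      _ = (m + 1) * (t i * ‖h‖) ^ k + C * ((t i * ‖θ i + h‖) ^ k * √‖t i • (θ i + h)‖) := by
          rw [norm_smul (t i) h, norm_smul (t i) (θ i + h), Real.norm_of_nonneg (htpos i).le,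
            ← Real.norm_of_nonneg (htpos i).le, ← norm_smul, Real.norm_of_nonneg (htpos i).le]
      _ = _ := by ring
  refine le_of_tendsto_of_tendsto ?_ ?_ hbound
  · exact ((P.contDiff_diagonal (m := 0)).continuous.tendsto (v + h)).comp hθ |>.norm
  · have h1 := (hθ.norm.pow k).mul ((Real.continuous_sqrt.tendsto _).comp hw.norm)
    simpa using (h1.const_mul C).const_add ((m + 1 : ℝ) * ‖h‖ ^ k)

theorem dimH_setOf_hasLeadingTerm_le (hn : 2 ≤ n) (hc : IsCliffordMul c)
    (φ : EuclideanSpace ℝ (Fin n) → F) {k : ℕ} (hk : 1 ≤ k) (m : ℕ) :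
    dimH {x | HasLeadingTerm c φ k m x} ≤ (n - 2 : ℕ) := by
  refine dimH_le_of_tangent fun x hx => ?_
  obtain ⟨P, ⟨h, hPh⟩, hPD, hP, -⟩ := hx
  let L : Submodule ℝ (EuclideanSpace ℝ (Fin n)) :=
    ⨅ h, LinearMap.ker (fderiv ℝ (fun h => P fun _ => h) h).toLinearMap
  have hL (v) : v ∈ L ↔ ∀ h, fderiv ℝ (fun h => P fun _ => h) h v = 0 := by simp [L]
  refine ⟨L, ?_, fun y v hy hlim hv => (hL v).2 fun h =>
    P.fderiv_diagonal_eq_zero_of_norm_le (norm_leading_term_le_of_tendsto hP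
      (fun i => (hy i).1.choose_spec.2.2.2) (fun i => (hy i).2) hlim hv) h⟩
  by_contra hlt
  have hd (y) : fderiv ℝ (fun h => P fun _ => h) y = 0 :=
    fderiv_eq_zero_of_finrank_ge hc (hPD y) (L := L) (by omega) fun v hv => (hL v).1 hv y
  have := is_const_of_fderiv_eq_zero ((P.contDiff_diagonal (m := 1)).differentiable one_ne_zero)
    hd h 0
  refine hPh (this.trans (P.map_coord_zero ⟨0, hk⟩ rfl))

/-- The nodal set of a nontrivial solution of a Dirac inequality has codimension at least two. -/
theorem dimH_zero_le [CompleteSpace F] (hn : 2 ≤ n) (hc : IsCliffordMul c)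
    {Ω : Set (EuclideanSpace ℝ (Fin n))} (hΩ : IsOpen Ω) (hΩc : IsPreconnected Ω)
    {φ : EuclideanSpace ℝ (Fin n) → F} (hφ : ContDiffOn ℝ 1 φ Ω)
    (hD : ∀ x ∈ Ω, ∃ K : ℝ, ∀ᶠ y in 𝓝 x, ‖diracOp c φ y‖ ≤ K * ‖φ y‖)
    (hne : ∃ x ∈ Ω, φ x ≠ 0) : dimH {x ∈ Ω | φ x = 0} ≤ (n - 2 : ℕ) := by
  have hsub : {x ∈ Ω | φ x = 0} ⊆
      ⋃ (k : ℕ) (m : ℕ), {x | HasLeadingTerm c φ (k + 1) m x} := by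
    rintro x ⟨hx, h0⟩
    obtain ⟨k, m, hk, h⟩ := exists_hasLeadingTerm (by omega) hc hΩ hΩc hφ hD hne hx h0
    refine mem_iUnion.2 ⟨k - 1, mem_iUnion.2 ⟨m, ?_⟩⟩
    rwa [mem_ofPred_eq, Nat.sub_add_cancel hk]
  refine (dimH_mono hsub).trans ?_
  simp only [dimH_iUnion, iSup_le_iff]
  exact fun k m => dimH_setOf_hasLeadingTerm_le hn hc φ (by omega) m

end NodalSet

section InvariantInnerProduct

open Set Filter Topology Metric
open scoped RealInnerProductSpace

variable {n : ℕ} {W : Type*} [NormedAddCommGroup W] [NormedSpace ℝ W] [FiniteDimensional ℝ W]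
  {g : Fin n → W →ₗ[ℝ] W}

theorem exists_norm_comp_eq
    (hg : ∀ i j w, g i (g j w) + g j (g i w) = if i = j then (-2 : ℝ) • w else 0)
    (s : Finset (Fin n)) :
    ∃ (F : Type) (_ : NormedAddCommGroup F) (_ : InnerProductSpace ℝ F) (B : W →ₗ[ℝ] F),
      Function.Injective B ∧ ∀ j ∈ s, ∀ w, ‖B (g j w)‖ = ‖B w‖ := by
  have hgg (i w) : g i (g i w) = -w := by
    have h := hg i i w
    rw [if_pos rfl, ← two_smul ℝ, neg_smul, ← smul_neg] at h
    exact smul_right_injective W (two_ne_zero (α := ℝ)) h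
  induction s using Finset.induction_on with
  | empty =>
    refine ⟨EuclideanSpace ℝ (Fin (Module.finrank ℝ W)), inferInstance, inferInstance,
      (LinearEquiv.ofFinrankEq W (EuclideanSpace ℝ (Fin (Module.finrank ℝ W)))
        (by simp)).toLinearMap, LinearEquiv.injective _, by simp⟩
  | insert i s his ih =>
    obtain ⟨F, _, _, B, hB, hs⟩ := ih
    let B' : W →ₗ[ℝ] WithLp 2 (F × F) :=
      (WithLp.linearEquiv 2 ℝ (F × F)).symm.toLinearMap ∘ₗ B.prod (B ∘ₗ g i)
    have hB' (w) : ‖B' w‖ ^ 2 = ‖B w‖ ^ 2 + ‖B (g i w)‖ ^ 2 := by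
      rw [WithLp.prod_norm_sq_eq_of_L2]
      rfl
    refine ⟨WithLp 2 (F × F), inferInstance, inferInstance, B', fun a b hab => hB ?_,
      fun j hj w => ?_⟩
    · have := congrArg (fun z => (WithLp.ofLp z).1) hab
      exact this
    · rw [← pow_left_inj₀ (norm_nonneg _) (norm_nonneg _) two_ne_zero, hB', hB']
      rcases Finset.mem_insert.1 hj with rfl | hj
      · rw [hgg, map_neg, norm_neg, add_comm]
      · have hij : i ≠ j := fun h => his (h ▸ hj)
        have h := hg i j w
        rw [if_neg hij] at h
        rw [hs j hj, eq_neg_of_add_eq_zero_left h, map_neg, norm_neg, hs j hj]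

/-- A finite dimensional Clifford module carries an inner product for which the Clifford
multiplication is skew-adjoint. -/
theorem exists_isCliffordMul
    (hg : ∀ i j w, g i (g j w) + g j (g i w) = if i = j then (-2 : ℝ) • w else 0) :
    ∃ (F : Type) (_ : NormedAddCommGroup F) (_ : InnerProductSpace ℝ F) (_ : CompleteSpace F)
      (e : W ≃L[ℝ] F) (c : EuclideanSpace ℝ (Fin n) →L[ℝ] F →L[ℝ] F), IsCliffordMul c ∧
      ∀ j w, c (EuclideanSpace.single j 1) (e w) = e (g j w) := by
  obtain ⟨F, _, _, B, hB, hs⟩ := exists_norm_comp_eq hg Finset.univ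
  let e' : W ≃ₗ[ℝ] LinearMap.range B := LinearEquiv.ofInjective B hB
  have : FiniteDimensional ℝ (LinearMap.range B) := inferInstance
  let e : W ≃L[ℝ] LinearMap.range B := e'.toContinuousLinearEquiv
  let G (j : Fin n) : LinearMap.range B →L[ℝ] LinearMap.range B :=
    e.toContinuousLinearMap ∘L (g j).toContinuousLinearMap ∘L e.symm.toContinuousLinearMap
  have hG (j a) : G j a = e (g j (e.symm a)) := rfl
  have hGnorm (j a) : ‖G j a‖ = ‖a‖ := by
    obtain ⟨w, rfl⟩ := e.surjective a
    rw [hG, e.symm_apply_apply]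
    exact hs j (Finset.mem_univ j) w
  have hGG (i j a) : G i (G j a) + G j (G i a) = if i = j then (-2 : ℝ) • a else 0 := by
    simp only [hG, e.symm_apply_apply, ← map_add, hg]
    split_ifs <;> simp
  have hGsq (i a) : G i (G i a) = -a := by
    have h := hGG i i a
    rw [if_pos rfl, ← two_smul ℝ, neg_smul, ← smul_neg] at h
    exact smul_right_injective _ (two_ne_zero (α := ℝ)) h
  have hGskew (j a b) : ⟪G j a, b⟫ = -⟪a, G j b⟫ := by
    have h := (LinearMap.norm_map_iff_inner_map_map (G j)).1 (hGnorm j) a (G j b)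
    rw [← h]
    change _ = -⟪G j a, G j (G j b)⟫
    rw [hGsq, inner_neg_right, neg_neg]
  let c : EuclideanSpace ℝ (Fin n) →L[ℝ] LinearMap.range B →L[ℝ] LinearMap.range B :=
    ∑ j, (EuclideanSpace.proj j : EuclideanSpace ℝ (Fin n) →L[ℝ] ℝ).smulRight (G j)
  have hc (v a) : c v a = ∑ j, v j • G j a := by
    simp [c, _root_.sum_apply]
  refine ⟨LinearMap.range B, inferInstance, inferInstance, FiniteDimensional.complete ℝ _, e, c,
    ⟨fun v a => ?_, fun v a b => ?_⟩, fun j w => ?_⟩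
  · have h1 : c v (c v a) = ∑ i, ∑ j, (v i * v j) • G i (G j a) := by
      simp only [hc, map_sum, map_smul, Finset.smul_sum, smul_smul]
    have h2 : c v (c v a) = ∑ i, ∑ j, (v i * v j) • G j (G i a) := by
      rw [h1, Finset.sum_comm]
      simp only [mul_comm]
    have h3 : (2 : ℝ) • c v (c v a) = (2 : ℝ) • -(‖v‖ ^ 2 • a) := by
      rw [two_smul]
      nth_rewrite 1 [h1]
      rw [h2, ← Finset.sum_add_distrib]
      simp only [← Finset.sum_add_distrib, ← smul_add, hGG]
      simp only [smul_ite, smul_zero, Finset.sum_ite_eq, Finset.mem_univ, if_true, smul_smul]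
      rw [← Finset.sum_smul, ← Finset.sum_mul, EuclideanSpace.norm_sq_eq, ← neg_smul, smul_smul]
      congr 1
      simp only [Real.norm_eq_abs, sq_abs, ← sq]
      ring
    exact smul_right_injective _ (two_ne_zero (α := ℝ)) h3
  · simp only [hc, sum_inner, inner_sum, inner_smul_left, inner_smul_right, hGskew]
    simp
  · rw [hc, Finset.sum_eq_single j]
    · simp [hG]
    · intro i _ hij
      simp [hij]
    · simp

end InvariantInnerProduct

section Reduction

open Set Filter Topology Metric

/-- The real linear endomorphism of `ℂ^N` given by a complex matrix. -/
noncomputable def realMulVec {N : ℕ} (A : Matrix (Fin N) (Fin N) ℂ) :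
    EuclideanSpace ℂ (Fin N) →ₗ[ℝ] EuclideanSpace ℂ (Fin N) where
  toFun w := WithLp.toLp 2 (A.mulVec (WithLp.ofLp w))
  map_add' v w := by rw [WithLp.ofLp_add, Matrix.mulVec_add, WithLp.toLp_add]
  map_smul' r w := by
    rw [WithLp.ofLp_smul, Matrix.mulVec_smul, WithLp.toLp_smul, RingHom.id_apply]

theorem realMulVec_clifford {n N : ℕ} {γ : Fin n → Matrix (Fin N) (Fin N) ℂ}
    (hγ : ∀ i j, γ i * γ j + γ j * γ i = if i = j then (-2 : ℂ) • 1 else 0) (i j : Fin n)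
    (w : EuclideanSpace ℂ (Fin N)) :
    realMulVec (γ i) (realMulVec (γ j) w) + realMulVec (γ j) (realMulVec (γ i) w) =
      if i = j then (-2 : ℝ) • w else 0 := by
  have h : realMulVec (γ i) (realMulVec (γ j) w) + realMulVec (γ j) (realMulVec (γ i) w) =
      WithLp.toLp 2 ((γ i * γ j + γ j * γ i).mulVec (WithLp.ofLp w)) := by
    rw [Matrix.add_mulVec, ← Matrix.mulVec_mulVec, ← Matrix.mulVec_mulVec]
    rfl
  rw [h, hγ]
  split_ifs with hij
  · ext k
    rw [Matrix.smul_mulVec, Matrix.one_mulVec]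
    simp
  · simp

theorem dirac_eq_sum_realMulVec {n N : ℕ} (γ : Fin n → Matrix (Fin N) (Fin N) ℂ)
    (φ : EuclideanSpace ℝ (Fin n) → EuclideanSpace ℂ (Fin N)) (x : EuclideanSpace ℝ (Fin n)) :
    dirac γ φ x = ∑ j, realMulVec (γ j) (fderiv ℝ φ x (EuclideanSpace.single j 1)) := by
  change WithLp.toLp 2 _ = _
  rw [WithLp.toLp_sum]
  rfl

variable {n : ℕ} {F : Type*} [NormedAddCommGroup F] [InnerProductSpace ℝ F]
  {c : EuclideanSpace ℝ (Fin n) →L[ℝ] F →L[ℝ] F}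

theorem exists_norm_diracOp_le_of_ne_zero {Ω : Set (EuclideanSpace ℝ (Fin n))} (hΩ : IsOpen Ω)
    {φ : EuclideanSpace ℝ (Fin n) → F} (hφ : ContDiffOn ℝ 1 φ Ω)
    {x : EuclideanSpace ℝ (Fin n)} (hx : x ∈ Ω) (h0 : φ x ≠ 0) :
    ∃ K : ℝ, ∀ᶠ y in 𝓝 x, ‖diracOp c φ y‖ ≤ K * ‖φ y‖ := by
  have h1 : ContinuousAt φ x := hφ.continuousOn.continuousAt (hΩ.mem_nhds hx)
  have h2 : ContinuousAt (fderiv ℝ φ) x :=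
    (hφ.continuousOn_fderiv_of_isOpen hΩ le_rfl).continuousAt (hΩ.mem_nhds hx)
  have h3 : ContinuousAt (fun y => diracOp c φ y) x := by
    unfold diracOp
    fun_prop
  have h4 : ContinuousAt (fun y => ‖diracOp c φ y‖ / ‖φ y‖) x :=
    h3.norm.div h1.norm (norm_ne_zero_iff.2 h0)
  refine ⟨‖diracOp c φ x‖ / ‖φ x‖ + 1, ?_⟩
  filter_upwards [h4.eventually_lt_const (lt_add_one _), h1.eventually_ne h0] with y hy hy0
  exact (div_le_iff₀ (norm_pos_iff.2 hy0)).1 hy.le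

end Reduction

/-- The nodal set of a nontrivial `C^{1,α}` solution of the Dirac equation
`Dφ = V(φ)`, with `V(0) = 0` and `V` Lipschitz near `0`, has Hausdorff dimension
at most `n - 2`. -/
theorem nodal_set_dimH_le {n N : ℕ} (hn : 2 ≤ n) (hN : 1 ≤ N)
    (γ : Fin n → Matrix (Fin N) (Fin N) ℂ)
    (hγ : ∀ i j, γ i * γ j + γ j * γ i = if i = j then (-2 : ℂ) • 1 else 0)
    (Ω : Set (EuclideanSpace ℝ (Fin n))) (hΩo : IsOpen Ω) (hΩc : IsConnected Ω)
    (α : ℝ) (hα : α ∈ Set.Ioo (0 : ℝ) 1)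
    (φ : EuclideanSpace ℝ (Fin n) → EuclideanSpace ℂ (Fin N))
    (hφ : IsC1Holder α φ Ω)
    (hφne : ∃ x ∈ Ω, φ x ≠ 0)
    (V : EuclideanSpace ℂ (Fin N) → EuclideanSpace ℂ (Fin N))
    (hV0 : V 0 = 0)
    (hVlip : ∃ U ∈ nhds (0 : EuclideanSpace ℂ (Fin N)), ∃ K : NNReal, LipschitzOnWith K V U)
    (heq : ∀ x ∈ Ω, dirac γ φ x = V (φ x)) :
    dimH {x ∈ Ω | φ x = 0} ≤ (n - 2 : ℕ) := by
  obtain ⟨F, _, _, _, e, c, hc, hce⟩ := exists_isCliffordMul (realMulVec_clifford hγ)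
  have hD (x) : diracOp c (e ∘ φ) x = e (dirac γ φ x) := by
    rw [dirac_eq_sum_realMulVec, map_sum, diracOp]
    refine Finset.sum_congr rfl fun j _ => ?_
    rw [e.comp_fderiv, ← hce]
    rfl
  have hφe : ContDiffOn ℝ 1 (e ∘ φ) Ω := e.contDiff.comp_contDiffOn hφ.1
  have hset : {x ∈ Ω | φ x = 0} = {x ∈ Ω | (e ∘ φ) x = 0} := by
    ext x
    simp
  rw [hset]
  refine dimH_zero_le hn hc hΩo hΩc.isPreconnected hφe (fun x hx => ?_)
    (by simpa using hφne)
  by_cases h0 : φ x = 0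
  · obtain ⟨U, hU, K, hK⟩ := hVlip
    have hcont : ContinuousAt φ x := hφ.1.continuousOn.continuousAt (hΩo.mem_nhds hx)
    refine ⟨‖(e : EuclideanSpace ℂ (Fin N) →L[ℝ] F)‖ *
      (K * ‖(e.symm : F →L[ℝ] EuclideanSpace ℂ (Fin N))‖), ?_⟩
    filter_upwards [hΩo.mem_nhds hx, hcont.preimage_mem_nhds (h0.symm ▸ hU)] with y hy hyU
    have h1 : ‖V (φ y)‖ ≤ K * ‖φ y‖ := by
      simpa [hV0] using hK.norm_sub_le hyU (mem_of_mem_nhds hU)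
    have h2 : ‖φ y‖ ≤ ‖(e.symm : F →L[ℝ] EuclideanSpace ℂ (Fin N))‖ * ‖e (φ y)‖ := by
      simpa using (e.symm : F →L[ℝ] EuclideanSpace ℂ (Fin N)).le_opNorm (e (φ y))
    rw [hD, heq y hy]
    calc ‖e (V (φ y))‖ ≤ ‖(e : EuclideanSpace ℂ (Fin N) →L[ℝ] F)‖ * ‖V (φ y)‖ :=
          (e : EuclideanSpace ℂ (Fin N) →L[ℝ] F).le_opNorm _
      _ ≤ ‖(e : EuclideanSpace ℂ (Fin N) →L[ℝ] F)‖ *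
            (K * (‖(e.symm : F →L[ℝ] EuclideanSpace ℂ (Fin N))‖ * ‖e (φ y)‖)) := by
          gcongr
          exact h1.trans (by gcongr)
      _ = _ := by
          simp only [Function.comp_apply]
          ring
  · exact exists_norm_diracOp_le_of_ne_zero hΩo hφe hx (by simpa using h0)
end

section
/- Let A: ℝⁿ → ℂ^N be a real-linear map satisfying Σ_{j=1}^n γ_j (A e_j) = 0, where (e_j) is the standard basis of ℝⁿ. If the rank of A as a real-linear map (viewing ℂ^N as ℝ^{2N}) is at most 1, then A = 0. Equivalently, every nonzero real-linear solution A of Σ_j γ_j (A e_j) = 0 has real rank at least 2. -/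
/-- Clifford multiplication by `c` squares to `-∑ j, c j ^ 2`; doubled to avoid a division. -/
theorem two_smul_clifford_mul_self {n N : ℕ} (γ : Fin n → Matrix (Fin N) (Fin N) ℂ)
    (hγ : ∀ i j, γ i * γ j + γ j * γ i = if i = j then (-2 : ℂ) • 1 else 0) (c : Fin n → ℂ) :
    (2 : ℂ) • ((∑ j, c j • γ j) * ∑ j, c j • γ j) =
      (-2 * ∑ j, c j ^ 2) • (1 : Matrix (Fin N) (Fin N) ℂ) := by
  have h : (∑ j, c j • γ j) * ∑ j, c j • γ j = ∑ i, ∑ j, (c i * c j) • (γ i * γ j) := by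
    simp only [Finset.sum_mul_sum, smul_mul_smul_comm]
  have h' : (∑ j, c j • γ j) * ∑ j, c j • γ j = ∑ i, ∑ j, (c i * c j) • (γ j * γ i) := by
    rw [h, Finset.sum_comm]
    simp only [mul_comm (c _) (c _)]
  rw [two_smul]
  nth_rewrite 1 [h]
  rw [h']
  simp only [← Finset.sum_add_distrib, ← smul_add, hγ, smul_ite, smul_zero, Finset.sum_ite_eq,
    Finset.mem_univ, if_true, smul_smul, ← Finset.sum_smul, ← Finset.sum_mul]
  congr 1
  simp only [← pow_two, mul_comm]

/-- Clifford multiplication by a nonzero real vector is injective. -/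
theorem eq_zero_or_eq_zero_of_clifford_mulVec_eq_zero {n N : ℕ}
    (γ : Fin n → Matrix (Fin N) (Fin N) ℂ)
    (hγ : ∀ i j, γ i * γ j + γ j * γ i = if i = j then (-2 : ℂ) • 1 else 0) (c : Fin n → ℝ)
    (v : Fin N → ℂ) (h : (∑ j, (c j : ℂ) • γ j).mulVec v = 0) : c = 0 ∨ v = 0 := by
  have hsq := congrArg (fun M => M.mulVec v) (two_smul_clifford_mul_self γ hγ fun j => (c j : ℂ))
  simp only [Matrix.smul_mulVec, ← Matrix.mulVec_mulVec, h, Matrix.mulVec_zero, smul_zero,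
    Matrix.one_mulVec] at hsq
  refine (smul_eq_zero.mp hsq.symm).imp_left fun h0 => ?_
  have hsum : ∑ j, c j ^ 2 = 0 := by
    have := (mul_eq_zero.mp h0).resolve_left (by norm_num)
    exact_mod_cast this
  funext j
  exact pow_eq_zero_iff two_ne_zero |>.mp
    ((Finset.sum_eq_zero_iff_of_nonneg fun i _ => sq_nonneg (c i)).mp hsum j (Finset.mem_univ j))

/-- A real-linear map `A : ℝⁿ → ℂ^N` with `Σ_j γ_j (A e_j) = 0` is zero as soon as its real
rank is at most 1; equivalently, nonzero solutions have real rank at least 2. -/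
theorem rank_ge_two_of_dirac_linear {n N : ℕ} (hn : 2 ≤ n) (hN : 1 ≤ N)
    (γ : Fin n → Matrix (Fin N) (Fin N) ℂ)
    (hγ : ∀ i j, γ i * γ j + γ j * γ i = if i = j then (-2 : ℂ) • 1 else 0)
    (A : EuclideanSpace ℝ (Fin n) →ₗ[ℝ] EuclideanSpace ℂ (Fin N))
    (hA : ((WithLp.equiv 2 (Fin N → ℂ)).symm
        (∑ j, (γ j).mulVec (WithLp.equiv 2 (Fin N → ℂ) (A (EuclideanSpace.single j 1))))
        : EuclideanSpace ℂ (Fin N)) = 0) :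
    (Module.finrank ℝ (LinearMap.range A) ≤ 1 → A = 0) ∧
    (A ≠ 0 → 2 ≤ Module.finrank ℝ (LinearMap.range A)) := by
  have key : Module.finrank ℝ (LinearMap.range A) ≤ 1 → A = 0 := by
    intro hr
    obtain ⟨v, hv⟩ := finrank_le_one_iff.mp hr
    choose c hc using fun j => hv ⟨A (EuclideanSpace.single j 1), LinearMap.mem_range_self A _⟩
    have hAc (j : Fin n) : A (EuclideanSpace.single j 1) = c j • (v : EuclideanSpace ℂ (Fin N)) :=
      (congrArg Subtype.val (hc j)).symm
    have hM : (∑ j, (c j : ℂ) • γ j).mulVec (WithLp.ofLp (v : EuclideanSpace ℂ (Fin N))) = 0 := by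
      have h := congrArg WithLp.ofLp hA
      simp only [WithLp.equiv_symm_apply, WithLp.equiv_apply, WithLp.ofLp_zero, hAc,
        WithLp.ofLp_smul, Matrix.mulVec_smul] at h
      rw [Matrix.sum_mulVec, ← h]
      refine Finset.sum_congr rfl fun j _ => ?_
      rw [Matrix.smul_mulVec, Complex.coe_smul]
    have hzero (j : Fin n) : A (EuclideanSpace.single j 1) = 0 := by
      rw [hAc]
      rcases eq_zero_or_eq_zero_of_clifford_mulVec_eq_zero γ hγ c _ hM with h | h
      · simp [h]
      · rw [(WithLp.ofLp_eq_zero 2).mp h, smul_zero]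
    refine (EuclideanSpace.basisFun (Fin n) ℝ).toBasis.ext fun j => ?_
    simpa using hzero j
  refine ⟨key, fun h => ?_⟩
  by_contra! hlt
  exact h (key (by omega))
end

section
/- Let Ω ⊆ ℝⁿ be open, α ∈ (0,1), and let φ: Ω → ℂ^N be a map of class C^{1,α} satisfying Dφ(x) = V(φ(x)) for all x ∈ Ω, where V: ℂ^N → ℂ^N satisfies V(0) = 0. If x₀ ∈ Ω is a point with φ(x₀) = 0 at which the differential dφ(x₀): ℝⁿ → ℂ^N is nonzero, then dφ(x₀) has real rank at least 2; in particular there exist two ℝ-valued component functions of φ (among the real and imaginary parts of its N complex components) whose gradients at x₀ are linearly independent. -/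
open MeasureTheory

/-- A real component (real or imaginary part of a complex component) of `φ`. -/
def realComponent {n N : ℕ} (φ : EuclideanSpace ℝ (Fin n) → EuclideanSpace ℂ (Fin N))
    (j : Fin N) (b : Bool) (x : EuclideanSpace ℝ (Fin n)) : ℝ :=
  if b then (φ x j).re else (φ x j).im

/-- The square of a real linear combination of Clifford generators is minus the sum of squares. -/
lemma sum_smul_mul_self_of_clifford {ι m : Type*} [Fintype ι] [DecidableEq ι] [Fintype m]
    [DecidableEq m] (γ : ι → Matrix m m ℂ)
    (hγ : ∀ i j, γ i * γ j + γ j * γ i = if i = j then (-2 : ℂ) • 1 else 0) (c : ι → ℝ) :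
    (∑ j, (c j : ℂ) • γ j) * (∑ j, (c j : ℂ) • γ j)
      = (-((∑ j, c j ^ 2 : ℝ) : ℂ)) • (1 : Matrix m m ℂ) := by
  have expand : (∑ j, (c j : ℂ) • γ j) * (∑ j, (c j : ℂ) • γ j)
      = ∑ i, ∑ j, ((c i : ℂ) * c j) • (γ i * γ j) := by
    rw [Finset.sum_mul_sum]
    exact Finset.sum_congr rfl fun i _ => Finset.sum_congr rfl fun j _ => smul_mul_smul_comm ..
  have swap : ∑ i, ∑ j, ((c i : ℂ) * c j) • (γ i * γ j)
      = ∑ i, ∑ j, ((c i : ℂ) * c j) • (γ j * γ i) := by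
    rw [Finset.sum_comm]
    exact Finset.sum_congr rfl fun i _ => Finset.sum_congr rfl fun j _ => by
      rw [mul_comm (c j : ℂ)]
  have double : (2 : ℂ) • ((∑ j, (c j : ℂ) • γ j) * (∑ j, (c j : ℂ) • γ j))
      = (2 : ℂ) • ((-((∑ j, c j ^ 2 : ℝ) : ℂ)) • (1 : Matrix m m ℂ)) := by
    rw [two_smul ℂ (_ * _)]
    nth_rewrite 2 [expand]
    rw [swap, expand]
    simp only [← Finset.sum_add_distrib, ← smul_add, hγ, smul_ite, smul_zero,
      Finset.sum_ite_eq, Finset.mem_univ, if_true, smul_smul]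
    rw [← Finset.sum_smul]
    congr 1
    push_cast
    rw [← Finset.sum_neg_distrib, Finset.mul_sum]
    exact Finset.sum_congr rfl fun i _ => by ring
  exact smul_right_injective _ (two_ne_zero (α := ℂ)) double

/-- Clifford multiplication by a nonzero real vector is injective. -/
lemma eq_zero_of_sum_mulVec_smul_eq_zero {ι m : Type*} [Fintype ι] [DecidableEq ι] [Fintype m]
    [DecidableEq m] (γ : ι → Matrix m m ℂ)
    (hγ : ∀ i j, γ i * γ j + γ j * γ i = if i = j then (-2 : ℂ) • 1 else 0)
    (c : ι → ℝ) (w : m → ℂ) (hw : w ≠ 0)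
    (h : ∑ j, (γ j).mulVec (c j • w) = 0) (j : ι) : c j = 0 := by
  have hG : (∑ j, (c j : ℂ) • γ j).mulVec w = 0 := by
    rw [← h, Matrix.sum_mulVec]
    refine Finset.sum_congr rfl fun i _ => ?_
    rw [Matrix.smul_mulVec, Matrix.mulVec_smul, Complex.coe_smul]
  have hsq := congrArg (fun A => A.mulVec w) (sum_smul_mul_self_of_clifford γ hγ c)
  simp only [← Matrix.mulVec_mulVec, hG, Matrix.mulVec_zero, Matrix.smul_mulVec,
    Matrix.one_mulVec] at hsq
  have hsum : ∑ j, c j ^ 2 = 0 := by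
    simpa only [neg_eq_zero, Complex.ofReal_eq_zero] using
      (smul_eq_zero.mp hsq.symm).resolve_right hw
  exact pow_eq_zero_iff two_ne_zero |>.mp
    ((Finset.sum_eq_zero_iff_of_nonneg fun i _ => sq_nonneg (c i)).mp hsum j (Finset.mem_univ j))

/-- A real-linear map in the kernel of the Dirac symbol whose range lies on a real line is zero. -/
lemma eq_zero_of_clifford_of_range_line {n N : ℕ} (γ : Fin n → Matrix (Fin N) (Fin N) ℂ)
    (hγ : ∀ i j, γ i * γ j + γ j * γ i = if i = j then (-2 : ℂ) • 1 else 0)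
    (L : EuclideanSpace ℝ (Fin n) →L[ℝ] EuclideanSpace ℂ (Fin N))
    (hL : ∑ j, (γ j).mulVec (L (EuclideanSpace.single j 1)).ofLp = 0)
    (w : EuclideanSpace ℂ (Fin N)) (hw : ∀ v, ∃ c : ℝ, L v = c • w) : L = 0 := by
  have ext_basis (h : ∀ j, L (EuclideanSpace.single j 1) = 0) : L = 0 := by
    refine ContinuousLinearMap.coe_injective
      ((EuclideanSpace.basisFun (Fin n) ℝ).toBasis.ext fun j => ?_)
    simpa using h j
  choose c hc using fun j => hw (EuclideanSpace.single j 1)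
  refine ext_basis fun j => ?_
  rcases eq_or_ne w 0 with rfl | hw0
  · rw [hc j, smul_zero]
  · have hcj : c j = 0 := eq_zero_of_sum_mulVec_smul_eq_zero γ hγ c w.ofLp
      (fun h => hw0 (WithLp.ofLp_injective 2 h)) (by simpa only [hc, WithLp.ofLp_smul] using hL) j
    rw [hc j, hcj, zero_smul]

lemma fderiv_realComponent_apply {n N : ℕ}
    {φ : EuclideanSpace ℝ (Fin n) → EuclideanSpace ℂ (Fin N)} {x : EuclideanSpace ℝ (Fin n)}
    (hφ : DifferentiableAt ℝ φ x) (j : Fin N) (b : Bool) (v : EuclideanSpace ℝ (Fin n)) :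
    fderiv ℝ (realComponent φ j b) x v
      = if b then (fderiv ℝ φ x v j).re else (fderiv ℝ φ x v j).im := by
  have hj : HasFDerivAt (fun y => φ y j)
      (((EuclideanSpace.proj j : EuclideanSpace ℂ (Fin N) →L[ℂ] ℂ).restrictScalars ℝ).comp
        (fderiv ℝ φ x)) x :=
    ((EuclideanSpace.proj j : EuclideanSpace ℂ (Fin N) →L[ℂ] ℂ).restrictScalars ℝ).hasFDerivAt.comp
      x hφ.hasFDerivAt
  cases b
  · have h : HasFDerivAt (realComponent φ j false) _ x := Complex.imCLM.hasFDerivAt.comp x hj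
    rw [h.fderiv]
    rfl
  · have h : HasFDerivAt (realComponent φ j true) _ x := Complex.reCLM.hasFDerivAt.comp x hj
    rw [h.fderiv]
    rfl

/-- At a zero of a `C^{1,α}` solution of `Dφ = V(φ)` where the differential does not vanish,
the differential has real rank at least two; in particular two real components of `φ` have
linearly independent gradients there. -/
theorem differential_rank_ge_two {n N : ℕ} (hn : 2 ≤ n) (hN : 1 ≤ N)
    (γ : Fin n → Matrix (Fin N) (Fin N) ℂ)
    (hγ : ∀ i j, γ i * γ j + γ j * γ i = if i = j then (-2 : ℂ) • 1 else 0)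
    (Ω : Set (EuclideanSpace ℝ (Fin n))) (hΩo : IsOpen Ω)
    (α : ℝ) (hα : α ∈ Set.Ioo (0 : ℝ) 1)
    (φ : EuclideanSpace ℝ (Fin n) → EuclideanSpace ℂ (Fin N))
    (hφ : IsC1Holder α φ Ω)
    (V : EuclideanSpace ℂ (Fin N) → EuclideanSpace ℂ (Fin N))
    (hV0 : V 0 = 0)
    (heq : ∀ x ∈ Ω, dirac γ φ x = V (φ x))
    (x₀ : EuclideanSpace ℝ (Fin n)) (hx₀ : x₀ ∈ Ω) (hzero : φ x₀ = 0)
    (hdne : fderiv ℝ φ x₀ ≠ 0) :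
    2 ≤ Module.finrank ℝ (LinearMap.range ((fderiv ℝ φ x₀ :
        EuclideanSpace ℝ (Fin n) →ₗ[ℝ] EuclideanSpace ℂ (Fin N)))) ∧
    ∃ (j₁ j₂ : Fin N) (b₁ b₂ : Bool),
      LinearIndependent ℝ
        ![fderiv ℝ (realComponent φ j₁ b₁) x₀, fderiv ℝ (realComponent φ j₂ b₂) x₀] := by
  have hd : DifferentiableAt ℝ φ x₀ :=
    (hφ.1.differentiableOn one_ne_zero).differentiableAt (hΩo.mem_nhds hx₀)
  have hL : ∑ j, (γ j).mulVec (fderiv ℝ φ x₀ (EuclideanSpace.single j 1)).ofLp = 0 := by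
    have h := heq x₀ hx₀
    rw [hzero, hV0] at h
    exact congrArg WithLp.ofLp h
  refine ⟨?_, ?_⟩
  · by_contra! hlt
    obtain ⟨w, hw⟩ := finrank_le_one_iff.mp (Nat.lt_succ_iff.mp hlt)
    refine hdne (eq_zero_of_clifford_of_range_line γ hγ _ hL w fun v => ?_)
    obtain ⟨c, hc⟩ := hw ⟨fderiv ℝ φ x₀ v, v, rfl⟩
    exact ⟨c, (congrArg Subtype.val hc).symm⟩
  · by_contra! hdep
    obtain ⟨j₀, b₀, hne⟩ : ∃ j b, fderiv ℝ (realComponent φ j b) x₀ ≠ 0 := by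
      by_contra! hall
      refine hdne (ContinuousLinearMap.ext fun v => PiLp.ext fun j => Complex.ext ?_ ?_)
      · simpa [hall] using (fderiv_realComponent_apply hd j true v).symm
      · simpa [hall] using (fderiv_realComponent_apply hd j false v).symm
    have hprop (j : Fin N) (b : Bool) : ∃ a : ℝ,
        a • fderiv ℝ (realComponent φ j₀ b₀) x₀ = fderiv ℝ (realComponent φ j b) x₀ := by
      simpa [LinearIndependent.pair_iff' hne] using hdep j₀ j b₀ b
    choose a ha using hprop
    refine hdne (eq_zero_of_clifford_of_range_line γ hγ _ hL
      (WithLp.toLp 2 fun j => ⟨a j true, a j false⟩) fun v =>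
        ⟨fderiv ℝ (realComponent φ j₀ b₀) x₀ v, PiLp.ext fun j => Complex.ext ?_ ?_⟩)
    · have h := fderiv_realComponent_apply hd j true v
      rw [← ha] at h
      simpa [mul_comm] using h.symm
    · have h := fderiv_realComponent_apply hd j false v
      rw [← ha] at h
      simpa [mul_comm] using h.symm
end

section
/- Let n ≥ 2, m ≥ 1, k ≥ 1, and let P: ℝⁿ → ℝ^m be a map each of whose components is a homogeneous polynomial of degree k. Define L = { y ∈ ℝⁿ : all partial derivatives ∂^β P^j(y) of order |β| ≤ k−1 of all components P^j vanish at y }. Then L is a linear subspace of ℝⁿ, and P is invariant under translations by L: P(x + y) = P(x) for all x ∈ ℝⁿ and all y ∈ L. -/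
open Filter Topology

/-- All derivatives of order `< k` of a smooth, positively `k`-homogeneous map vanish at `0`. -/
theorem iteratedFDeriv_zero_of_homogeneous {E F : Type*} [NormedAddCommGroup E] [NormedSpace ℝ E]
    [NormedAddCommGroup F] [NormedSpace ℝ F] {k i : ℕ} (hik : i < k) {P : E → F}
    (hP : ContDiff ℝ i P) (hhom : ∀ t : ℝ, 0 < t → ∀ x, P (t • x) = t ^ k • P x) :
    iteratedFDeriv ℝ i P 0 = 0 := by
  have h1 := iteratedFDeriv_const_smul_apply (i := i) (a := (2 : ℝ) ^ k) (x := (0 : E))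
    hP.contDiffAt
  have h2 := ((2 : ℝ) • ContinuousLinearMap.id ℝ E).iteratedFDeriv_comp_right hP 0 le_rfl
  have h3 : P ∘ ((2 : ℝ) • ContinuousLinearMap.id ℝ E) = (2 : ℝ) ^ k • P := by
    ext x
    simp [hhom 2 two_pos x]
  rw [h3, h1] at h2
  ext v
  have h4 := congrArg (fun f => f v) h2
  simp only [smul_apply, map_zero,
    ContinuousMultilinearMap.compContinuousLinearMap_apply,
    ContinuousLinearMap.id_apply] at h4
  rw [ContinuousMultilinearMap.map_smul_univ] at h4
  simp only [Finset.prod_const, Finset.card_univ, Fintype.card_fin] at h4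
  have h5 : ((2 : ℝ) ^ k - 2 ^ i) • iteratedFDeriv ℝ i P 0 v = 0 := by
    rw [sub_smul, h4, sub_self]
  have h6 : (2 : ℝ) ^ k - 2 ^ i ≠ 0 :=
    (sub_pos.2 (pow_lt_pow_right₀ one_lt_two hik)).ne'
  simpa using (smul_eq_zero.1 h5).resolve_left h6

/-- The restriction of a multivariate polynomial to the line `s ↦ a + s b`. -/
noncomputable def MvPolynomial.restrictLine {σ : Type*} (p : MvPolynomial σ ℝ) (a b : σ → ℝ) :
    Polynomial ℝ :=
  MvPolynomial.aeval (fun l => Polynomial.C (a l) + Polynomial.X * Polynomial.C (b l)) p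

theorem MvPolynomial.eval_restrictLine {σ : Type*} (p : MvPolynomial σ ℝ) (a b : σ → ℝ) (s : ℝ) :
    (p.restrictLine a b).eval s = MvPolynomial.eval (fun l => a l + s * b l) p := by
  have h := MvPolynomial.map_aeval
    (fun l => Polynomial.C (a l) + Polynomial.X * Polynomial.C (b l)) (Polynomial.evalRingHom s) p
  simp only [Polynomial.coe_evalRingHom] at h
  rw [MvPolynomial.restrictLine, h, MvPolynomial.eval, MvPolynomial.coe_eval₂Hom,
    MvPolynomial.coe_eval₂Hom]
  congr 1
  · ext; simp
  · ext; simp; ring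

theorem MvPolynomial.contDiff_eval_euclidean {ι : Type*} [Fintype ι] (p : MvPolynomial ι ℝ)
    {r : WithTop ℕ∞} :
    ContDiff ℝ r (fun x : EuclideanSpace ℝ ι => MvPolynomial.eval (fun l => x l) p) := by
  induction p using MvPolynomial.induction_on with
  | C a => simpa using contDiff_const
  | add p q hp hq => simpa using hp.add hq
  | mul_X p i hp =>
    have hi : ContDiff ℝ r (fun x : EuclideanSpace ℝ ι => x i) :=
      (EuclideanSpace.proj i : EuclideanSpace ℝ ι →L[ℝ] ℝ).contDiff
    simpa using hp.mul hi

theorem Polynomial.iteratedDeriv_eval (G : Polynomial ℝ) (i : ℕ) :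
    iteratedDeriv i (fun s => G.eval s) = fun s => (Polynomial.derivative^[i] G).eval s := by
  induction i with
  | zero => simp
  | succ i ih =>
    rw [iteratedDeriv_succ, ih, Function.iterate_succ_apply']
    ext s
    simp

theorem Polynomial.X_pow_dvd_of_iteratedDeriv_eq_zero {G : Polynomial ℝ} {k : ℕ}
    (h : ∀ i < k, iteratedDeriv i (fun s => G.eval s) 0 = 0) : Polynomial.X ^ k ∣ G := by
  rw [Polynomial.X_pow_dvd_iff]
  intro i hi
  have h1 := h i hi
  rw [Polynomial.iteratedDeriv_eval] at h1
  simp only [← Polynomial.coeff_zero_eq_eval_zero, Polynomial.coeff_iterate_derivative, zero_add,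
    Nat.descFactorial_self, nsmul_eq_mul] at h1
  exact (mul_eq_zero.1 h1).resolve_left (by exact_mod_cast i.factorial_ne_zero)

theorem iteratedDeriv_line_eq_zero {E F : Type*} [NormedAddCommGroup E] [NormedSpace ℝ E]
    [NormedAddCommGroup F] [NormedSpace ℝ F] {i : ℕ} {f : E → F} (hf : ContDiff ℝ i f) {y : E}
    (hy : iteratedFDeriv ℝ i f y = 0) (x : E) :
    iteratedDeriv i (fun s : ℝ => f (y + s • x)) 0 = 0 := by
  have hf' : ContDiff ℝ i (fun z => f (y + z)) := hf.comp (contDiff_const.add contDiff_id)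
  have h := (ContinuousLinearMap.toSpanSingleton ℝ x).iteratedFDeriv_comp_right hf' 0 le_rfl
  have h' : (fun s : ℝ => f (y + s • x)) =
      (fun z => f (y + z)) ∘ ContinuousLinearMap.toSpanSingleton ℝ x := by
    ext s; simp
  rw [iteratedDeriv_eq_iteratedFDeriv, h', h, iteratedFDeriv_comp_add_left]
  simp [hy]

/-- A positively `k`-homogeneous polynomial function is invariant under translation by any point
at which all its derivatives of order `< k` vanish. -/
theorem add_eq_of_iteratedFDeriv_eq_zero {n k : ℕ} {f : EuclideanSpace ℝ (Fin n) → ℝ}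
    (hf : ContDiff ℝ ⊤ f) {p : MvPolynomial (Fin n) ℝ}
    (hp : ∀ x, f x = MvPolynomial.eval (fun l => x l) p)
    (hhom : ∀ t : ℝ, 0 < t → ∀ x, f (t • x) = t ^ k * f x) {y : EuclideanSpace ℝ (Fin n)}
    (hy : ∀ i < k, iteratedFDeriv ℝ i f y = 0) (x : EuclideanSpace ℝ (Fin n)) :
    f (x + y) = f x := by
  have key : ∀ a b : EuclideanSpace ℝ (Fin n), ∀ s : ℝ,
      (p.restrictLine a b).eval s = f (a + s • b) := fun a b s => by
    rw [MvPolynomial.eval_restrictLine, hp]; simp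
  obtain ⟨H, hH⟩ : Polynomial.X ^ k ∣ p.restrictLine y x := by
    refine Polynomial.X_pow_dvd_of_iteratedDeriv_eq_zero fun i hi => ?_
    simp only [key]
    exact iteratedDeriv_line_eq_zero (hf.of_le le_top) (hy i hi) x
  have hlim : Tendsto (fun t => (p.restrictLine x y).eval t) atTop (𝓝 (H.eval 0)) := by
    have h1 : Tendsto (fun t : ℝ => H.eval t⁻¹) atTop (𝓝 (H.eval 0)) :=
      (H.continuous.tendsto 0).comp tendsto_inv_atTop_zero
    refine h1.congr' ?_
    filter_upwards [eventually_gt_atTop 0] with t ht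
    have h2 : x + t • y = t • (y + t⁻¹ • x) := by
      rw [smul_add, smul_inv_smul₀ ht.ne', add_comm]
    rw [key, h2, hhom t ht, ← key, hH, Polynomial.eval_mul, Polynomial.eval_pow, Polynomial.eval_X,
      ← mul_assoc, ← mul_pow, mul_inv_cancel₀ ht.ne', one_pow, one_mul]
  have hconst := Polynomial.eq_C_of_degree_le_zero (Polynomial.tendsto_nhds_iff _ |>.1 hlim).2
  have h0 := key x y 0
  have h1 := key x y 1
  rw [hconst, Polynomial.eval_C] at h0 h1
  simpa using h1.symm.trans h0

/-- For a map `P : ℝⁿ → ℝ^m` whose components are homogeneous polynomials of degree `k`,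
the set `L` of points where all derivatives of order `≤ k-1` vanish is a linear subspace,
and `P` is invariant under translations by elements of `L`. -/
theorem homogeneous_poly_invariance {n m k : ℕ} (hn : 2 ≤ n) (hm : 1 ≤ m) (hk : 1 ≤ k)
    (P : EuclideanSpace ℝ (Fin n) → EuclideanSpace ℝ (Fin m))
    (hpoly : ∀ i : Fin m, ∃ p : MvPolynomial (Fin n) ℝ,
      ∀ x, P x i = MvPolynomial.eval (fun l => x l) p)
    (hhom : ∀ t : ℝ, 0 < t → ∀ x, P (t • x) = t ^ k • P x)
    (L : Set (EuclideanSpace ℝ (Fin n)))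
    (hL : L = {y | ∀ i ≤ k - 1, iteratedFDeriv ℝ i P y = 0}) :
    (∃ L' : Submodule ℝ (EuclideanSpace ℝ (Fin n)), (L' : Set (EuclideanSpace ℝ (Fin n))) = L) ∧
    ∀ y ∈ L, ∀ x, P (x + y) = P x := by
  have hcoord : ∀ j, ContDiff ℝ ⊤ (fun x => P x j) := fun j => by
    obtain ⟨p, hp⟩ := hpoly j
    simpa only [hp] using p.contDiff_eval_euclidean
  have hP : ContDiff ℝ ⊤ P := contDiff_euclidean.2 hcoord
  have hinv : ∀ y ∈ L, ∀ x, P (x + y) = P x := by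
    intro y hy x
    rw [hL] at hy
    ext j
    obtain ⟨p, hp⟩ := hpoly j
    refine add_eq_of_iteratedFDeriv_eq_zero (f := fun x => P x j) (k := k) (hcoord j) hp
      (fun t ht x => by simp [hhom t ht x]) (fun i hi => ?_) x
    have h := (EuclideanSpace.proj (𝕜 := ℝ) j : EuclideanSpace ℝ (Fin m) →L[ℝ] ℝ).iteratedFDeriv_comp_left
      (hP.contDiffAt (x := y)) (i := i) le_top
    rw [hy i (by omega)] at h
    refine Eq.trans h ?_
    ext v
    simp
  have hmem : ∀ y, (∀ x, P (x + y) = P x) → y ∈ L := by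
    intro y hy
    rw [hL]
    intro i hi
    have h := iteratedFDeriv_comp_add_right (𝕜 := ℝ) (f := P) i y 0
    simp only [hy, zero_add] at h
    rw [← h]
    exact iteratedFDeriv_zero_of_homogeneous (by omega) (hP.of_le le_top) hhom
  have hpos : ∀ t : ℝ, 0 < t → ∀ y ∈ L, ∀ x, P (x + t • y) = P x := by
    intro t ht y hy x
    have h := hinv y hy (t⁻¹ • x)
    have h1 := hhom t ht (t⁻¹ • x + y)
    rw [h, ← hhom t ht, smul_add, smul_inv_smul₀ ht.ne'] at h1
    exact h1
  have hneg : ∀ y, (∀ x, P (x + y) = P x) → ∀ x, P (x + -y) = P x := fun y hy x => by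
    rw [← hy (x + -y), neg_add_cancel_right]
  refine ⟨⟨{ carrier := L, zero_mem' := ?_, add_mem' := ?_, smul_mem' := ?_ }, rfl⟩, hinv⟩
  · intro a b ha hb
    exact hmem _ fun x => by rw [← add_assoc, hinv b hb, hinv a ha]
  · exact hmem _ fun x => by rw [add_zero]
  · intro c y hy
    refine hmem _ ?_
    rcases lt_trichotomy c 0 with hc | rfl | hc
    · have h := hneg _ (hpos (-c) (neg_pos.2 hc) y hy)
      simpa using h
    · simp
    · exact hpos c hc y hy
end
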